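/- arXiv:1308.3143 — 2 statements merged into one kernel-verified Lean document; each statement's English description precedes it below -/
import Mathlib

section
/- If K_1, …, K_p are dust-like graph-directed sets with ratio r ∈ (0,1) and integer characteristic m ≥ 2, then each set K_i (i = 1, …, p) is bilipschitz equivalent to the symbolic space Σ_m^r. -/
open scoped Classical

/-- The symbolic space metric on `ℕ → Fin m`: `d(x,y) = r ^ (min {k | x k ≠ y k})`
for `x ≠ y`, and `d(x,x) = 0`. -/
noncomputable def symbDist (r : ℝ) {m : ℕ} (x y : ℕ → Fin m) : ℝ :=
  if x = y then 0 else r ^ sInf {k : ℕ | x k ≠ y k}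

/-- `K` (a subset of a metric space) is bilipschitz equivalent to the symbolic
space `Σ_m^r`. -/
def BilipWithSymb {X : Type*} [MetricSpace X] (K : Set X) (m : ℕ) (r : ℝ) : Prop :=
  ∃ f : K → (ℕ → Fin m), Function.Bijective f ∧ ∃ C : ℝ, 1 ≤ C ∧ ∀ x y : K,
    C⁻¹ * dist x y ≤ symbDist r (f x) (f y) ∧ symbDist r (f x) (f y) ≤ C * dist x y

/-- `K ⊆ X` and `K' ⊆ X'` are bilipschitz equivalent (as metric spaces with the
induced metrics). -/
def BilipEquivSets {X Y : Type*} [MetricSpace X] [MetricSpace Y]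
    (K : Set X) (K' : Set Y) : Prop :=
  ∃ f : K → K', Function.Bijective f ∧ ∃ C : ℝ, 1 ≤ C ∧ ∀ x y : K,
    C⁻¹ * dist x y ≤ dist (f x) (f y) ∧ dist (f x) (f y) ≤ C * dist x y

/-- Dust-like graph-directed sets with ratio `r` on a directed graph with `p`
vertices, where `a i j` is the number of edges from `i` to `j`:
nonempty compact sets `K i` with `K i = ⋃_j ⋃_{e : Fin (a i j)} S i j e '' (K j)`,
the union being pairwise disjoint, each `S i j e` a similitude of ratio `r`. -/
structure GraphDirected (X : Type*) [MetricSpace X] (p : ℕ) (r : ℝ) where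
  a : Fin p → Fin p → ℕ
  S : ∀ i j : Fin p, Fin (a i j) → X → X
  sim : ∀ i j e x y, dist (S i j e x) (S i j e y) = r * dist x y
  K : Fin p → Set X
  nonempty : ∀ i, (K i).Nonempty
  compact : ∀ i, IsCompact (K i)
  union : ∀ i, K i = ⋃ j, ⋃ e, S i j e '' K j
  disj : ∀ i : Fin p, ∀ j j' : Fin p, ∀ e : Fin (a i j), ∀ e' : Fin (a i j'),
    (⟨j, e⟩ : Σ j, Fin (a i j)) ≠ ⟨j', e'⟩ →
    Disjoint (S i j e '' K j) (S i j' e' '' K j')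

/-- The family has integer characteristic `m`: there is a positive vector `v`
with `A v = m v`, `A` being the adjacency matrix. -/
def GraphDirected.HasCharacteristic {X : Type*} [MetricSpace X] {p : ℕ} {r : ℝ}
    (G : GraphDirected X p r) (m : ℕ) : Prop :=
  ∃ v : Fin p → ℝ, (∀ i, 0 < v i) ∧ ∀ i, ∑ j, (G.a i j : ℝ) * v j = (m : ℝ) * v i

/-- `K` belongs to the class `𝔄_m^r`: `K = K_1` for some dust-like
graph-directed sets `{K_1, …, K_p}` with ratio `r` and integer characteristic `m`. -/
def MemGDClass {X : Type*} [MetricSpace X] (K : Set X) (r : ℝ) (m : ℕ) : Prop :=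
  ∃ (p : ℕ) (hp : 0 < p) (G : GraphDirected X p r),
    G.HasCharacteristic m ∧ K = G.K ⟨0, hp⟩

/-- `U` is parametrised by the symbolic space at scale `s` with constant `C`. -/
def GDGood {X : Type*} [MetricSpace X] (M : ℕ) (R C s : ℝ) (U : Set X) : Prop :=
  ∃ g : (ℕ → Fin M) → X, Set.range g = U ∧ ∀ x y : ℕ → Fin M, ∀ k : ℕ,
    (∀ i < k, x i = y i) → x k ≠ y k →
      s * R ^ k ≤ C * dist (g x) (g y) ∧ dist (g x) (g y) ≤ C * (s * R ^ k)

def GDIsGood {X : Type*} [MetricSpace X] (M : ℕ) (R : ℝ) (U : Set X) : Prop :=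
  ∃ C : ℝ, 0 < C ∧ GDGood M R C 1 U

theorem gd_firstdiff {α : Type*} {x y : ℕ → α} (h : x ≠ y) :
    ∃ k, (∀ i < k, x i = y i) ∧ x k ≠ y k := by
  have h' : ∃ k, x k ≠ y k := by
    by_contra hh
    push Not at hh
    exact h (funext hh)
  refine ⟨Nat.find h', fun i hi => ?_, Nat.find_spec h'⟩
  by_contra hc
  exact Nat.find_min h' hi hc

section
variable {X : Type*} [MetricSpace X] {M : ℕ} {R : ℝ}

theorem GDGood.mono {C C' s : ℝ} {U : Set X} (hR : 0 < R) (hs : 0 ≤ s) (h : GDGood M R C s U)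
    (hC : C ≤ C') : GDGood M R C' s U := by
  obtain ⟨g, hg, hb⟩ := h
  refine ⟨g, hg, fun x y k h1 h2 => ?_⟩
  obtain ⟨h3, h4⟩ := hb x y k h1 h2
  have : 0 ≤ s * R ^ k := by positivity
  exact ⟨h3.trans (by gcongr), h4.trans (by gcongr)⟩

theorem GDGood.rescale {C s t : ℝ} {U : Set X} (hR : 0 < R) (hs : 0 ≤ s) (hC : 0 ≤ C)
    (h : GDGood M R C s U) (ht : 0 < t) (ht1 : t ≤ 1) : GDGood M R (C / t) (t * s) U := by
  obtain ⟨g, hg, hb⟩ := h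
  refine ⟨g, hg, fun x y k h1 h2 => ?_⟩
  obtain ⟨h3, h4⟩ := hb x y k h1 h2
  have h0 : 0 ≤ s * R ^ k := by positivity
  constructor
  · calc t * s * R ^ k = t * (s * R ^ k) := by ring
      _ ≤ 1 * (s * R ^ k) := by gcongr
      _ ≤ C * dist (g x) (g y) := by rw [one_mul]; exact h3
      _ ≤ C / t * dist (g x) (g y) := by
        gcongr
        rw [le_div_iff₀ ht]
        nlinarith
  · refine h4.trans (le_of_eq ?_)
    field_simp

theorem GDGood.image {C s t : ℝ} {U : Set X} (ht : 0 ≤ t)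
    (h : GDGood M R C s U) (S : X → X) (hS : ∀ x y, dist (S x) (S y) = t * dist x y) :
    GDGood M R C (t * s) (S '' U) := by
  obtain ⟨g, hg, hb⟩ := h
  refine ⟨S ∘ g, by rw [Set.range_comp, hg], fun x y k h1 h2 => ?_⟩
  obtain ⟨h3, h4⟩ := hb x y k h1 h2
  simp only [Function.comp, hS]
  constructor
  · calc t * s * R ^ k = t * (s * R ^ k) := by ring
      _ ≤ t * (C * dist (g x) (g y)) := by gcongr
      _ = _ := by ring
  · calc t * dist (g x) (g y) ≤ t * (C * (s * R ^ k)) := by gcongr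
      _ = _ := by ring

theorem GDGood.nonempty {C s : ℝ} {U : Set X} (hM : 2 ≤ M) (h : GDGood M R C s U) :
    U.Nonempty := by
  obtain ⟨g, hg, hb⟩ := h
  exact ⟨g (fun _ => ⟨0, by omega⟩), by rw [← hg]; exact ⟨_, rfl⟩⟩

theorem GDGood.diam {C s : ℝ} {U : Set X} (hR : 0 < R) (hR1 : R < 1) (hs : 0 ≤ s) (hC : 0 ≤ C)
    (h : GDGood M R C s U) : ∀ x ∈ U, ∀ y ∈ U, dist x y ≤ C * s := by
  obtain ⟨g, rfl, hb⟩ := h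
  rintro _ ⟨x, rfl⟩ _ ⟨y, rfl⟩
  by_cases hxy : x = y
  · subst hxy; simp; positivity
  · obtain ⟨k, h1, h2⟩ := gd_firstdiff hxy
    refine (hb x y k h1 h2).2.trans ?_
    have : R ^ k ≤ 1 := pow_le_one₀ hR.le hR1.le
    gcongr
    nlinarith

theorem GDGood.compact {C s : ℝ} {U : Set X} (hR : 0 < R) (hR1 : R < 1) (hs : 0 < s) (hC : 0 < C)
    (h : GDGood M R C s U) : IsCompact U := by
  obtain ⟨g, rfl, hb⟩ := h
  refine isCompact_range ?_
  rw [continuous_iff_continuousAt]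
  intro x
  rw [Metric.continuousAt_iff']
  intro ε hε
  obtain ⟨n, hn⟩ := exists_pow_lt_of_lt_one (show 0 < ε / (C * s) by positivity) hR1
  have hU : ∀ᶠ y in nhds x, ∀ i ∈ Finset.range n, y i = x i := by
    rw [Filter.eventually_all_finset]
    intro i _
    have hc : Continuous (fun y : ℕ → Fin M => y i) := continuous_apply i
    exact (hc.tendsto x).eventually (by simp : ∀ᶠ z in nhds (x i), z = x i)
  filter_upwards [hU] with y hy
  by_cases hxy : y = x
  · subst hxy; simpa
  · obtain ⟨k, h1, h2⟩ := gd_firstdiff hxy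
    have hk : n ≤ k := by
      by_contra hk
      exact h2 (hy k (by simp; omega))
    refine (hb y x k h1 h2).2.trans_lt ?_
    have h3 : R ^ k ≤ R ^ n := pow_le_pow_of_le_one hR.le hR1.le hk
    rw [lt_div_iff₀ (by positivity)] at hn
    have : C * (s * R ^ k) ≤ C * (s * R ^ n) := by gcongr
    nlinarith

theorem GDGood.split {C s : ℝ} {U : Set X} (h : GDGood M R C s U) :
    ∃ V : Fin M → Set X, U = ⋃ i, V i ∧ (∀ i, GDGood M R C (R * s) (V i)) ∧
      ∀ i j, i ≠ j → ∀ x ∈ V i, ∀ y ∈ V j, s ≤ C * dist x y := by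
  obtain ⟨g, rfl, hb⟩ := h
  let cons : Fin M → (ℕ → Fin M) → (ℕ → Fin M) := fun i x n => Nat.casesOn n i x
  refine ⟨fun i => Set.range (fun x => g (cons i x)), ?_, ?_, ?_⟩
  · ext u
    simp only [Set.mem_range, Set.mem_iUnion]
    constructor
    · rintro ⟨x, rfl⟩
      refine ⟨x 0, fun n => x (n+1), ?_⟩
      congr 1
      funext n
      cases n <;> rfl
    · rintro ⟨i, x, rfl⟩
      exact ⟨_, rfl⟩
  · intro i
    refine ⟨_, rfl, fun x y k h1 h2 => ?_⟩
    have := hb (cons i x) (cons i y) (k+1) (by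
      intro j hj
      cases j with
      | zero => rfl
      | succ j => exact h1 j (by omega)) h2
    rw [pow_succ] at this
    constructor
    · exact le_trans (le_of_eq (by ring)) this.1
    · exact this.2.trans (le_of_eq (by ring))
  · rintro i j hij _ ⟨x, rfl⟩ _ ⟨y, rfl⟩
    have := (hb (cons i x) (cons j y) 0 (by simp) hij).1
    simpa using this

/-- The main construction. -/
theorem gd_family {C : ℝ} (hR : 0 < R) (hR1 : R < 1) (hC : 0 < C)
    (F : Set X → ℝ → Prop)
    (hne : ∀ U s, F U s → U.Nonempty) (hcpt : ∀ U s, F U s → IsCompact U)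
    (hdiam : ∀ U s, F U s → ∀ x ∈ U, ∀ y ∈ U, dist x y ≤ C * s)
    (hdec : ∀ U s, F U s → ∃ V : Fin M → Set X, U = ⋃ i, V i ∧ (∀ i, F (V i) (R * s)) ∧
      ∀ i j, i ≠ j → ∀ x ∈ V i, ∀ y ∈ V j, s ≤ C * dist x y)
    (U : Set X) (s : ℝ) (hU : F U s) : GDGood M R C s U := by
  have hdec' : ∀ U s, ∃ V : Fin M → Set X, F U s → U = ⋃ i, V i ∧ (∀ i, F (V i) (R * s)) ∧
      ∀ i j, i ≠ j → ∀ x ∈ V i, ∀ y ∈ V j, s ≤ C * dist x y := by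
    intro U s
    by_cases h : F U s
    · obtain ⟨V, hV⟩ := hdec U s h
      exact ⟨V, fun _ => hV⟩
    · exact ⟨fun _ => ∅, fun h' => absurd h' h⟩
  choose V hV using hdec'
  let cyl : (ℕ → Fin M) → ℕ → Set X := fun x n =>
    Nat.rec U (fun n W => V W (R ^ n * s) (x n)) n
  have cyl0 : ∀ x, cyl x 0 = U := fun x => rfl
  have cylS : ∀ x n, cyl x (n+1) = V (cyl x n) (R ^ n * s) (x n) := fun x n => rfl
  have cylF : ∀ x n, F (cyl x n) (R ^ n * s) := by
    intro x n
    induction n with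
    | zero => simpa [cyl0] using hU
    | succ n ih =>
      rw [cylS, pow_succ]
      have := (hV _ _ ih).2.1 (x n)
      rwa [show R * (R ^ n * s) = R ^ n * R * s by ring] at this
  have cylsub : ∀ x n, cyl x (n+1) ⊆ cyl x n := by
    intro x n
    rw [cylS]
    conv_rhs => rw [(hV _ _ (cylF x n)).1]
    exact Set.subset_iUnion _ _
  have cylcongr : ∀ x y n, (∀ i < n, x i = y i) → cyl x n = cyl y n := by
    intro x y n
    induction n with
    | zero => intro _; rfl
    | succ n ih =>
      intro h
      rw [cylS, cylS, ih (fun i hi => h i (by omega)), h n (by omega)]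
  have hint : ∀ x, (⋂ n, cyl x n).Nonempty := fun x =>
    IsCompact.nonempty_iInter_of_sequence_nonempty_isCompact_isClosed _ (cylsub x)
      (fun n => hne _ _ (cylF x n)) (hcpt _ _ (cylF x 0)) (fun n => (hcpt _ _ (cylF x n)).isClosed)
  choose g hg using hint
  have hg' : ∀ x n, g x ∈ cyl x n := fun x n => Set.mem_iInter.1 (hg x) n
  refine ⟨g, ?_, ?_⟩
  · apply Set.Subset.antisymm
    · rintro _ ⟨x, rfl⟩
      exact hg' x 0
    · intro u hu
      have hi : Nonempty (Fin M) := by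
        have := (hV U s hU).1
        rw [this] at hu
        obtain ⟨i, -⟩ := Set.mem_iUnion.1 hu
        exact ⟨i⟩
      let pick : Set X → ℕ → Fin M := fun W n =>
        if h : ∃ i, u ∈ V W (R ^ n * s) i then h.choose else Classical.arbitrary _
      let W : ℕ → Set X := fun n => Nat.rec U (fun n W => V W (R ^ n * s) (pick W n)) n
      let x : ℕ → Fin M := fun n => pick (W n) n
      have hWc : ∀ n, cyl x n = W n := by
        intro n
        induction n with
        | zero => rfl
        | succ n ih =>
          rw [cylS, ih]
      have hux : ∀ n, u ∈ cyl x n := by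
        intro n
        induction n with
        | zero => exact hu
        | succ n ih =>
          have h1 := (hV _ _ (cylF x n)).1
          have ih' := ih
          rw [h1, hWc] at ih'
          have h2 := Set.mem_iUnion.1 ih'
          have h3 : u ∈ V (W n) (R ^ n * s) (pick (W n) n) := by
            simp only [pick, dif_pos h2]
            exact h2.choose_spec
          rw [cylS, hWc]
          exact h3
      refine ⟨x, ?_⟩
      have hd : ∀ n, dist (g x) u ≤ C * (R ^ n * s) := fun n =>
        hdiam _ _ (cylF x n) _ (hg' x n) _ (hux n)
      have hlim : Filter.Tendsto (fun n : ℕ => C * (R ^ n * s)) Filter.atTop (nhds 0) := by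
        have := (tendsto_pow_atTop_nhds_zero_of_lt_one hR.le hR1).mul_const s |>.const_mul C
        simpa using this
      have : dist (g x) u ≤ 0 := ge_of_tendsto' hlim hd
      exact dist_le_zero.1 this
  · intro x y k h1 h2
    constructor
    · have h3 := hg' x (k+1)
      have h4 := hg' y (k+1)
      rw [cylS] at h3 h4
      rw [← cylcongr x y k h1] at h4
      have := (hV _ _ (cylF x k)).2.2 _ _ h2 _ h3 _ h4
      linarith [mul_comm s (R ^ k)]
    · have h4 := hg' y k
      rw [← cylcongr x y k h1] at h4
      have := hdiam _ _ (cylF x k) _ (hg' x k) _ h4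
      rwa [mul_comm s]

theorem gd_family' {C : ℝ} (hM : 2 ≤ M) (hR : 0 < R) (hR1 : R < 1) (hC : 0 < C)
    (F : Set X → ℝ → Prop)
    (hpos : ∀ U s, F U s → 0 < s)
    (hne : ∀ U s, F U s → U.Nonempty) (hcpt : ∀ U s, F U s → IsCompact U)
    (hdiam : ∀ U s, F U s → ∀ x ∈ U, ∀ y ∈ U, dist x y ≤ C * s)
    (hdec : ∀ U s, F U s → ∃ V : Fin M → Set X, U = ⋃ i, V i ∧
      (∀ i, F (V i) (R * s) ∨ GDGood M R C (R * s) (V i)) ∧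
      ∀ i j, i ≠ j → ∀ x ∈ V i, ∀ y ∈ V j, s ≤ C * dist x y)
    (U : Set X) (s : ℝ) (hU : F U s) : GDGood M R C s U := by
  refine gd_family hR hR1 hC (fun U s => 0 < s ∧ (F U s ∨ GDGood M R C s U)) ?_ ?_ ?_ ?_ U s
    ⟨hpos _ _ hU, Or.inl hU⟩
  · rintro U s ⟨hs, h | h⟩
    · exact hne _ _ h
    · exact h.nonempty hM
  · rintro U s ⟨hs, h | h⟩
    · exact hcpt _ _ h
    · exact h.compact hR hR1 hs hC
  · rintro U s ⟨hs, h | h⟩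
    · exact hdiam _ _ h
    · exact h.diam hR hR1 hs.le hC.le
  · rintro U s ⟨hs, h | h⟩
    · obtain ⟨V, h1, h2, h3⟩ := hdec _ _ h
      exact ⟨V, h1, fun i => ⟨by positivity, h2 i⟩, h3⟩
    · obtain ⟨V, h1, h2, h3⟩ := h.split
      exact ⟨V, h1, fun i => ⟨by positivity, Or.inr (h2 i)⟩, h3⟩

theorem gd_sep {U V : Set X} (hU : IsCompact U) (hV : IsCompact V) (h : Disjoint U V) :
    ∃ C : ℝ, 0 < C ∧ ∀ x ∈ U, ∀ y ∈ V, 1 ≤ C * dist x y := by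
  obtain ⟨δ, hδ, hd⟩ := Metric.exists_pos_forall_lt_edist hU hV.isClosed h
  refine ⟨1 / δ, by positivity, fun x hx y hy => ?_⟩
  have := hd x hx y hy
  have h1 : (δ : ℝ) < dist x y := by
    rw [edist_nndist] at this
    exact_mod_cast this
  have : (0:ℝ) < δ := hδ
  rw [div_mul_eq_mul_div, one_mul, le_div_iff₀ this]
  linarith

theorem gd_bdd {U : Set X} (hU : IsCompact U) :
    ∃ C : ℝ, 0 < C ∧ ∀ x ∈ U, ∀ y ∈ U, dist x y ≤ C := by
  obtain ⟨C, hC⟩ := Metric.isBounded_iff.1 hU.isBounded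
  exact ⟨max C 1, by positivity, fun x hx y hy => (hC hx hy).trans (le_max_left _ _)⟩

theorem GDIsGood.compact {U : Set X} (hR : 0 < R) (hR1 : R < 1) (h : GDIsGood M R U) :
    IsCompact U := by
  obtain ⟨C, hC, h⟩ := h
  exact h.compact hR hR1 one_pos hC

theorem GDIsGood.union {U V : Set X} (hM : 2 ≤ M) (hR : 0 < R) (hR1 : R < 1)
    (hU : GDIsGood M R U) (hV : GDIsGood M R V) (hUV : Disjoint U V) :
    GDIsGood M R (U ∪ V) := by
  have cU := hU.compact hR hR1
  have cV := hV.compact hR hR1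
  obtain ⟨a, ha, hU⟩ := hU
  obtain ⟨b, hb, hV⟩ := hV
  obtain ⟨c, hc, hsep⟩ := gd_sep cU cV hUV
  obtain ⟨d, hd, hdiam⟩ := gd_bdd (cU.union cV)
  obtain ⟨C, hC0, hCa, hCb, hCc, hCd⟩ : ∃ C : ℝ, 0 < C ∧ a ≤ C ∧ b ≤ C ∧ c ≤ C ∧ d ≤ C :=
    ⟨a + b + c + d, by positivity, by linarith, by linarith, by linarith, by linarith⟩
  have hCR : C ≤ C / R := by rw [le_div_iff₀ hR]; nlinarith
  have hCR0 : 0 < C / R := by positivity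
  refine ⟨C / R, by positivity, ?_⟩
  let F : Set X → ℝ → Prop := fun W s => 0 < s ∧ ∃ T E : Set X, W = T ∪ E ∧ GDGood M R C s T ∧
    GDGood M R C s E ∧ ∀ x ∈ T, ∀ y ∈ E, s ≤ C * dist x y ∧ dist x y ≤ C / R * s
  refine gd_family' hM hR hR1 (by positivity) F ?_ ?_ ?_ ?_ ?_ _ _ ?_
  · rintro _ s ⟨h, -⟩
    exact h
  · rintro _ s ⟨h, T, E, rfl, h1, h2, h3⟩
    exact (h1.nonempty hM).inl
  · rintro _ s ⟨h, T, E, rfl, h1, h2, h3⟩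
    exact (h1.compact hR hR1 h hC0).union (h2.compact hR hR1 h hC0)
  · rintro _ s ⟨h, T, E, rfl, h1, h2, h3⟩ x hx y hy
    have h4 := h1.diam hR hR1 h.le hC0.le
    have h5 := h2.diam hR hR1 h.le hC0.le
    have h6 : C * s ≤ C / R * s := by gcongr
    rcases hx with hx | hx <;> rcases hy with hy | hy
    · exact (h4 x hx y hy).trans h6
    · exact (h3 x hx y hy).2
    · rw [dist_comm]; exact (h3 y hy x hx).2
    · exact (h5 x hx y hy).trans h6
  · rintro _ s ⟨h, T, E, rfl, h1, h2, h3⟩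
    have h4 := h1.diam hR hR1 h.le hC0.le
    obtain ⟨V, rfl, hV2, hV3⟩ := h1.split
    let i0 : Fin M := ⟨0, by omega⟩
    let i1 : Fin M := ⟨1, by omega⟩
    have h01 : i0 ≠ i1 := by simp [i0, i1]
    have hle : ∀ x y : X, s ≤ C * dist x y → s ≤ C / R * dist x y := by
      intro x y hxy
      exact hxy.trans (by gcongr)
    have key : ∀ i x, x ∈ (if i = i0 then V i0 ∪ V i1 else if i = i1 then E else V i) →
        ((i = i1 ∧ x ∈ E) ∨ (i ≠ i1 ∧ ∃ j, x ∈ V j ∧ (j = i ∨ (i = i0 ∧ j = i1)))) := by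
      intro i x hx
      split_ifs at hx with ha hb
      · right
        subst ha
        rcases hx with hx | hx
        · exact ⟨h01, _, hx, Or.inl rfl⟩
        · exact ⟨h01, _, hx, Or.inr ⟨rfl, rfl⟩⟩
      · exact Or.inl ⟨hb, hx⟩
      · exact Or.inr ⟨hb, i, hx, Or.inl rfl⟩
    refine ⟨fun i => if i = i0 then V i0 ∪ V i1 else if i = i1 then E else V i, ?_, ?_, ?_⟩
    · apply Set.Subset.antisymm
      · rintro x (hx | hx)
        · obtain ⟨i, hi⟩ := Set.mem_iUnion.1 hx
          by_cases ha : i = i0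
          · exact Set.mem_iUnion.2 ⟨i0, by simp; left; exact ha ▸ hi⟩
          by_cases hb : i = i1
          · exact Set.mem_iUnion.2 ⟨i0, by simp; right; exact hb ▸ hi⟩
          · exact Set.mem_iUnion.2 ⟨i, by simpa [ha, hb]⟩
        · exact Set.mem_iUnion.2 ⟨i1, by simpa [h01.symm]⟩
      · intro x hx
        obtain ⟨i, hi⟩ := Set.mem_iUnion.1 hx
        rcases key i x hi with ⟨-, hx⟩ | ⟨-, j, hx, -⟩
        · exact Or.inr hx
        · exact Or.inl (Set.mem_iUnion.2 ⟨j, hx⟩)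
    · intro i
      by_cases ha : i = i0
      · left
        refine ⟨by positivity, V i0, V i1, by simp [ha], hV2 _, hV2 _, ?_⟩
        intro x hx y hy
        constructor
        · refine le_trans ?_ (hV3 _ _ h01 x hx y hy)
          nlinarith
        · refine (h4 x (Set.mem_iUnion.2 ⟨_, hx⟩) y (Set.mem_iUnion.2 ⟨_, hy⟩)).trans ?_
          apply le_of_eq
          field_simp
      · right
        by_cases hb : i = i1
        · simp only [hb, h01.symm, if_false, if_true]
          exact h2.rescale hR h.le hC0.le hR hR1.le
        · simp only [ha, hb, if_false]
          exact (hV2 i).mono hR (by positivity) hCR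
    · intro i j hij x hx y hy
      apply hle
      rcases key i x hx with ⟨hi, hx⟩ | ⟨hi, i', hx, hi'⟩ <;>
        rcases key j y hy with ⟨hj, hy⟩ | ⟨hj, j', hy, hj'⟩
      · exact absurd (hi.trans hj.symm) hij
      · rw [dist_comm]; exact (h3 y (Set.mem_iUnion.2 ⟨_, hy⟩) x hx).1
      · exact (h3 x (Set.mem_iUnion.2 ⟨_, hx⟩) y hy).1
      · refine hV3 i' j' ?_ x hx y hy
        rintro rfl
        rcases hi' with hi' | ⟨hi', hi''⟩ <;> rcases hj' with hj' | ⟨hj', hj''⟩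
        · exact hij (hi'.symm.trans hj')
        · exact hi (hi'.symm.trans hj'')
        · exact hj (hj'.symm.trans hi'')
        · exact hij (hi'.trans hj'.symm)
  · refine ⟨one_pos, U, V, rfl, hU.mono hR zero_le_one hCa, hV.mono hR zero_le_one hCb, ?_⟩
    intro x hx y hy
    refine ⟨(hsep x hx y hy).trans (by gcongr), ?_⟩
    rw [mul_one]
    exact (hdiam x (Or.inl hx) y (Or.inr hy)).trans (hCd.trans hCR)

theorem GDIsGood.finUnion {ι : Type*} (hM : 2 ≤ M) (hR : 0 < R) (hR1 : R < 1)
    (s : Finset ι) (hs : s.Nonempty) (U : ι → Set X)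
    (hU : ∀ i ∈ s, GDIsGood M R (U i)) (hd : ∀ i ∈ s, ∀ j ∈ s, i ≠ j → Disjoint (U i) (U j)) :
    GDIsGood M R (⋃ i ∈ s, U i) := by
  induction hs using Finset.Nonempty.cons_induction with
  | singleton a => simpa using hU a (by simp)
  | cons a s ha hs ih =>
    rw [Finset.cons_eq_insert, Finset.set_biUnion_insert]
    refine GDIsGood.union hM hR hR1 (hU a (by simp)) (ih ?_ ?_) ?_
    · intro i hi; exact hU i (by simp [hi])
    · intro i hi j hj; exact hd i (by simp [hi]) j (by simp [hj])
    · rw [Set.disjoint_iUnion₂_right]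
      intro i hi
      exact hd a (by simp) i (by simp [hi]) (by rintro rfl; exact ha hi)

theorem GDIsGood.iUnion {ι : Type*} [Fintype ι] [Nonempty ι] (hM : 2 ≤ M) (hR : 0 < R) (hR1 : R < 1)
    (U : ι → Set X)
    (hU : ∀ i, GDIsGood M R (U i)) (hd : ∀ i j, i ≠ j → Disjoint (U i) (U j)) :
    GDIsGood M R (⋃ i, U i) := by
  have := GDIsGood.finUnion hM hR hR1 Finset.univ Finset.univ_nonempty U (fun i _ => hU i)
    (fun i _ j _ => hd i j)
  simpa using this

theorem GDGood.isGood {C s : ℝ} {U : Set X} (hR : 0 < R) (hC : 0 < C) (hs : 0 < s)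
    (h : GDGood M R C s U) : GDIsGood M R U := by
  obtain ⟨g, hg, hb⟩ := h
  refine ⟨C * s + C / s, by positivity, g, hg, fun x y k h1 h2 => ?_⟩
  obtain ⟨h3, h4⟩ := hb x y k h1 h2
  have hd : 0 ≤ dist (g x) (g y) := dist_nonneg
  have hk : 0 < R ^ k := by positivity
  constructor
  · have : R ^ k ≤ C / s * dist (g x) (g y) := by
      rw [div_mul_eq_mul_div, le_div_iff₀ hs]; linarith
    have h5 : 0 ≤ C * s * dist (g x) (g y) := by positivity
    linarith
  · have h5 : 0 ≤ C / s * R ^ k := by positivity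
    linarith

theorem GDIsGood.split2 {U : Set X} (hM : 2 ≤ M) (hR : 0 < R) (hR1 : R < 1)
    (h : GDIsGood M R U) : ∃ V W : Set X, U = V ∪ W ∧ Disjoint V W ∧ GDIsGood M R V ∧
      GDIsGood M R W := by
  obtain ⟨C, hC, h⟩ := h
  obtain ⟨V, h1, h2, h3⟩ := h.split
  have hd : ∀ i j, i ≠ j → Disjoint (V i) (V j) := by
    intro i j hij
    rw [Set.disjoint_left]
    intro x hx hy
    have := h3 i j hij x hx x hy
    simp at this
    linarith
  have hg : ∀ i, GDIsGood M R (V i) := fun i => (h2 i).isGood hR hC (by positivity)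
  let i0 : Fin M := ⟨0, by omega⟩
  let i1 : Fin M := ⟨1, by omega⟩
  have h01 : i0 ≠ i1 := by simp [i0, i1]
  refine ⟨V i0, ⋃ i ∈ Finset.univ.erase i0, V i, ?_, ?_, hg _, ?_⟩
  · rw [h1]
    ext x
    simp only [Set.mem_iUnion, Set.mem_union, Finset.mem_erase, Finset.mem_univ, and_true,
      exists_prop]
    constructor
    · rintro ⟨i, hi⟩
      by_cases h : i = i0
      · left; exact h ▸ hi
      · exact Or.inr ⟨i, h, hi⟩
    · rintro (h | ⟨i, -, h⟩)
      · exact ⟨_, h⟩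
      · exact ⟨_, h⟩
  · rw [Set.disjoint_iUnion₂_right]
    intro i hi
    exact hd _ _ (Finset.ne_of_mem_erase hi).symm
  · exact GDIsGood.finUnion hM hR hR1 _ ⟨i1, by simp [h01.symm]⟩ V (fun i _ => hg i)
      (fun i _ j _ => hd i j)

theorem GDIsGood.splitN {U : Set X} (hM : 2 ≤ M) (hR : 0 < R) (hR1 : R < 1)
    (h : GDIsGood M R U) (t : ℕ) : ∃ V : Fin (t+1) → Set X, U = ⋃ i, V i ∧
      (∀ i j, i ≠ j → Disjoint (V i) (V j)) ∧ ∀ i, GDIsGood M R (V i) := by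
  induction t generalizing U with
  | zero => exact ⟨fun _ => U, by rw [Set.iUnion_const], fun i j hij => absurd (by omega) hij, fun _ => h⟩
  | succ t ih =>
    obtain ⟨A, B, rfl, hAB, hA, hB⟩ := h.split2 hM hR hR1
    obtain ⟨V, rfl, hV2, hV3⟩ := ih hB
    rw [Set.disjoint_iUnion_right] at hAB
    refine ⟨Fin.cons A V, ?_, ?_, ?_⟩
    · ext x; simp [Fin.exists_fin_succ]
    · intro i j
      refine Fin.cases ?_ (fun i => ?_) i <;> refine Fin.cases ?_ (fun j => ?_) j
      · simp
      · intro _; simpa using hAB j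
      · intro _; simpa using (hAB i).symm
      · intro hij; simpa using hV2 i j (by simpa using hij)
    · intro i
      refine Fin.cases ?_ (fun i => ?_) i
      · simpa
      · simpa using hV3 i

/-- Finite systems in which every set has exactly `M` children. -/
theorem gd_system {ι : Type*} [Finite ι] (hM : 2 ≤ M) (hR : 0 < R) (hR1 : R < 1)
    (Y : ι → Set X) (hne : ∀ a, (Y a).Nonempty) (hc : ∀ a, IsCompact (Y a))
    (hdec : ∀ a, ∃ (β : Type) (_ : Fintype β) (V : β → Set X), Fintype.card β = M ∧
      Y a = ⋃ i, V i ∧ (∀ i j, i ≠ j → Disjoint (V i) (V j)) ∧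
      ∀ i, (∃ b, ∃ S : X → X, (∀ x y, dist (S x) (S y) = R * dist x y) ∧ V i = S '' Y b) ∨
        GDIsGood M R (V i)) (a : ι) : GDIsGood M R (Y a) := by
  have simcont : ∀ (t : ℝ) (S : X → X), 0 < t → (∀ x y, dist (S x) (S y) = t * dist x y) →
      Continuous S := by
    intro t S ht hS
    exact (LipschitzWith.of_dist_le_mul (K := ⟨t, ht.le⟩) (fun x y => (hS x y).le)).continuous
  have step : ∀ a, ∃ C0 : ℝ, 0 < C0 ∧ ∀ C, C0 ≤ C → (∀ x ∈ Y a, ∀ y ∈ Y a, dist x y ≤ C) ∧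
      ∃ V : Fin M → Set X, Y a = ⋃ i, V i ∧
      (∀ i, (∃ b, ∃ S : X → X, (∀ x y, dist (S x) (S y) = R * dist x y) ∧ V i = S '' Y b) ∨
        GDGood M R C R (V i)) ∧ ∀ i j, i ≠ j → ∀ x ∈ V i, ∀ y ∈ V j, 1 ≤ C * dist x y := by
    intro a
    obtain ⟨β, _, V, hcard, hY, hd, hV⟩ := hdec a
    have hcV : ∀ i, IsCompact (V i) := by
      intro i
      rcases hV i with ⟨b, S, hS, h⟩ | h
      · rw [h]; exact (hc b).image (simcont R S hR hS)
      · exact h.compact hR hR1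
    obtain ⟨c1, hc1, hb⟩ := gd_bdd (hc a)
    have h2 : ∀ q : β × β, ∃ c : ℝ, 0 < c ∧ (q.1 ≠ q.2 → ∀ x ∈ V q.1, ∀ y ∈ V q.2,
        1 ≤ c * dist x y) := by
      intro q
      by_cases h : q.1 = q.2
      · exact ⟨1, one_pos, fun h' => absurd h h'⟩
      · obtain ⟨c, hc, h'⟩ := gd_sep (hcV q.1) (hcV q.2) (hd _ _ h)
        exact ⟨c, hc, fun _ => h'⟩
    choose c2 hc2 hsep using h2
    have h3 : ∀ i, ∃ c : ℝ, 0 < c ∧ (GDIsGood M R (V i) → GDGood M R c R (V i)) := by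
      intro i
      by_cases h : GDIsGood M R (V i)
      · have h' := h
        obtain ⟨c, hc, h⟩ := h
        refine ⟨c / R, by positivity, fun _ => ?_⟩
        simpa using h.rescale hR zero_le_one hc.le hR hR1.le
      · exact ⟨1, one_pos, fun h' => absurd h' h⟩
    choose c3 hc3 hgood using h3
    have n2 : ∀ q, c2 q ≤ ∑ q, c2 q := fun q =>
      Finset.single_le_sum (fun i _ => (hc2 i).le) (Finset.mem_univ q)
    have n3 : ∀ q, c3 q ≤ ∑ q, c3 q := fun q =>
      Finset.single_le_sum (fun i _ => (hc3 i).le) (Finset.mem_univ q)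
    have p2 : 0 ≤ ∑ q, c2 q := Finset.sum_nonneg (fun i _ => (hc2 i).le)
    have p3 : 0 ≤ ∑ q, c3 q := Finset.sum_nonneg (fun i _ => (hc3 i).le)
    refine ⟨c1 + ∑ q, c2 q + ∑ q, c3 q, by positivity, fun C hC => ⟨?_, ?_⟩⟩
    · intro x hx y hy
      linarith [hb x hx y hy]
    · let e := (Fintype.equivFinOfCardEq hcard).symm
      refine ⟨fun i => V (e i), ?_, ?_, ?_⟩
      · rw [hY]; exact (e.surjective.iUnion_comp V).symm
      · intro i
        rcases hV (e i) with h | h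
        · exact Or.inl h
        · right
          exact (hgood _ h).mono hR hR.le (by linarith [n3 (e i)])
      · intro i j hij x hx y hy
        refine (hsep (e i, e j) (by simpa using hij) x hx y hy).trans ?_
        gcongr
        linarith [n2 (e i, e j)]
  choose C0 hC0 hstep using step
  have := Fintype.ofFinite ι
  have n0 : ∀ q, C0 q ≤ ∑ q, C0 q := fun q =>
      Finset.single_le_sum (fun i _ => (hC0 i).le) (Finset.mem_univ q)
  have p0 : 0 < ∑ q, C0 q := (hC0 a).trans_le (n0 a)
  refine ⟨_, p0, ?_⟩
  generalize (∑ q, C0 q) = C at n0 p0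
  let F : Set X → ℝ → Prop := fun U s => 0 < s ∧ ∃ b, ∃ S : X → X,
    (∀ x y, dist (S x) (S y) = s * dist x y) ∧ U = S '' Y b
  refine gd_family' hM hR hR1 p0 F ?_ ?_ ?_ ?_ ?_ _ _ ?_
  · rintro _ s ⟨h, -⟩; exact h
  · rintro _ s ⟨h, b, S, hS, rfl⟩; exact (hne b).image S
  · rintro _ s ⟨h, b, S, hS, rfl⟩; exact (hc b).image (simcont s S h hS)
  · rintro _ s ⟨h, b, S, hS, rfl⟩ _ ⟨x, hx, rfl⟩ _ ⟨y, hy, rfl⟩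
    rw [hS, mul_comm]
    have := (hstep b C (n0 b)).1 x hx y hy
    gcongr
  · rintro _ s ⟨h, b, S, hS, rfl⟩
    obtain ⟨V, hV1, hV2, hV3⟩ := (hstep b C (n0 b)).2
    refine ⟨fun i => S '' V i, ?_, ?_, ?_⟩
    · rw [hV1, Set.image_iUnion]
    · intro i
      rcases hV2 i with ⟨b', S', hS', h'⟩ | h'
      · left
        refine ⟨by positivity, b', S ∘ S', fun x y => ?_, ?_⟩
        · simp only [Function.comp, hS, hS']; ring
        · simp only [h', Set.image_image]; rfl
      · right
        rw [mul_comm]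
        exact h'.image h.le S hS
    · rintro i j hij _ ⟨x, hx, rfl⟩ _ ⟨y, hy, rfl⟩
      have := hV3 i j hij x hx y hy
      rw [hS]
      nlinarith
  · exact ⟨one_pos, a, id, by simp, by simp⟩

end
section
variable {X : Type*} [MetricSpace X] {M : ℕ} {R : ℝ} {p : ℕ}

theorem gd_union (G : GraphDirected X p R) (i : Fin p) :
    G.K i = ⋃ e : (Σ j, Fin (G.a i j)), G.S i e.1 e.2 '' G.K e.1 := by
  conv_lhs => rw [G.union i]
  rw [Set.iUnion_sigma]

theorem gd_disj (G : GraphDirected X p R) (i : Fin p) (e e' : Σ j, Fin (G.a i j)) (h : e ≠ e') :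
    Disjoint (G.S i e.1 e.2 '' G.K e.1) (G.S i e'.1 e'.2 '' G.K e'.1) :=
  G.disj i e.1 e'.1 e.2 e'.2 h

theorem gd_inj (hR : 0 < R) {S : X → X} (hS : ∀ x y, dist (S x) (S y) = R * dist x y) :
    Function.Injective S := by
  intro x y h
  have := hS x y
  rw [h, dist_self] at this
  have h2 : dist x y = 0 := by
    rcases mul_eq_zero.1 this.symm with h | h
    · linarith
    · exact h
  exact dist_eq_zero.1 h2

theorem gd_cont (hR : 0 < R) {S : X → X} (hS : ∀ x y, dist (S x) (S y) = R * dist x y) :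
    Continuous S :=
  (LipschitzWith.of_dist_le_mul (K := ⟨R, hR.le⟩) (fun x y => (hS x y).le)).continuous

theorem gd_coreF (hM : 2 ≤ M) (hR : 0 < R) (hR1 : R < 1) (G : GraphDirected X p R)
    (F : Fin p → Prop) (w : Fin p → ℕ)
    (hF1 : ∀ j, F j → ∀ k, 0 < G.a j k → F k) (hw : ∀ j, F j → 0 < w j)
    (hF2 : ∀ j, F j → ∃ χ : (Σ k, Fin (G.a j k)) → Fin (w j),
      ∀ c, ∑ e, (if χ e = c then w e.1 else 0) = M) :
    ∀ j, F j → GDIsGood M R (G.K j) := by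
  choose χ hχ using hF2
  let ι := {q : Σ j, Fin (w j) // F q.1}
  let Y : ι → Set X := fun q => ⋃ e : {e : Σ k, Fin (G.a q.1.1 k) // χ q.1.1 q.2 e = q.1.2},
    G.S q.1.1 e.1.1 e.1.2 '' G.K e.1.1
  have hKY : ∀ j (hj : F j), G.K j = ⋃ c : Fin (w j), Y ⟨⟨j, c⟩, hj⟩ := by
    intro j hj
    rw [gd_union]
    ext x
    simp only [Set.mem_iUnion, Y]
    constructor
    · rintro ⟨e, he⟩
      exact ⟨χ j hj e, ⟨e, rfl⟩, he⟩
    · rintro ⟨c, ⟨e, _⟩, h⟩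
      exact ⟨e, h⟩
  have hYd : ∀ j (hj : F j) c c', c ≠ c' → Disjoint (Y ⟨⟨j, c⟩, hj⟩) (Y ⟨⟨j, c'⟩, hj⟩) := by
    intro j hj c c' hc
    simp only [Y]
    rw [Set.disjoint_iUnion_left]
    rintro ⟨e, he⟩
    rw [Set.disjoint_iUnion_right]
    rintro ⟨e', he'⟩
    refine gd_disj G j e e' ?_
    rintro rfl
    exact hc (he.symm.trans he')
  have hcard : ∀ q : ι, Fintype.card (Σ e : {e : Σ k, Fin (G.a q.1.1 k) // χ q.1.1 q.2 e = q.1.2},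
      Fin (w e.1.1)) = M := by
    intro q
    rw [Fintype.card_sigma, ← hχ q.1.1 q.2 q.1.2, ← Finset.sum_filter]
    simp only [Fintype.card_fin]
    rw [Finset.sum_subtype (p := fun e => χ q.1.1 q.2 e = q.1.2) _ (by simp)]
  have hFe : ∀ q : ι, ∀ e : (Σ k, Fin (G.a q.1.1 k)), F e.1 := by
    intro q e
    exact hF1 _ q.2 _ (Fin.pos e.2)
  have hgood : ∀ q : ι, GDIsGood M R (Y q) := by
    refine gd_system hM hR hR1 Y ?_ ?_ ?_
    · intro q
      have : 0 < Fintype.card (Σ e : {e : Σ k, Fin (G.a q.1.1 k) // χ q.1.1 q.2 e = q.1.2},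
        Fin (w e.1.1)) := by rw [hcard]; omega
      obtain ⟨⟨e, _⟩⟩ := Fintype.card_pos_iff.1 this
      obtain ⟨x, hx⟩ := G.nonempty e.1.1
      exact ⟨_, Set.mem_iUnion.2 ⟨e, x, hx, rfl⟩⟩
    · intro q
      exact isCompact_iUnion fun e => (G.compact _).image (gd_cont hR (G.sim _ _ _))
    · intro q
      refine ⟨(Σ e : {e : Σ k, Fin (G.a q.1.1 k) // χ q.1.1 q.2 e = q.1.2}, Fin (w e.1.1)),
        inferInstance,
        fun f => G.S q.1.1 f.1.1.1 f.1.1.2 '' Y ⟨⟨f.1.1.1, f.2⟩, hFe q f.1.1⟩, hcard q, ?_, ?_, ?_⟩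
      · rw [Set.iUnion_sigma]
        simp only [Y]
        refine Set.iUnion_congr fun e => ?_
        rw [hKY e.1.1 (hFe q e.1), Set.image_iUnion]
      · rintro ⟨e, c⟩ ⟨e', c'⟩ hne
        by_cases he : e = e'
        · subst he
          have hc : c ≠ c' := by rintro rfl; exact hne rfl
          exact (Set.disjoint_image_iff (gd_inj hR (G.sim _ _ _))).2 (hYd _ _ _ _ hc)
        · have := gd_disj G q.1.1 e.1 e'.1 (fun h => he (Subtype.ext h))
          refine this.mono (Set.image_mono ?_) (Set.image_mono ?_)
          · rw [hKY e.1.1 (hFe q e.1)]; exact Set.subset_iUnion (fun c => Y ⟨⟨e.1.1, c⟩, _⟩) c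
          · rw [hKY e'.1.1 (hFe q e'.1)]; exact Set.subset_iUnion (fun c => Y ⟨⟨e'.1.1, c⟩, _⟩) c'
      · intro f
        exact Or.inl ⟨_, _, G.sim _ _ _, rfl⟩
  intro j hj
  rw [hKY j hj]
  have : Nonempty (Fin (w j)) := ⟨⟨0, hw j hj⟩⟩
  exact GDIsGood.iUnion hM hR hR1 _ (fun c => hgood _) (hYd j hj)

theorem gd_core (hM : 2 ≤ M) (hR : 0 < R) (hR1 : R < 1) (G : GraphDirected X p R)
    (F : Fin p → Prop) (hF : ∀ j, F j → GDIsGood M R (G.K j))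
    (hT1 : ∀ j, ¬ F j → ∑ k, (if F k then 0 else G.a j k) < M)
    (hT2 : ∀ j, ¬ F j → ∃ k, F k ∧ 0 < G.a j k) :
    ∀ j, GDIsGood M R (G.K j) := by
  have simgood : ∀ U : Set X, GDIsGood M R U → ∀ S : X → X,
      (∀ x y, dist (S x) (S y) = R * dist x y) → GDIsGood M R (S '' U) := by
    rintro U ⟨C, hC, h⟩ S hS
    exact (h.image hR.le S hS).isGood hR hC (by positivity)
  have hT : ∀ q : {j // ¬ F j}, GDIsGood M R (G.K q.1) := by
    refine gd_system hM hR hR1 (fun q : {j // ¬ F j} => G.K q.1) (fun q => G.nonempty _)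
      (fun q => G.compact _) ?_
    rintro ⟨j, hj⟩
    let E := Σ k, Fin (G.a j k)
    let P : E → Set X := fun e => G.S j e.1 e.2 '' G.K e.1
    have hPd : ∀ e e', e ≠ e' → Disjoint (P e) (P e') := gd_disj G j
    have hcT : Fintype.card {e : E // ¬ F e.1} < M := by
      refine lt_of_eq_of_lt ?_ (hT1 j hj)
      rw [Fintype.card_subtype, Finset.card_filter, Fintype.sum_sigma]
      refine Finset.sum_congr rfl fun k _ => ?_
      by_cases hk : F k <;> simp [hk]
    obtain ⟨k, hk, hpos⟩ := hT2 j hj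
    have : Nonempty {e : E // F e.1} := ⟨⟨⟨k, ⟨0, hpos⟩⟩, hk⟩⟩
    have hVg : GDIsGood M R (⋃ e : {e : E // F e.1}, P e.1) := by
      refine GDIsGood.iUnion hM hR hR1 _ (fun e => ?_) ?_
      · exact simgood _ (hF _ e.2) _ (G.sim _ _ _)
      · intro e e' h
        exact hPd _ _ (fun h' => h (Subtype.ext h'))
    obtain ⟨W, hW1, hW2, hW3⟩ := hVg.splitN hM hR hR1 (M - Fintype.card {e : E // ¬ F e.1} - 1)
    refine ⟨{e : E // ¬ F e.1} ⊕ Fin (M - Fintype.card {e : E // ¬ F e.1} - 1 + 1), inferInstance,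
      Sum.elim (fun e => P e.1) W, ?_, ?_, ?_, ?_⟩
    · rw [Fintype.card_sum, Fintype.card_fin]; omega
    · rw [Set.iUnion_sum]
      simp only [Sum.elim_inl, Sum.elim_inr]
      rw [← hW1, gd_union]
      ext x
      simp only [Set.mem_iUnion, Set.mem_union]
      constructor
      · rintro ⟨e, he⟩
        by_cases h : F e.1
        · exact Or.inr ⟨⟨e, h⟩, he⟩
        · exact Or.inl ⟨⟨e, h⟩, he⟩
      · rintro (⟨e, he⟩ | ⟨e, he⟩)
        · exact ⟨e.1, he⟩
        · exact ⟨e.1, he⟩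
    · have hPW : ∀ (e : {e : E // ¬ F e.1}) i, Disjoint (P e.1) (W i) := by
        intro e i
        have : Disjoint (P e.1) (⋃ e : {e : E // F e.1}, P e.1) := by
          rw [Set.disjoint_iUnion_right]
          intro e'
          refine hPd _ _ ?_
          intro h
          exact e.2 (h ▸ e'.2)
        refine this.mono_right ?_
        rw [hW1]
        exact Set.subset_iUnion _ _
      rintro (e | i) (e' | i') hne
      · exact hPd _ _ (fun h => hne (by rw [Subtype.ext h]))
      · exact hPW _ _
      · exact (hPW _ _).symm
      · exact hW2 _ _ (fun h => hne (by rw [h]))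
    · rintro (e | i)
      · exact Or.inl ⟨⟨e.1.1, e.2⟩, _, G.sim _ _ _, rfl⟩
      · exact Or.inr (hW3 i)
  intro j
  by_cases hj : F j
  · exact hF j hj
  · exact hT ⟨j, hj⟩

theorem gd_comp {R1 R2 : ℝ} (hR1 : 0 < R1) (G1 : GraphDirected X p R1) (G2 : GraphDirected X p R2)
    (h : G2.K = G1.K) : ∃ G3 : GraphDirected X p (R1 * R2), G3.K = G1.K ∧
      ∀ i j, G3.a i j = ∑ k, G1.a i k * G2.a k j := by
  let a3 : Fin p → Fin p → ℕ := fun i j => ∑ k, G1.a i k * G2.a k j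
  let φ : ∀ i j, Fin (a3 i j) ≃ (Σ k, Fin (G1.a i k) × Fin (G2.a k j)) := fun i j =>
    (Fintype.equivFinOfCardEq (by simp [a3])).symm
  refine ⟨⟨a3, fun i j e => G1.S i (φ i j e).1 (φ i j e).2.1 ∘ G2.S _ j (φ i j e).2.2, ?_, G1.K,
    G1.nonempty, G1.compact, ?_, ?_⟩, rfl, fun i j => rfl⟩
  · intro i j e x y
    simp only [Function.comp, G1.sim, G2.sim]; ring
  · intro i
    ext x
    constructor
    · intro hx
      rw [gd_union] at hx
      obtain ⟨⟨k, e⟩, y, hy, rfl⟩ := Set.mem_iUnion.1 hx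
      simp only at hy
      rw [← h, gd_union] at hy
      obtain ⟨⟨j, e'⟩, z, hz, rfl⟩ := Set.mem_iUnion.1 hy
      rw [h] at hz
      refine Set.mem_iUnion.2 ⟨j, Set.mem_iUnion.2 ⟨(φ i j).symm ⟨k, e, e'⟩, z, hz, ?_⟩⟩
      rw [Equiv.apply_symm_apply]
      rfl
    · intro hx
      obtain ⟨j, hx⟩ := Set.mem_iUnion.1 hx
      obtain ⟨e, z, hz, rfl⟩ := Set.mem_iUnion.1 hx
      rw [gd_union]
      refine Set.mem_iUnion.2 ⟨⟨(φ i j e).1, (φ i j e).2.1⟩, G2.S _ j (φ i j e).2.2 z, ?_, rfl⟩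
      simp only
      rw [← h, gd_union]
      exact Set.mem_iUnion.2 ⟨⟨j, (φ i j e).2.2⟩, z, by rw [h]; exact hz, rfl⟩
  · intro i j j' e e' hne
    have key : ∀ (q : Σ k, Fin (G1.a i k) × Fin (G2.a k j))
        (q' : Σ k, Fin (G1.a i k) × Fin (G2.a k j')),
        ((⟨j, q⟩ : Σ j, Σ k, Fin (G1.a i k) × Fin (G2.a k j)) ≠ ⟨j', q'⟩) →
        Disjoint ((G1.S i q.1 q.2.1 ∘ G2.S _ j q.2.2) '' G1.K j)
          ((G1.S i q'.1 q'.2.1 ∘ G2.S _ j' q'.2.2) '' G1.K j') := by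
      rintro ⟨k, e1, e2⟩ ⟨k', e1', e2'⟩ hq
      rw [Set.image_comp, Set.image_comp]
      by_cases he : (⟨k, e1⟩ : Σ k, Fin (G1.a i k)) = ⟨k', e1'⟩
      · cases he
        refine (Set.disjoint_image_iff (gd_inj hR1 (G1.sim _ _ _))).2 ?_
        rw [← h]
        refine G2.disj k j j' e2 e2' ?_
        intro h'
        cases h'
        exact hq rfl
      · have hsub : ∀ k j (e : Fin (G2.a k j)), G2.S k j e '' G1.K j ⊆ G1.K k := by
          intro k j e
          conv_rhs => rw [← h, gd_union]
          rw [← h]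
          exact Set.subset_iUnion (fun e : (Σ j, Fin (G2.a k j)) => G2.S k e.1 e.2 '' G2.K e.1) ⟨j, e⟩
        exact (gd_disj G1 i ⟨k, e1⟩ ⟨k', e1'⟩ he).mono (Set.image_mono (hsub _ _ _))
          (Set.image_mono (hsub _ _ _))
    refine key _ _ ?_
    intro h'
    apply hne
    obtain ⟨h1, h2⟩ := Sigma.mk.inj h'
    subst h1
    have := (φ i j).injective (eq_of_heq h2)
    rw [this]

theorem gd_pow (hR : 0 < R) (G : GraphDirected X p R) (n : ℕ) :
    ∃ G' : GraphDirected X p (R ^ (n+1)), G'.K = G.K ∧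
      ∀ i j, G'.a i j = ((Matrix.of G.a) ^ (n+1) : Matrix (Fin p) (Fin p) ℕ) i j := by
  induction n with
  | zero =>
    rw [zero_add, pow_one, pow_one]
    exact ⟨G, rfl, fun i j => rfl⟩
  | succ n ih =>
    obtain ⟨G', h1, h2⟩ := ih
    obtain ⟨G3, h3, h4⟩ := gd_comp (by positivity) G' G h1.symm
    rw [pow_succ R]
    refine ⟨G3, h3.trans h1, fun i j => ?_⟩
    rw [h4, pow_succ (Matrix.of G.a), Matrix.mul_apply]
    refine Finset.sum_congr rfl fun k _ => ?_
    rw [h2]; rfl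

theorem gd_symb {r : ℝ} {m : ℕ} {x y : ℕ → Fin m} {k : ℕ} (h1 : ∀ i < k, x i = y i)
    (h2 : x k ≠ y k) : symbDist r x y = r ^ k := by
  have hne : x ≠ y := fun h => h2 (by rw [h])
  rw [symbDist, if_neg hne]
  congr 1
  refine le_antisymm (Nat.sInf_le h2) ?_
  refine le_csInf ⟨k, h2⟩ fun b hb => ?_
  by_contra hc
  exact hb (h1 b (by omega))

theorem gd_block {r : ℝ} (hr : 0 < r) (hr1 : r < 1) {m L : ℕ} (hL : 0 < L) {U : Set X}
    (h : GDIsGood (m ^ L) (r ^ L) U) : BilipWithSymb U m r := by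
  obtain ⟨C, hC, g, hg, hb⟩ := h
  let e : (Fin L → Fin m) ≃ Fin (m ^ L) := finFunctionFinEquiv
  let φ : (ℕ → Fin m) → (ℕ → Fin (m ^ L)) := fun x n => e (fun i => x (n * L + i))
  have hφs : Function.Surjective φ := by
    intro y
    refine ⟨fun k => e.symm (y (k / L)) ⟨k % L, Nat.mod_lt _ hL⟩, ?_⟩
    funext n
    simp only [φ]
    rw [Equiv.apply_eq_iff_eq_symm_apply]
    funext i
    have h1 : (n * L + i) / L = n := by
      rw [mul_comm, Nat.mul_add_div hL, Nat.div_eq_of_lt i.2, add_zero]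
    have h2 : (n * L + i) % L = i := by
      rw [mul_comm, Nat.mul_add_mod, Nat.mod_eq_of_lt i.2]
    simp only [h1, h2]
  have hbound : ∀ x y : ℕ → Fin m, ∀ k, (∀ i < k, x i = y i) → x k ≠ y k →
      r ^ k ≤ C * dist (g (φ x)) (g (φ y)) ∧ dist (g (φ x)) (g (φ y)) ≤ C / r ^ L * r ^ k := by
    intro x y k h1 h2
    have hdm := Nat.div_add_mod k L
    have hml := Nat.mod_lt k hL
    have := hb (φ x) (φ y) (k / L) (by
      intro n hn
      simp only [φ]
      congr 1
      funext i
      apply h1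
      have h3 : n + 1 ≤ k / L := hn
      have h4 := Nat.mul_le_mul_left L h3
      have h5 := i.2
      rw [mul_comm n L]
      rw [mul_add, mul_one] at h4
      omega) (by
      intro hcon
      simp only [φ] at hcon
      have h3 := congrFun (e.injective hcon) ⟨k % L, hml⟩
      simp only at h3
      rw [mul_comm, hdm] at h3
      exact h2 h3)
    rw [one_mul, ← pow_mul] at this
    obtain ⟨h3, h4⟩ := this
    constructor
    · refine le_trans ?_ h3
      exact pow_le_pow_of_le_one hr.le hr1.le (by omega)
    · refine h4.trans ?_
      rw [div_mul_eq_mul_div, le_div_iff₀ (by positivity), mul_assoc, ← pow_add]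
      gcongr ?_ * ?_
      exact pow_le_pow_of_le_one hr.le hr1.le (by omega)
  have hginj : Function.Injective (fun x => g (φ x)) := by
    intro x y hxy
    by_contra hne
    obtain ⟨k, h1, h2⟩ := gd_firstdiff hne
    have := (hbound x y k h1 h2).1
    simp only at hxy
    rw [hxy, dist_self, mul_zero] at this
    have : 0 < r ^ k := by positivity
    linarith
  have hrange : ∀ u : U, ∃ x, g (φ x) = u := by
    rintro ⟨u, hu⟩
    rw [← hg] at hu
    obtain ⟨y, rfl⟩ := hu
    obtain ⟨x, rfl⟩ := hφs y
    exact ⟨x, rfl⟩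
  choose f hf using hrange
  have hD : C / r ^ L + C + 1 > 0 := by positivity
  have hCL : 0 < C / r ^ L := by positivity
  refine ⟨f, ⟨?_, ?_⟩, C / r ^ L + C + 1, by linarith, ?_⟩
  · intro u v huv
    apply Subtype.ext
    rw [← hf u, ← hf v, huv]
  · intro x
    refine ⟨⟨g (φ x), by rw [← hg]; exact ⟨_, rfl⟩⟩, ?_⟩
    apply hginj
    exact hf _
  · intro u v
    by_cases huv : u = v
    · subst huv; simp [symbDist]
    · have hne : f u ≠ f v := fun h => huv (Subtype.ext (by rw [← hf u, ← hf v, h]))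
      obtain ⟨k, h1, h2⟩ := gd_firstdiff hne
      obtain ⟨h3, h4⟩ := hbound _ _ k h1 h2
      rw [gd_symb h1 h2]
      have hd : dist u v = dist (g (φ (f u))) (g (φ (f v))) := by rw [hf, hf]; rfl
      rw [hd]
      have hrk : 0 < r ^ k := by positivity
      constructor
      · rw [inv_mul_le_iff₀ hD]
        nlinarith
      · refine h3.trans ?_
        gcongr
        linarith

end
theorem gd_intvec {p m : ℕ} (a : Fin p → Fin p → ℕ) (v : Fin p → ℝ) (hv : ∀ i, 0 < v i)
    (h : ∀ i, ∑ j, (a i j : ℝ) * v j = (m : ℝ) * v i) :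
    ∃ u : Fin p → ℕ, (∀ i, 0 < u i) ∧ ∀ i, ∑ j, a i j * u j = m * u i := by
  let W : Submodule ℚ ℝ := Submodule.span ℚ (Set.range v)
  have : FiniteDimensional ℚ W := FiniteDimensional.span_of_finite ℚ (Set.finite_range v)
  let b := Module.finBasis ℚ W
  let vW : Fin p → W := fun j => ⟨v j, Submodule.subset_span ⟨j, rfl⟩⟩
  let q : Fin p → Fin (Module.finrank ℚ W) → ℚ := fun j l => b.repr (vW j) l
  have hq : ∀ j, v j = ∑ l, (q j l : ℝ) * (b l : ℝ) := by
    intro j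
    have h1 := b.sum_repr (vW j)
    have h2 := congrArg (Subtype.val) h1
    rw [AddSubmonoidClass.coe_finsetSum] at h2
    simp only [Submodule.coe_smul, Rat.smul_def] at h2
    exact h2.symm
  have hrel : ∀ i l, ∑ j, (a i j : ℚ) * q j l = m * q i l := by
    intro i l
    have h1 : ∑ j, (a i j : ℚ) • vW j = (m : ℚ) • vW i := by
      apply Subtype.ext
      simpa [vW, Rat.smul_def] using h i
    have h2 := congrArg (fun x => b.repr x l) h1
    simpa [map_sum] using h2
  have hopen : IsOpen {β : Fin (Module.finrank ℚ W) → ℝ | ∀ j, 0 < ∑ l, (q j l : ℝ) * β l} := by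
    simp only [Set.setOf_forall]
    refine isOpen_iInter_of_finite fun j => ?_
    exact isOpen_lt continuous_const (by fun_prop)
  have hdense : DenseRange (Pi.map (fun (_ : Fin (Module.finrank ℚ W)) (x : ℚ) => (x : ℝ))) :=
    DenseRange.piMap fun _ => Rat.denseRange_cast
  obtain ⟨β, hβ⟩ := hdense.exists_mem_open hopen ⟨fun l => (b l : ℝ), fun j => by
    rw [← hq j]; exact hv j⟩
  let u' : Fin p → ℚ := fun j => ∑ l, q j l * β l
  have hu' : ∀ j, 0 < u' j := by
    intro j
    have := hβ j
    simp only [Pi.map_apply] at this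
    have h2 : (0 : ℝ) < ((u' j : ℚ) : ℝ) := by
      simp only [u']; push_cast; exact this
    exact_mod_cast h2
  have hrel' : ∀ i, ∑ j, (a i j : ℚ) * u' j = m * u' i := by
    intro i
    simp only [u', Finset.mul_sum]
    rw [Finset.sum_comm]
    refine Finset.sum_congr rfl fun l _ => ?_
    rw [← mul_assoc, ← hrel, Finset.sum_mul]
    refine Finset.sum_congr rfl fun j _ => by ring
  have hN : ∀ j, ∃ n : ℕ, (n : ℚ) = (∏ k, (u' k).den : ℕ) * u' j := by
    intro j
    obtain ⟨c, hc⟩ := Finset.dvd_prod_of_mem (fun k => (u' k).den) (Finset.mem_univ j)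
    have hn : 0 < (u' j).num := Rat.num_pos.2 (hu' j)
    refine ⟨c * (u' j).num.toNat, ?_⟩
    rw [hc]
    have h1 : (((u' j).num.toNat : ℕ) : ℚ) = ((u' j).num : ℚ) := by
      have : (((u' j).num.toNat : ℕ) : ℤ) = (u' j).num := Int.toNat_of_nonneg hn.le
      exact_mod_cast this
    push_cast
    rw [h1]
    have h2 := Rat.den_mul_eq_num (u' j)
    rw [← h2]; ring
  choose u hu using hN
  have hP : (0:ℚ) < (∏ k, (u' k).den : ℕ) := by
    exact_mod_cast Finset.prod_pos fun k _ => (u' k).den_pos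
  refine ⟨u, fun i => ?_, fun i => ?_⟩
  · have : (0:ℚ) < u i := by rw [hu]; exact mul_pos hP (hu' i)
    exact_mod_cast this
  · have : ∑ j, (a i j : ℚ) * u j = m * u i := by
      simp only [hu]
      rw [mul_left_comm, ← hrel', Finset.mul_sum]
      refine Finset.sum_congr rfl fun j _ => by ring
    exact_mod_cast this

theorem gd_mulpos {p : ℕ} (A B : Matrix (Fin p) (Fin p) ℕ) (i j : Fin p) :
    0 < (A * B) i j ↔ ∃ l, 0 < A i l ∧ 0 < B l j := by
  rw [Matrix.mul_apply, Finset.sum_pos_iff]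
  simp

theorem gd_supp {p : ℕ} (A : Matrix (Fin p) (Fin p) ℕ) :
    ∃ L, 0 < L ∧ ∀ n, 0 < n → ∀ i j, 0 < (A ^ (L * n)) i j ↔ 0 < (A ^ L) i j := by
  let s : ℕ → Set (Fin p × Fin p) := fun n => {q | 0 < (A ^ n) q.1 q.2}
  have hadd : ∀ n n' k, s n = s n' → s (n + k) = s (n' + k) := by
    intro n n' k h
    ext ⟨i, j⟩
    have h' : ∀ l, 0 < (A ^ n) i l ↔ 0 < (A ^ n') i l := fun l => by
      have := Set.ext_iff.1 h (i, l)
      exact this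
    simp only [s, Set.mem_setOf_eq, pow_add, gd_mulpos, h']
  obtain ⟨x, y, hxy, hs⟩ := Finite.exists_ne_map_eq_of_infinite s
  wlog hlt : x < y generalizing x y
  · exact this y x hxy.symm hs.symm (by omega)
  obtain ⟨d, rfl⟩ : ∃ d, y = x + d := ⟨y - x, by omega⟩
  have hd : 0 < d := by omega
  have h1 : ∀ n, x ≤ n → s (n + d) = s n := by
    intro n hn
    obtain ⟨k, rfl⟩ : ∃ k, n = x + k := ⟨n - x, by omega⟩
    rw [hadd x (x + d) k hs]
    congr 1; ring
  have h2 : ∀ c n, x ≤ n → s (n + d * c) = s n := by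
    intro c
    induction c with
    | zero => intro n _; simp
    | succ c ih =>
      intro n hn
      rw [mul_add, mul_one, ← add_assoc, h1 _ (by omega), ih n hn]
  refine ⟨d * (x + 1), by positivity, fun n hn i j => ?_⟩
  obtain ⟨n, rfl⟩ : ∃ k, n = k + 1 := ⟨n - 1, by omega⟩
  have h3 := h2 ((x + 1) * n) (d * (x + 1)) (by nlinarith)
  have h4 := Set.ext_iff.1 h3 (i, j)
  simp only [s, Set.mem_setOf_eq] at h4
  rw [← h4, show d * (x + 1) * (n + 1) = d * (x + 1) + d * ((x + 1) * n) by ring]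

theorem gd_color {p s W Z : ℕ} (b w : Fin p → ℕ) (z : Fin p → ℤ) (hs : 0 < s)
    (hz : ∑ k, z k * (w k : ℤ) = 1) (hZ : ∀ k, |z k| ≤ Z)
    (hsum : ∑ k, b k * w k = s * W)
    (hb : ∀ k, z k ≠ 0 → s * (s * ((∑ k, w k) * Z)) ≤ b k) :
    ∃ χ : (Σ k, Fin (b k)) → Fin s, ∀ c, ∑ e, (if χ e = c then w e.1 else 0) = W := by
  set D := ∑ k, w k with hD
  have hs' : (0:ℤ) < s := by exact_mod_cast hs
  let q : Fin p → ℤ := fun k => ((b k / s : ℕ) : ℤ)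
  have hq0 : ∀ k, 0 ≤ q k := fun k => by positivity
  have hq1 : ∀ k, s * q k ≤ b k := fun k => by
    have := Nat.mul_div_le (b k) s
    simp only [q]; exact_mod_cast this
  have hq2 : ∀ k, (b k : ℤ) ≤ s * q k + s := fun k => by
    have := Nat.lt_mul_div_succ (b k) hs
    have h2 : (b k : ℤ) < s * (q k + 1) := by simp only [q]; exact_mod_cast this
    linarith
  have hsumZ : ∑ k, (b k : ℤ) * w k = s * W := by exact_mod_cast hsum
  let δ : ℤ := W - ∑ k, q k * w k
  have hδ : s * δ = ∑ k, (b k - s * q k) * (w k : ℤ) := by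
    simp only [δ, sub_mul, Finset.sum_sub_distrib, mul_sub, Finset.mul_sum, hsumZ, mul_assoc]
  have hδ0 : 0 ≤ δ := by
    have : 0 ≤ s * δ := by
      rw [hδ]
      refine Finset.sum_nonneg fun k _ => mul_nonneg (by linarith [hq1 k]) (by positivity)
    nlinarith
  have hδD : δ ≤ D := by
    have : s * δ ≤ s * D := by
      rw [hδ, hD]
      push_cast
      rw [Finset.mul_sum]
      refine Finset.sum_le_sum fun k _ => mul_le_mul_of_nonneg_right (by linarith [hq2 k]) (by positivity)
    nlinarith
  have hDZ : ∀ k, |δ * z k| ≤ D * Z := by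
    intro k
    rw [abs_mul, abs_of_nonneg hδ0]
    exact mul_le_mul hδD (hZ k) (abs_nonneg _) (by positivity)
  have hqbig : ∀ k, z k ≠ 0 → (s : ℤ) * (D * Z) ≤ q k := by
    intro k hk
    have := (Nat.le_div_iff_mul_le hs).2 ((mul_comm _ _).trans_le (hb k hk))
    simp only [q]; exact_mod_cast this
  have hDZ0 : (0:ℤ) ≤ D * Z := by positivity
  let c0 : Fin s := ⟨0, hs⟩
  let x : Fin s → Fin p → ℤ := fun c k =>
    if c = c0 then b k - (s - 1) * (q k + δ * z k) else q k + δ * z k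
  have hx0 : ∀ c k, 0 ≤ x c k := by
    intro c k
    simp only [x]
    by_cases hzk : z k = 0
    · split_ifs
      · rw [hzk]
        have := hq1 k
        have := hq0 k
        nlinarith
      · rw [hzk]; simpa using hq0 k
    · have h1 := hqbig k hzk
      have h2 := abs_le.1 (hDZ k)
      have h3 := hq1 k
      split_ifs
      · have h4 : ((s:ℤ) - 1) * (δ * z k) ≤ (s - 1) * (D * Z) :=
          mul_le_mul_of_nonneg_left h2.2 (by linarith)
        nlinarith
      · nlinarith
  have hxc : ∀ k, ∑ c, x c k = b k := by
    intro k
    have h1 : ∀ c, x c k = (q k + δ * z k) + if c = c0 then b k - s * (q k + δ * z k) else 0 := by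
      intro c
      simp only [x]
      split_ifs <;> ring
    simp only [h1, Finset.sum_add_distrib, Finset.sum_const, Finset.sum_ite_eq', Finset.mem_univ,
      if_true, Finset.card_univ, Fintype.card_fin, nsmul_eq_mul]
    ring
  have hbase : ∑ k, (q k + δ * z k) * (w k : ℤ) = W := by
    simp only [add_mul, Finset.sum_add_distrib, mul_assoc]
    rw [← Finset.mul_sum, hz]
    simp only [δ]; ring
  have hxW : ∀ c, ∑ k, x c k * (w k : ℤ) = W := by
    intro c
    simp only [x]
    split_ifs
    · simp only [sub_mul _ _ (w _ : ℤ), Finset.sum_sub_distrib, mul_assoc _ _ (w _ : ℤ)]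
      rw [← Finset.mul_sum, hbase, hsumZ]; ring
    · exact hbase
  let y : Fin s → Fin p → ℕ := fun c k => (x c k).toNat
  have hy : ∀ c k, (y c k : ℤ) = x c k := fun c k => Int.toNat_of_nonneg (hx0 c k)
  have hyc : ∀ k, ∑ c, y c k = b k := by
    intro k
    have := hxc k
    simp only [← hy] at this
    exact_mod_cast this
  have hyW : ∀ c, ∑ k, y c k * w k = W := by
    intro c
    have := hxW c
    simp only [← hy] at this
    exact_mod_cast this
  let ψ : ∀ k, Fin (b k) ≃ Σ c, Fin (y c k) := fun k =>
    (Fintype.equivFinOfCardEq (by simp [hyc])).symm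
  refine ⟨fun e => (ψ e.1 e.2).1, fun c => ?_⟩
  rw [Fintype.sum_sigma, ← hyW c]
  refine Finset.sum_congr rfl fun k _ => ?_
  rw [(ψ k).sum_comp (fun f => if f.1 = c then w k else 0), Fintype.sum_sigma]
  simp only
  rw [Finset.sum_eq_single c]
  · simp
  · intro d _ hd
    simp [hd]
  · simp

theorem gd_bezout {p : ℕ} (O : Finset (Fin p)) (w : Fin p → ℕ) (h : O.gcd w = 1) :
    ∃ z : Fin p → ℤ, (∀ k, k ∉ O → z k = 0) ∧ ∑ k, z k * (w k : ℤ) = 1 := by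
  have key : ∀ O : Finset (Fin p), ∃ z : Fin p → ℤ, (∀ k, k ∉ O → z k = 0) ∧
      ∑ k, z k * (w k : ℤ) = (O.gcd w : ℕ) := by
    intro O
    induction O using Finset.induction_on with
    | empty => exact ⟨fun _ => 0, fun _ _ => rfl, by simp⟩
    | insert a s ha ih =>
      obtain ⟨z, hz0, hz⟩ := ih
      rw [Finset.gcd_insert]
      have hb := Nat.gcd_eq_gcd_ab (w a) (s.gcd w)
      refine ⟨fun k => Nat.gcdB (w a) (s.gcd w) * z k +
        if k = a then Nat.gcdA (w a) (s.gcd w) else 0, ?_, ?_⟩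
      · intro k hk
        simp only [Finset.mem_insert, not_or] at hk
        simp [hz0 k hk.2, hk.1]
      · simp only [add_mul, Finset.sum_add_distrib, mul_assoc, ← Finset.mul_sum, hz, ite_mul,
          zero_mul, Finset.sum_ite_eq', Finset.mem_univ, if_true]
        rw [show GCDMonoid.gcd (w a) (s.gcd w) = Nat.gcd (w a) (s.gcd w) from rfl, hb]
        ring
  obtain ⟨z, h1, h2⟩ := key O
  exact ⟨z, h1, by rw [h2, h]; rfl⟩
theorem gd_comb {p M : ℕ} (hM : 2 ≤ M) (B : Matrix (Fin p) (Fin p) ℕ) (u : Fin p → ℕ)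
    (hu : ∀ i, 0 < u i) (hBu : ∀ i, ∑ j, B i j * u j = M * u i)
    (hB : ∀ n, 0 < n → ∀ i j, 0 < (B ^ n) i j ↔ 0 < B i j) :
    ∃ n, 0 < n ∧ ∃ (F : Fin p → Prop) (w : Fin p → ℕ),
      (∀ j, F j → ∀ k, 0 < (B ^ n) j k → F k) ∧ (∀ j, F j → 0 < w j) ∧
      (∀ j, F j → ∃ χ : (Σ k, Fin ((B ^ n) j k)) → Fin (w j),
        ∀ c, ∑ e, (if χ e = c then w e.1 else 0) = M ^ n) ∧
      (∀ j, ¬ F j → ∑ k, (if F k then 0 else (B ^ n) j k) < M ^ n) ∧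
      (∀ j, ¬ F j → ∃ k, F k ∧ 0 < (B ^ n) j k) := by
  have htrans : ∀ i j k, 0 < B i j → 0 < B j k → 0 < B i k := by
    intro i j k h1 h2
    rw [← hB 2 (by norm_num), pow_two, gd_mulpos]
    exact ⟨j, h1, h2⟩
  have hserial : ∀ i, ∃ j, 0 < B i j := by
    intro i
    by_contra hc
    push Not at hc
    have h1 := hBu i
    rw [Finset.sum_eq_zero (fun j _ => by rw [Nat.le_zero.1 (hc j), zero_mul])] at h1
    have := hu i
    have : 0 < M * u i := by positivity
    omega
  have hpowu : ∀ n i, ∑ j, (B ^ n) i j * u j = M ^ n * u i := by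
    intro n
    induction n with
    | zero => intro i; simp [Matrix.one_apply]
    | succ n ih =>
      intro i
      simp only [pow_succ, Matrix.mul_apply, Finset.sum_mul]
      rw [Finset.sum_comm]
      simp only [mul_assoc, ← Finset.mul_sum, hBu]
      have : ∀ x, (B ^ n) i x * (M * u x) = M * ((B ^ n) i x * u x) := fun x => by ring
      simp only [this, ← Finset.mul_sum, ih]
      ring
  let out : Fin p → Finset (Fin p) := fun j => Finset.univ.filter fun k => 0 < B j k
  have hout : ∀ j k, k ∈ out j ↔ 0 < B j k := by simp [out]
  let F : Fin p → Prop := fun j => ∀ k, 0 < B j k → 0 < B k j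
  have hFself : ∀ j, F j → 0 < B j j := by
    intro j hj
    obtain ⟨k, hk⟩ := hserial j
    exact htrans j k j hk (hj k hk)
  have hFclosed : ∀ j, F j → ∀ k, 0 < B j k → F k := by
    intro j hj k hk l hl
    have h1 := htrans j k l hk hl
    exact htrans l j k (hj l h1) hk
  have hFout : ∀ j, F j → ∀ k, 0 < B j k → out k = out j := by
    intro j hj k hk
    ext l
    rw [hout, hout]
    exact ⟨fun h => htrans _ _ _ hk h, fun h => htrans _ _ _ (hj k hk) h⟩
  have hreach : ∀ i, ∃ j, F j ∧ 0 < B i j := by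
    intro i
    have hne : (out i).Nonempty := by
      obtain ⟨j, hj⟩ := hserial i
      exact ⟨j, (hout _ _).2 hj⟩
    obtain ⟨k, hk, hmin⟩ := Finset.exists_min_image (out i) (fun k => (out k).card) hne
    rw [hout] at hk
    have hsub : ∀ l, 0 < B k l → out l = out k := by
      intro l hl
      apply Finset.eq_of_subset_of_card_le
      · intro x hx
        rw [hout] at hx ⊢
        exact htrans _ _ _ hl hx
      · exact hmin l ((hout _ _).2 (htrans _ _ _ hk hl))
    obtain ⟨l, hl⟩ := hserial k
    refine ⟨l, ?_, htrans _ _ _ hk hl⟩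
    intro l' hl'
    rw [← hout, hsub l' (htrans _ _ _ hl hl'), hout]
    exact hl
  let g : Fin p → ℕ := fun j => (out j).gcd u
  let w : Fin p → ℕ := fun j => u j / g j
  have hgdvd : ∀ j, F j → g j ∣ u j := fun j hj =>
    Finset.gcd_dvd ((hout _ _).2 (hFself j hj))
  have hgpos : ∀ j, F j → 0 < g j := fun j hj => Nat.pos_of_dvd_of_pos (hgdvd j hj) (hu j)
  have hwpos : ∀ j, F j → 0 < w j := fun j hj =>
    Nat.div_pos (Nat.le_of_dvd (hu j) (hgdvd j hj)) (hgpos j hj)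
  have hgw : ∀ j, F j → g j * w j = u j := fun j hj => Nat.mul_div_cancel' (hgdvd j hj)
  have hgeq : ∀ j, F j → ∀ k, 0 < B j k → g k = g j := by
    intro j hj k hk
    simp only [g, hFout j hj k hk]
  have hwgcd : ∀ j, F j → (out j).gcd w = 1 := by
    intro j hj
    have h1 : (out j).gcd (fun k => g j * w k) = (out j).gcd u := by
      refine Finset.gcd_congr rfl fun k hk => ?_
      rw [hout] at hk
      rw [← hgeq j hj k hk, hgw k (hFclosed j hj k hk)]
    rw [Finset.gcd_mul_left] at h1
    have h2 := hgpos j hj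
    simp only [normalize_eq] at h1
    exact Nat.eq_of_mul_eq_mul_left h2 (by rw [h1, mul_one])
  have hzero : ∀ n, 0 < n → ∀ j k, ¬ 0 < B j k → (B ^ n) j k = 0 := by
    intro n hn j k h
    by_contra hc
    exact h ((hB n hn j k).1 (Nat.pos_of_ne_zero hc))
  have hwsum : ∀ n, 0 < n → ∀ j, F j → ∑ k, (B ^ n) j k * w k = w j * M ^ n := by
    intro n hn j hj
    apply Nat.eq_of_mul_eq_mul_left (hgpos j hj)
    rw [← mul_assoc, hgw j hj, mul_comm (u j), ← hpowu, Finset.mul_sum]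
    refine Finset.sum_congr rfl fun k _ => ?_
    by_cases hk : 0 < B j k
    · rw [← hgw k (hFclosed j hj k hk), hgeq j hj k hk]; ring
    · rw [hzero n hn j k hk]; simp
  set U := ∑ k, u k with hU
  have huU : ∀ k, u k ≤ U := fun k => Finset.single_le_sum (fun _ _ => Nat.zero_le _) (Finset.mem_univ k)
  have hgrow : ∀ n, 0 < n → ∀ j, F j → ∀ k, 0 < B j k → M ^ n ≤ U * (B ^ (n+1)) j k := by
    intro n hn j hj k hk
    calc M ^ n ≤ M ^ n * u j := Nat.le_mul_of_pos_right _ (hu j)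
      _ = ∑ l, (B ^ n) j l * u l := (hpowu n j).symm
      _ ≤ ∑ l, U * ((B ^ n) j l * B l k) := by
        refine Finset.sum_le_sum fun l _ => ?_
        by_cases hl : 0 < B j l
        · have h1 : 0 < B l k := htrans _ _ _ (hj l hl) hk
          calc (B ^ n) j l * u l ≤ (B ^ n) j l * U := Nat.mul_le_mul_left _ (huU l)
            _ = U * ((B ^ n) j l * 1) := by ring
            _ ≤ _ := Nat.mul_le_mul_left _ (Nat.mul_le_mul_left _ h1)
        · rw [hzero n hn j l hl]; simp
      _ = U * (B ^ (n+1)) j k := by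
        rw [pow_succ, Matrix.mul_apply, Finset.mul_sum]
  have hbig : ∀ T : ℕ, ∀ᶠ n in Filter.atTop, ∀ j, F j → ∀ k, 0 < B j k → T ≤ (B ^ n) j k := by
    intro T
    filter_upwards [Filter.eventually_ge_atTop (U * T + 2)] with n hn j hj k hk
    obtain ⟨n, rfl⟩ : ∃ n', n = n' + 1 := ⟨n - 1, by omega⟩
    have h1 := hgrow n (by omega) j hj k hk
    have h2 : n < M ^ n := Nat.lt_pow_self (by omega)
    have h3 : 0 < U := (hu j).trans_le (huU j)
    have h4 : U * T ≤ U * (B ^ (n+1)) j k := by omega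
    exact Nat.le_of_mul_le_mul_left h4 h3
  have hcol : ∀ j, F j → ∀ᶠ n in Filter.atTop, ∃ χ : (Σ k, Fin ((B ^ n) j k)) → Fin (w j),
        ∀ c, ∑ e, (if χ e = c then w e.1 else 0) = M ^ n := by
    intro j hj
    obtain ⟨z, hz0, hz⟩ := gd_bezout (out j) w (hwgcd j hj)
    have hZ : ∀ k, |z k| ≤ ((∑ k, (z k).natAbs : ℕ) : ℤ) := by
      intro k
      rw [Int.abs_eq_natAbs]
      exact_mod_cast Finset.single_le_sum (f := fun k => (z k).natAbs) (fun _ _ => Nat.zero_le _)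
        (Finset.mem_univ k)
    filter_upwards [hbig (w j * (w j * ((∑ k, w k) * (∑ k, (z k).natAbs)))),
      Filter.eventually_gt_atTop 0] with n hn hn0
    refine gd_color _ w z (hwpos j hj) hz hZ (hwsum n hn0 j hj) ?_
    intro k hk
    refine hn j hj k ?_
    rw [← hout]
    by_contra hc
    exact hk (hz0 k hc)
  have hcol' : ∀ᶠ n in Filter.atTop, ∀ j, F j → ∃ χ : (Σ k, Fin ((B ^ n) j k)) → Fin (w j),
        ∀ c, ∑ e, (if χ e = c then w e.1 else 0) = M ^ n := by
    rw [Filter.eventually_all]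
    intro j
    by_cases hj : F j
    · filter_upwards [hcol j hj] with n hn _
      exact hn
    · exact Filter.Eventually.of_forall fun n h => absurd h hj
  have hFT : ∀ n l k, F l → ¬ F k → (B ^ n) l k = 0 := by
    intro n l k hl hk
    rcases Nat.eq_zero_or_pos n with rfl | hn
    · rw [pow_zero, Matrix.one_apply_ne]
      rintro rfl
      exact hk hl
    · exact hzero n hn l k (fun h => hk (hFclosed l hl k h))
  have hT : ∀ᶠ n in Filter.atTop, ∀ j, ¬ F j → ∑ k, (if F k then 0 else (B ^ n) j k) < M ^ n := by
    rcases Nat.eq_zero_or_pos U with hU0 | hUpos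
    · refine Filter.Eventually.of_forall fun n j => ?_
      have := huU j
      have := hu j
      omega
    have hUR : (0:ℝ) < U := by exact_mod_cast hUpos
    have hU1 : (1:ℝ) ≤ U := by exact_mod_cast hUpos
    have hMR : (2:ℝ) ≤ M := by exact_mod_cast hM
    let θ : ℝ := M - 1 / U
    have hUi : 1 / (U:ℝ) ≤ 1 := by rw [div_le_one hUR]; exact hU1
    have hUi0 : 0 < 1 / (U:ℝ) := by positivity
    have hθ0 : 0 ≤ θ := by simp only [θ]; linarith
    have hθM : θ < M := by simp only [θ]; linarith
    have hstep : ∀ j, ¬ F j → ∑ k, (if F k then (0:ℝ) else B j k * u k) ≤ θ * u j := by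
      intro j hj
      obtain ⟨k0, hk0, hpos⟩ := hreach j
      have h1 : ∑ k, (if F k then 0 else B j k * u k) + 1 ≤ M * u j := by
        rw [← hBu j]
        have h2 : ∑ k, B j k * u k = ∑ k, (if F k then 0 else B j k * u k) +
            ∑ k, (if F k then B j k * u k else 0) := by
          rw [← Finset.sum_add_distrib]
          refine Finset.sum_congr rfl fun k _ => ?_
          split_ifs <;> simp
        rw [h2]
        gcongr
        have h3 := Finset.single_le_sum (f := fun k => if F k then B j k * u k else 0)
          (fun _ _ => Nat.zero_le _) (Finset.mem_univ k0)
        simp only [hk0, if_true] at h3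
        exact le_trans (Nat.mul_pos hpos (hu k0)) h3
      have h4 : ∑ k, (if F k then (0:ℝ) else B j k * u k) + 1 ≤ M * u j := by
        have : ((∑ k, (if F k then 0 else B j k * u k) + 1 : ℕ) : ℝ) ≤ (M * u j : ℕ) := by
          exact_mod_cast h1
        push_cast at this
        exact this
      have h5 : (u j : ℝ) / U ≤ 1 := by
        rw [div_le_one hUR]; exact_mod_cast huU j
      have h6 : θ * u j = M * u j - u j / U := by simp only [θ]; ring
      linarith
    have hind : ∀ n j, ¬ F j → ∑ k, (if F k then (0:ℝ) else (B ^ n) j k * u k) ≤ θ ^ n * u j := by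
      intro n
      induction n with
      | zero =>
        intro j hj
        rw [Finset.sum_eq_single j]
        · simp [hj]
        · intro k _ hk
          simp [Matrix.one_apply_ne hk.symm]
        · simp
      | succ n ih =>
        intro j hj
        have h1 : ∀ k, (if F k then (0:ℝ) else ((B ^ (n+1)) j k : ℕ) * u k) =
            ∑ l, (if F l then (0:ℝ) else B j l) * (if F k then (0:ℝ) else (B ^ n) l k * u k) := by
          intro k
          by_cases hk : F k
          · simp [hk]
          · simp only [hk, if_false]
            rw [pow_succ', Matrix.mul_apply]
            push_cast
            rw [Finset.sum_mul]
            refine Finset.sum_congr rfl fun l _ => ?_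
            by_cases hl : F l
            · simp [hl, hFT n l k hl hk]
            · simp [hl]; ring
        simp only [h1]
        rw [Finset.sum_comm]
        simp only [← Finset.mul_sum]
        calc _ ≤ ∑ l, (if F l then (0:ℝ) else B j l) * (θ ^ n * u l) := by
              refine Finset.sum_le_sum fun l _ => ?_
              by_cases hl : F l
              · simp [hl]
              · simp only [hl, if_false]
                exact mul_le_mul_of_nonneg_left (ih l hl) (by positivity)
          _ = θ ^ n * ∑ l, (if F l then (0:ℝ) else B j l * u l) := by
              rw [Finset.mul_sum]
              refine Finset.sum_congr rfl fun l _ => ?_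
              split_ifs
              · simp
              · ring
          _ ≤ θ ^ n * (θ * u j) := by
              exact mul_le_mul_of_nonneg_left (hstep j hj) (by positivity)
          _ = _ := by ring
    have hMpos : (0:ℝ) < M := by linarith
    have hlim : Filter.Tendsto (fun n : ℕ => (θ / M) ^ n) Filter.atTop (nhds 0) :=
      tendsto_pow_atTop_nhds_zero_of_lt_one (by positivity) (by rw [div_lt_one hMpos]; exact hθM)
    filter_upwards [hlim.eventually_lt_const hUi0] with n hn j hj
    have h1 := hind n j hj
    have h2 : ((∑ k, (if F k then 0 else (B ^ n) j k) : ℕ) : ℝ) ≤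
        ∑ k, (if F k then (0:ℝ) else (B ^ n) j k * u k) := by
      push_cast
      refine Finset.sum_le_sum fun k _ => ?_
      split_ifs
      · simp
      · have : (1:ℝ) ≤ u k := by exact_mod_cast hu k
        exact le_mul_of_one_le_right (by positivity) this
    have h3 : θ ^ n * u j ≤ θ ^ n * U := by
      have : (u j : ℝ) ≤ U := by exact_mod_cast huU j
      gcongr
    have h4 : θ ^ n * U < M ^ n := by
      rw [div_pow, div_lt_iff₀ (by positivity), div_mul_eq_mul_div, lt_div_iff₀ hUR, one_mul] at hn
      exact hn
    have h5 : ((∑ k, (if F k then 0 else (B ^ n) j k) : ℕ) : ℝ) < ((M ^ n : ℕ) : ℝ) := by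
      push_cast at h2 ⊢
      linarith
    exact_mod_cast h5
  obtain ⟨n, hn1, hn2, hn3⟩ := (hcol'.and (hT.and (Filter.eventually_gt_atTop 0))).exists
  refine ⟨n, hn3, F, w, ?_, hwpos, hn1, (fun j hj => by convert hn2 j hj), ?_⟩
  · intro j hj k hk
    exact hFclosed j hj k ((hB n hn3 j k).1 hk)
  · intro j _
    obtain ⟨k, hk, hp⟩ := hreach j
    exact ⟨k, hk, (hB n hn3 j k).2 hp⟩

/-- **Theorem 1.** If `K_1, …, K_p` are dust-like graph-directed sets with ratio
`r ∈ (0,1)` and integer characteristic `m ≥ 2`, then every `K_i` is bilipschitz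
equivalent to the symbolic space `Σ_m^r`. -/
theorem dustlike_graphDirected_bilip_symb
    {X : Type*} [MetricSpace X] [CompactSpace X] {p : ℕ} {r : ℝ}
    (hr : r ∈ Set.Ioo (0 : ℝ) 1) {m : ℕ} (hm : 2 ≤ m)
    (G : GraphDirected X p r) (hG : G.HasCharacteristic m) :
    ∀ i : Fin p, BilipWithSymb (G.K i) m r := by
  obtain ⟨hr0, hr1⟩ := hr
  obtain ⟨v, hv, hAv⟩ := hG
  obtain ⟨u, hu, hAu⟩ := gd_intvec G.a v hv hAv
  obtain ⟨L, hL, hsupp⟩ := gd_supp (Matrix.of G.a)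
  have hpowu : ∀ n i, ∑ j, ((Matrix.of G.a) ^ n : Matrix (Fin p) (Fin p) ℕ) i j * u j
      = m ^ n * u i := by
    intro n
    induction n with
    | zero => intro i; simp [Matrix.one_apply]
    | succ n ih =>
      intro i
      simp only [pow_succ (Matrix.of G.a), Matrix.mul_apply, Finset.sum_mul]
      rw [Finset.sum_comm]
      simp only [mul_assoc, ← Finset.mul_sum, Matrix.of_apply, hAu]
      have : ∀ x, ((Matrix.of G.a) ^ n : Matrix (Fin p) (Fin p) ℕ) i x * (m * u x)
        = m * (((Matrix.of G.a) ^ n : Matrix (Fin p) (Fin p) ℕ) i x * u x) := fun x => by ring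
      simp only [this, ← Finset.mul_sum, ih]
      ring
  have hpow2 : ∀ N, 0 < N → 2 ≤ m ^ N := fun N hN =>
    hm.trans (Nat.le_self_pow hN.ne' m)
  obtain ⟨n, hn, F, w, h1, h2, h3, h4, h5⟩ := gd_comb (hpow2 L hL) ((Matrix.of G.a) ^ L) u hu
    (hpowu L) (fun n hn i j => by rw [← pow_mul]; exact hsupp n hn i j)
  have hN : 0 < L * n := Nat.mul_pos hL hn
  obtain ⟨N, hNe⟩ : ∃ N, L * n = N + 1 := ⟨L * n - 1, by omega⟩
  obtain ⟨G', hK, ha⟩ := gd_pow hr0 G N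
  have hQ : ((Matrix.of G.a) ^ L) ^ n = Matrix.of G'.a := by
    rw [← pow_mul, hNe]
    ext i j
    exact (ha i j).symm
  have hMM : (m ^ L) ^ n = m ^ (N + 1) := by rw [← pow_mul, hNe]
  generalize ((Matrix.of G.a) ^ L) ^ n = Q at h1 h3 h4 h5 hQ
  generalize (m ^ L) ^ n = M1 at h3 h4 hMM
  subst hQ hMM
  have hRpos : 0 < r ^ (N + 1) := by positivity
  have hR1 : r ^ (N + 1) < 1 := pow_lt_one₀ hr0.le hr1 (by omega)
  have hgood := gd_core (hpow2 (N + 1) (by omega)) hRpos hR1 G' F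
    (gd_coreF (hpow2 (N + 1) (by omega)) hRpos hR1 G' F w h1 h2 h3) h4 h5
  intro i
  refine gd_block hr0 hr1 (L := N + 1) (by omega) ?_
  rw [← hK]
  exact hgood i
end

section
/- Let r_1, r_2 ∈ (0,1) and let m_1, m_2 ≥ 2 be integers. If K ∈ 𝔄_{m_1}^{r_1} and K′ ∈ 𝔄_{m_2}^{r_2}, then K and K′ are bilipschitz equivalent if and only if there exist integers k_1, k_2 ≥ 1 such that r_1^{k_1} = r_2^{k_2} and m_1^{k_1} = m_2^{k_2}. -/
open scoped Classical

namespace GDB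
universe u

def BL {X : Type*} {Y : Type*} (R : ℕ → X → X → Prop) (R' : ℕ → Y → Y → Prop) : Prop :=
  ∃ f : X ≃ Y, ∃ c : ℕ, ∀ n x y, (R (n+c) x y → R' n (f x) (f y)) ∧
    (R' (n+c) (f x) (f y) → R n x y)

theorem BL.symm {X Y : Type*} {R : ℕ → X → X → Prop} {R' : ℕ → Y → Y → Prop}
    (h : BL R R') : BL R' R := by
  obtain ⟨f, c, h⟩ := h
  refine ⟨f.symm, c, fun n x y => ⟨fun hh => ?_, fun hh => ?_⟩⟩
  · exact (h n _ _).2 (by simpa using hh)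
  · simpa using (h n _ _).1 hh

theorem BL.trans {X Y Z : Type*} {R : ℕ → X → X → Prop} {R' : ℕ → Y → Y → Prop}
    {R'' : ℕ → Z → Z → Prop} (h : BL R R') (h' : BL R' R'') : BL R R'' := by
  obtain ⟨f, c, h⟩ := h
  obtain ⟨g, d, k⟩ := h'
  refine ⟨f.trans g, d + c, fun n x y => ⟨fun hh => ?_, fun hh => ?_⟩⟩
  · exact (k n _ _).1 ((h _ _ _).1 (by rwa [add_assoc]))
  · exact (h n _ _).2 ((k _ _ _).2 (by rw [add_assoc, add_comm c d]; exact hh))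

structure Fam where
  V : Type
  E : V → Type
  tgt : ∀ i, E i → V
  X : V → Type u
  dec : ∀ i, X i ≃ Σ e : E i, X (tgt i e)

def Fam.R (F : Fam.{u}) : ℕ → ∀ i, F.X i → F.X i → Prop
  | 0, _, _, _ => True
  | n+1, i, x, y => ∃ e x' y', F.dec i x = ⟨e, x'⟩ ∧ F.dec i y = ⟨e, y'⟩ ∧
      Fam.R F n (F.tgt i e) x' y'

variable (F : Fam.{u})

theorem Fam.R_refl (n : ℕ) : ∀ i x, F.R n i x x := by
  induction n with
  | zero => intros; trivial
  | succ n ih => intro i x; exact ⟨_, _, _, rfl, rfl, ih _ _⟩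

theorem Fam.R_symm (n : ℕ) : ∀ i x y, F.R n i x y → F.R n i y x := by
  induction n with
  | zero => intros; trivial
  | succ n ih =>
    rintro i x y ⟨e, x', y', h1, h2, h3⟩; exact ⟨_, _, _, h2, h1, ih _ _ _ h3⟩

theorem Fam.R_trans (n : ℕ) : ∀ i x y z, F.R n i x y → F.R n i y z → F.R n i x z := by
  induction n with
  | zero => intros; trivial
  | succ n ih =>
    rintro i x y z ⟨e, x', y', h1, h2, h3⟩ ⟨e2, y2, z', k1, k2, k3⟩
    rw [h2] at k1
    obtain ⟨rfl, hh⟩ := Sigma.mk.inj k1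
    obtain rfl := eq_of_heq hh
    exact ⟨_, _, _, h1, k2, ih _ _ _ _ h3 k3⟩

theorem Fam.R_succ (n : ℕ) : ∀ i x y, F.R (n+1) i x y → F.R n i x y := by
  induction n with
  | zero => intros; trivial
  | succ n ih =>
    rintro i x y ⟨e, x', y', h1, h2, h3⟩; exact ⟨_, _, _, h1, h2, ih _ _ _ h3⟩

theorem Fam.R_anti {n k : ℕ} (h : n ≤ k) (i x y) (hh : F.R k i x y) : F.R n i x y := by
  induction h with
  | refl => exact hh
  | step _ ih => exact ih (F.R_succ _ _ _ _ hh)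

def Fam.Sep (i : F.V) : Prop := ∀ x y, (∀ n, F.R n i x y) → x = y
def Fam.Comp (i : F.V) : Prop := ∀ s : ℕ → F.X i, (∀ n, F.R n i (s n) (s (n+1))) →
  ∃ x, ∀ n, F.R n i x (s n)

def RD (b M : ℕ) (n : ℕ) (x y : Fin b × (ℕ → Fin M)) : Prop :=
  x.1 = y.1 ∧ ∀ k < n, x.2 k = y.2 k

def RS (M : ℕ) (n : ℕ) (x y : ℕ → Fin M) : Prop := ∀ k < n, x k = y k

theorem RS.anti {M n k} {x y : ℕ → Fin M} (h : RS M k x y) (hn : n ≤ k) : RS M n x y :=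
  fun j hj => h j (by omega)

def Fam.T (ω : Σ i, F.X i) : Σ i, F.X i := ⟨F.tgt ω.1 (F.dec ω.1 ω.2).1, (F.dec ω.1 ω.2).2⟩

section
variable {F}
variable {v : F.V → ℕ} {M : ℕ} (a : ∀ i, F.E i → Fin (v i))
  (Φ : ∀ i, (Σ e : F.E i, Fin (v (F.tgt i e))) ≃ Fin (v i) × Fin M)

def tr_h (ω : Σ i, F.X i) : Fin (v ω.1) := a ω.1 (F.dec ω.1 ω.2).1
def tr_l (ω : Σ i, F.X i) : Fin M := (Φ ω.1 ⟨(F.dec ω.1 ω.2).1, tr_h a (F.T ω)⟩).2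
def tr_f (i : F.V) (x : F.X i) : Fin (v i) × (ℕ → Fin M) :=
  (tr_h a ⟨i, x⟩, fun n => tr_l a Φ (F.T^[n] ⟨i, x⟩))

theorem tr_f_snd_zero (i x) : (tr_f a Φ i x).2 0 =
    (Φ i ⟨(F.dec i x).1, (tr_f a Φ _ (F.dec i x).2).1⟩).2 := rfl
theorem tr_f_snd_succ (i x n) : (tr_f a Φ i x).2 (n+1) =
    (tr_f a Φ _ (F.dec i x).2).2 n := rfl

theorem tr_fwd (n : ℕ) : ∀ i x y, F.R (n+1) i x y → RD (v i) M n (tr_f a Φ i x) (tr_f a Φ i y) := by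
  induction n with
  | zero =>
    rintro i x y ⟨e, x', y', h1, h2, h3⟩
    refine ⟨?_, by simp⟩
    simp [tr_f, tr_h, h1, h2]
  | succ n ih =>
    rintro i x y ⟨e, x', y', h1, h2, h3⟩
    have := ih _ _ _ h3
    refine ⟨by simp [tr_f, tr_h, h1, h2], ?_⟩
    rintro (_|k) hk
    · rw [tr_f_snd_zero, tr_f_snd_zero, h1, h2]; dsimp only; rw [this.1]
    · rw [tr_f_snd_succ, tr_f_snd_succ, h1, h2]; exact this.2 k (by omega)

variable (hΦ : ∀ i p, (Φ i p).1 = a i p.1)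
include hΦ

theorem tr_key (i x) : Φ i ⟨(F.dec i x).1, (tr_f a Φ _ (F.dec i x).2).1⟩ =
    ((tr_f a Φ i x).1, (tr_f a Φ i x).2 0) := by
  ext1
  · rw [hΦ]; rfl
  · rfl

theorem tr_bwd (n : ℕ) : ∀ i x y, RD (v i) M n (tr_f a Φ i x) (tr_f a Φ i y) → F.R n i x y := by
  induction n with
  | zero => intros; trivial
  | succ n ih =>
    intro i x y h
    have hx := tr_key a Φ hΦ i x
    have hy := tr_key a Φ hΦ i y
    rw [h.1, h.2 0 (by omega), ← hy] at hx
    have := (Φ i).injective hx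
    have h2 := h.2
    rcases hdx : F.dec i x with ⟨e, x'⟩
    rcases hdy : F.dec i y with ⟨e2, y'⟩
    have h3 : ∀ k < n, (tr_f a Φ _ (F.dec i x).2).2 k = (tr_f a Φ _ (F.dec i y).2).2 k :=
      fun k hk => h2 (k+1) (by omega)
    rw [hdx, hdy] at this
    rw [hdx, hdy] at h3
    obtain ⟨rfl, hh⟩ := Sigma.mk.inj this
    have hh := eq_of_heq hh
    exact ⟨_, _, _, hdx, hdy, ih _ _ _ ⟨hh, h3⟩⟩

theorem tr_approx (hM : 0 < M) (hne : ∀ i, Fin (v i) → Nonempty (F.X i)) (n : ℕ) :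
    ∀ i (d : Fin (v i) × (ℕ → Fin M)), ∃ x, RD (v i) M n (tr_f a Φ i x) d := by
  induction n with
  | zero =>
    rintro i ⟨t, z⟩
    rcases hp : (Φ i).symm (t, z 0) with ⟨e, t'⟩
    obtain ⟨x'⟩ := hne _ t'
    refine ⟨(F.dec i).symm ⟨e, x'⟩, ?_, by simp⟩
    have := hΦ i ⟨e, t'⟩
    rw [← hp] at this
    simp only [Equiv.apply_symm_apply] at this
    simp only [tr_f, tr_h, Equiv.apply_symm_apply]
    rw [this, hp]
  | succ n ih =>
    rintro i ⟨t, z⟩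
    rcases hp : (Φ i).symm (t, z 0) with ⟨e, t'⟩
    obtain ⟨x', hx'⟩ := ih _ (t', fun k => z (k+1))
    refine ⟨(F.dec i).symm ⟨e, x'⟩, ?_⟩
    have hk := tr_key a Φ hΦ i ((F.dec i).symm ⟨e, x'⟩)
    have hd := tr_f_snd_succ a Φ i ((F.dec i).symm ⟨e, x'⟩)
    rw [Equiv.apply_symm_apply] at hk hd
    dsimp only at hk hd
    rw [hx'.1] at hk
    dsimp only at hk
    rw [← hp, Equiv.apply_symm_apply] at hk
    refine ⟨(congrArg Prod.fst hk).symm, ?_⟩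
    rintro (_|k) hkk
    · exact (congrArg Prod.snd hk).symm
    · rw [hd]; exact hx'.2 k (by omega)

theorem tr_BL (hM : 0 < M) (hne : ∀ i, Fin (v i) → Nonempty (F.X i)) (i : F.V)
    (hs : F.Sep i) (hc : F.Comp i) : BL (fun n => F.R n i) (RD (v i) M) := by
  have hb : Function.Bijective (tr_f a Φ i) := by
    constructor
    · intro x y h
      exact hs _ _ fun n => tr_bwd a Φ hΦ n i x y (by rw [h]; exact ⟨rfl, fun _ _ => rfl⟩)
    · intro d
      choose s hs' using fun n => tr_approx a Φ hΦ hM hne n i d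
      obtain ⟨x, hx⟩ := hc s (fun n => tr_bwd a Φ hΦ n i _ _
        ⟨(hs' n).1.trans (hs' _).1.symm, fun k hk =>
          ((hs' n).2 k hk).trans ((hs' (n+1)).2 k (by omega)).symm⟩)
      refine ⟨x, ?_⟩
      have h1 := fun n => tr_fwd a Φ n i _ _ (hx (n+1))
      ext1
      · exact (h1 0).1.trans (hs' _).1
      · ext1 k
        exact ((h1 (k+1)).2 k (by omega)).trans ((hs' _).2 k (by omega))
  refine ⟨Equiv.ofBijective _ hb, 1, fun n x y => ⟨fun h => tr_fwd a Φ n i x y h, fun h => ?_⟩⟩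
  exact tr_bwd a Φ hΦ n i x y ⟨h.1, fun k hk => h.2 k (by omega)⟩
end
end GDB

namespace GDB

def lev_RO {I : Type*} (M : ℕ) (lam : I → ℕ) (n : ℕ) : Option (I × (ℕ → Fin M)) → Option (I × (ℕ → Fin M)) → Prop
  | none, none => True
  | none, some p => n ≤ lam p.1
  | some p, none => n ≤ lam p.1
  | some p, some q => (n ≤ lam p.1 ∧ n ≤ lam q.1) ∨ (p.1 = q.1 ∧ RS M (n - lam p.1 - 1) p.2 q.2)

theorem RO_BL {I J : Type*} {M : ℕ} {lam : I → ℕ} {mu : J → ℕ} (E : I ≃ J) (b : ℕ)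
    (h1 : ∀ i, lam i ≤ mu (E i)) (h2 : ∀ i, mu (E i) ≤ lam i + b) :
    BL (lev_RO M lam) (lev_RO M mu) := by
  refine ⟨Equiv.optionCongr (E.prodCongr (Equiv.refl _)), b, fun n x y => ⟨fun h => ?_, fun h => ?_⟩⟩
  · rcases x with _ | ⟨i, x⟩ <;> rcases y with _ | ⟨j, y⟩ <;> simp [lev_RO] at h ⊢
    · have := h1 j; omega
    · have := h1 i; omega
    · have := h1 i; have := h1 j
      rcases h with h | ⟨rfl, h⟩
      · left; omega
      · right; exact ⟨rfl, h.anti (by omega)⟩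
  · rcases x with _ | ⟨i, x⟩ <;> rcases y with _ | ⟨j, y⟩ <;> simp [lev_RO] at h ⊢
    · have := h2 j; omega
    · have := h2 i; omega
    · have := h2 i; have := h2 j
      rcases h with h | ⟨rfl, h⟩
      · left; omega
      · right; exact ⟨rfl, h.anti (by omega)⟩

def ring_G {L : ℕ} : Option ((ℕ × Fin L) × (ℕ → Fin (L+1))) → ℕ → Fin (L+1)
  | none, _ => 0
  | some ((k, l), y), n => if n < k then 0 else if n = k then l.succ else y (n - k - 1)

theorem ring_RS {L : ℕ} (n : ℕ) (o o' : Option ((ℕ × Fin L) × (ℕ → Fin (L+1)))) :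
    RS (L+1) n (ring_G o) (ring_G o') ↔ lev_RO (L+1) (fun i : ℕ × Fin L => i.1) n o o' := by
  rcases o with _ | ⟨⟨k, l⟩, y⟩ <;> rcases o' with _ | ⟨⟨k', l'⟩, y'⟩
  · simp [RS, lev_RO]
  · simp only [RS, lev_RO, ring_G]
    constructor
    · intro h
      by_contra hn
      have := h k' (by omega)
      simp at this
      exact Fin.succ_ne_zero _ this.symm
    · intro h j hj; rw [if_pos (by omega)]
  · simp only [RS, lev_RO, ring_G]
    constructor
    · intro h
      by_contra hn
      have := h k (by omega)
      simp at this
    · intro h j hj; rw [if_pos (by omega)]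
  · simp only [RS, lev_RO, ring_G]
    constructor
    · intro h
      by_contra hn
      push Not at hn
      rcases lt_trichotomy k k' with hk | rfl | hk
      · have := h k (by omega)
        simp [hk] at this
      · have h1 := h k (by omega)
        simp at h1
        obtain ⟨j, hj, hne⟩ := hn.2 (by rw [h1])
        apply hne
        have h2 := h (k + 1 + j) (by omega)
        have e1 : ¬ (k + 1 + j < k) := by omega
        have e2 : ¬ (k + 1 + j = k) := by omega
        have e3 : k + 1 + j - k - 1 = j := by omega
        simpa only [e1, e2, e3, if_false] using h2
      · have := h k' (by omega)
        simp [hk] at this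
        exact Fin.succ_ne_zero _ this.symm
    · rintro (h | ⟨h, h'⟩) j hj
      · rw [if_pos (by omega), if_pos (by omega)]
      · simp only [Prod.mk.injEq] at h
        obtain ⟨rfl, rfl⟩ := h
        by_cases h1 : j < k
        · simp [h1]
        by_cases h2 : j = k
        · simp [h2]
        simp only [h1, h2, if_false]
        exact h' _ (by omega)

theorem ring_bij {L : ℕ} : Function.Bijective (ring_G (L := L)) := by
  constructor
  · intro o o' h
    have h1 : ∀ n, lev_RO (L+1) (fun i : ℕ × Fin L => i.1) n o o' := fun n =>
      (ring_RS n o o').1 (by rw [h]; exact fun _ _ => rfl)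
    rcases o with _ | ⟨⟨k, l⟩, y⟩ <;> rcases o' with _ | ⟨⟨k', l'⟩, y'⟩
    · rfl
    · have := h1 (k'+1); simp [lev_RO] at this
    · have := h1 (k+1); simp [lev_RO] at this
    · have h2 : ∀ n, (k, l) = (k', l') ∧ RS (L+1) n y y' := by
        intro n
        rcases h1 (k + n + 1) with h3 | h3
        · simp at h3
        · exact ⟨h3.1, RS.anti h3.2 (by simp; omega)⟩
      rw [(h2 0).1, show y = y' from funext fun n => (h2 (n+1)).2 n (by omega)]
  · intro z
    by_cases h : ∃ n, z n ≠ 0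
    · obtain ⟨l, hl⟩ := Fin.exists_succ_eq.2 (Nat.find_spec h)
      refine ⟨some ((Nat.find h, l), fun j => z (Nat.find h + 1 + j)), ?_⟩
      ext1 n
      simp only [ring_G]
      split_ifs with h1 h2
      · have := Nat.find_min h h1
        push Not at this
        exact this.symm
      · rw [hl, h2]
      · congr 1; omega
    · push Not at h
      exact ⟨none, funext fun n => (h n).symm⟩

theorem stream_BL (L : ℕ) : BL (lev_RO (L+1) (fun i : ℕ × Fin L => i.1)) (RS (L+1)) :=
  ⟨Equiv.ofBijective _ ring_bij, 0, fun n x y => ⟨(ring_RS n x y).2, (ring_RS n x y).1⟩⟩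

def d_lam {L b : ℕ} : Fin b ⊕ (ℕ × Fin L) → ℕ
  | .inl _ => 0
  | .inr i => i.1

def d_G {L b : ℕ} : Option ((Fin b ⊕ (ℕ × Fin L)) × (ℕ → Fin (L+1))) → Fin (b+1) × (ℕ → Fin (L+1))
  | none => (0, ring_G none)
  | some (.inl t, y) => (t.succ, y)
  | some (.inr i, y) => (0, ring_G (some (i, y)))

theorem d_bij {L b : ℕ} : Function.Bijective (d_G (L := L) (b := b)) := by
  constructor
  · rintro (_ | ⟨t | i, y⟩) (_ | ⟨t' | i', y'⟩) h
    · rfl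
    · simp only [d_G, Prod.mk.injEq] at h; exact absurd h.1.symm (Fin.succ_ne_zero _)
    · simp only [d_G, Prod.mk.injEq] at h; have := ring_bij.1 h.2; simp at this
    · simp only [d_G, Prod.mk.injEq] at h; exact absurd h.1 (Fin.succ_ne_zero _)
    · simp only [d_G, Prod.mk.injEq, Fin.succ_inj] at h; rw [h.1, h.2]
    · simp only [d_G, Prod.mk.injEq] at h; exact absurd h.1 (Fin.succ_ne_zero _)
    · simp only [d_G, Prod.mk.injEq] at h; have := ring_bij.1 h.2; simp at this
    · simp only [d_G, Prod.mk.injEq] at h; exact absurd h.1.symm (Fin.succ_ne_zero _)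
    · simp only [d_G, Prod.mk.injEq] at h; have := ring_bij.1 h.2; simp at this; rw [this.1, this.2]
  · rintro ⟨t, z⟩
    induction t using Fin.cases with
    | zero =>
      obtain ⟨o, rfl⟩ := ring_bij.2 z
      rcases o with _ | ⟨i, y⟩
      · exact ⟨none, rfl⟩
      · exact ⟨some (.inr i, y), rfl⟩
    | succ t => exact ⟨some (.inl t, z), rfl⟩

theorem d_BL (L b : ℕ) : BL (lev_RO (L+1) (d_lam (L := L) (b := b))) (RD (b+1) (L+1)) := by
  refine ⟨Equiv.ofBijective _ d_bij, 1, fun n x y => ⟨fun h => ?_, fun h => ?_⟩⟩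
  · rcases x with _ | ⟨t | i, x⟩ <;> rcases y with _ | ⟨t' | i', y⟩
    · exact ⟨rfl, fun _ _ => rfl⟩
    · simp [lev_RO, d_lam] at h
    · exact ⟨rfl, RS.anti ((ring_RS (n+1) none (some (i', y))).2 h) (by omega)⟩
    · simp [lev_RO, d_lam] at h
    · simp [lev_RO, d_lam] at h
      exact ⟨by simp [d_G, h.1], h.2⟩
    · simp [lev_RO, d_lam] at h
    · exact ⟨rfl, RS.anti ((ring_RS (n+1) (some (i, x)) none).2 h) (by omega)⟩
    · simp [lev_RO, d_lam] at h
    · refine ⟨rfl, RS.anti ((ring_RS (n+1) (some (i, x)) (some (i', y))).2 ?_) (Nat.le_succ n)⟩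
      simpa [lev_RO, d_lam] using h
  · rcases x with _ | ⟨t | i, x⟩ <;> rcases y with _ | ⟨t' | i', y⟩
    · trivial
    · exact absurd h.1.symm (Fin.succ_ne_zero _)
    · exact (ring_RS n none (some (i', y))).1 (RS.anti h.2 (by omega))
    · exact absurd h.1 (Fin.succ_ne_zero _)
    · obtain ⟨h1, h2⟩ := h
      simp [d_G] at h1 h2
      simp only [lev_RO, d_lam]
      right
      exact ⟨by rw [h1], fun k hk => h2 k (by omega)⟩
    · exact absurd h.1 (Fin.succ_ne_zero _)
    · exact (ring_RS n (some (i, x)) none).1 (RS.anti h.2 (by omega))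
    · exact absurd h.1.symm (Fin.succ_ne_zero _)
    · have := (ring_RS n (some (i, x)) (some (i', y))).1 (RS.anti h.2 (by omega))
      simpa [lev_RO, d_lam] using this

def fin_sum_nat (b : ℕ) : Fin b ⊕ ℕ ≃ ℕ where
  toFun := Sum.elim (fun s => s) (fun n => n + b)
  invFun n := if h : n < b then .inl ⟨n, h⟩ else .inr (n - b)
  left_inv := by rintro (s | n) <;> simp
  right_inv := by intro n; by_cases h : n < b <;> simp [h]; omega

/-- `b+1` copies of the symbolic space are equivalent to one copy. -/
theorem hilbert_BL (M b : ℕ) (hM : 2 ≤ M) (hb : 0 < b) : BL (RD b M) (RS M) := by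
  obtain ⟨L, rfl⟩ : ∃ L, M = L + 1 + 1 := ⟨M - 2, by omega⟩
  obtain ⟨b, rfl⟩ : ∃ c, b = c + 1 := ⟨b - 1, by omega⟩
  refine (d_BL (L+1) b).symm.trans (BL.trans ?_ (stream_BL (L+1)))
  let e : Fin b ⊕ (ℕ × Fin (L+1)) ≃ ℕ × Fin (L+1) :=
    ((Equiv.refl _).sumCongr (Nat.divModEquiv (L+1)).symm).trans
      ((fin_sum_nat b).trans (Nat.divModEquiv (L+1)))
  have e1 : ∀ s : Fin b, (e (.inl s)).1 = s / (L+1) := fun s => rfl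
  have e2 : ∀ k l, (e (.inr (k, l))).1 = (k * (L+1) + l + b) / (L+1) := by
    intro k l
    simp [e, fin_sum_nat, Nat.divModEquiv]
    try ring_nf
  refine RO_BL e b ?_ ?_
  · rintro (s | ⟨k, l⟩)
    · simp [d_lam]
    · rw [e2]; simp only [d_lam]
      rw [Nat.le_div_iff_mul_le (by omega)]; omega
  · rintro (s | ⟨k, l⟩)
    · rw [e1]; simp only [d_lam]
      have := Nat.div_le_self s (L+1); omega
    · rw [e2]; simp only [d_lam]
      rw [← Nat.lt_succ_iff, Nat.div_lt_iff_lt_mul (by omega)]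
      have := l.2
      nlinarith
end GDB

namespace GDB

theorem greedy_subset {I : Type*} (w : I → ℕ) (W : ℕ) (T : ℕ) (s : Finset I) :
    (∀ i ∈ s, w i ≤ W) → T ≤ ∑ i ∈ s, w i →
    ∃ t ⊆ s, ∑ i ∈ t, w i ≤ T ∧ T ≤ ∑ i ∈ t, w i + W := by
  induction s using Finset.induction_on with
  | empty => intro _ h; exact ⟨∅, by simp, by simp, by simp at h; omega⟩
  | insert x s hx ih =>
    intro hw hT
    by_cases h : T ≤ ∑ i ∈ s, w i
    · obtain ⟨t, ht, h1, h2⟩ := ih (fun i hi => hw i (by simp [hi])) h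
      exact ⟨t, ht.trans (Finset.subset_insert _ _), h1, h2⟩
    · rw [Finset.sum_insert hx] at hT
      have := hw x (by simp)
      exact ⟨s, Finset.subset_insert _ _, by omega, by omega⟩

theorem semigroup_rep {J : Type*} [Fintype J] (w : J → ℕ)
    (hg : ∀ d, (∀ j, d ∣ w j) → d = 1) :
    ∃ F, ∀ n ≥ F, ∃ x : J → ℕ, ∑ j, x j * w j = n := by
  obtain ⟨F, hF⟩ := Nat.exists_mem_closure_of_ge (Set.range w)
  refine ⟨F, fun n hn => ?_⟩
  have h1 : Nat.setGcd (Set.range w) = 1 :=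
    hg _ fun j => Nat.setGcd_dvd_of_mem ⟨j, rfl⟩
  have := hF n hn (by simp [h1])
  clear hn
  induction this using AddSubmonoid.closure_induction with
  | mem x hx =>
    obtain ⟨j, rfl⟩ := hx
    exact ⟨fun i => if i = j then 1 else 0, by simp⟩
  | zero => exact ⟨0, by simp⟩
  | add a b _ _ ha hb =>
    obtain ⟨x, rfl⟩ := ha
    obtain ⟨y, rfl⟩ := hb
    exact ⟨x + y, by simp [add_mul, Finset.sum_add_distrib]⟩

theorem pack_rigid {J : Type*} [Fintype J] (w : J → ℕ) (hw : ∀ j, 0 < w j)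
    (hg : ∀ d, (∀ j, d ∣ w j) → d = 1) (Q : ℕ) :
    ∃ H, ∀ q ≤ Q, ∀ M ≥ H, ∀ (I : Type) [Fintype I] (κ : I → J),
      (∀ j, H ≤ (Finset.univ.filter fun i => κ i = j).card) →
      ∑ i, w (κ i) = q * M →
      ∃ a : I → Fin q, ∀ k, ∑ i with a i = k, w (κ i) = M := by
  obtain ⟨F, hF⟩ := semigroup_rep w hg
  set W := ∑ j, w j with hW
  have hwW : ∀ j, w j ≤ W := fun j => Finset.single_le_sum (f := w) (fun _ _ => Nat.zero_le _) (Finset.mem_univ j)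
  set X := F + W with hX
  refine ⟨Q * X * W + Q * X + F, ?_⟩
  intro q hq M hM I _ κ hκ hsum
  have key : ∀ q ≤ Q, ∀ s : Finset I, (∀ j, q * X ≤ (s.filter fun i => κ i = j).card) →
      ∑ i ∈ s, w (κ i) = q * M → ∃ a : I → ℕ, (∀ i ∈ s, a i < q) ∧
        ∀ k < q, ∑ i ∈ s with a i = k, w (κ i) = M := by
    intro q
    induction q with
    | zero =>
      intro _ s _ h
      refine ⟨fun _ => 0, fun i hi => ?_, by simp⟩
      simp at h
      exact absurd (h i hi) (hw _).ne'
    | succ q ih =>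
      intro hq s hs hsum
      -- find t
      obtain ⟨t, hts, htM, htc⟩ : ∃ t ⊆ s, ∑ i ∈ t, w (κ i) = M ∧
          ∀ j, q * X ≤ ((s \ t).filter fun i => κ i = j).card := by
        rcases Nat.eq_zero_or_pos q with rfl | hq0
        · exact ⟨s, le_rfl, by simpa using hsum, by simp⟩
        choose ρ hρs hρc using fun j => Finset.exists_subset_card_eq (hs j)
        have hρκ : ∀ j, ∀ i ∈ ρ j, κ i = j := fun j i hi => (Finset.mem_filter.1 (hρs j hi)).2
        have hρs' : ∀ j, ∀ i ∈ ρ j, i ∈ s := fun j i hi => (Finset.mem_filter.1 (hρs j hi)).1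
        have hsumsub : ∀ τ : J → Finset I, (∀ j, τ j ⊆ ρ j) →
            ∑ i ∈ Finset.univ.biUnion τ, w (κ i) = ∑ j, (τ j).card * w j := by
          intro τ hτ
          rw [Finset.sum_biUnion]
          · refine Finset.sum_congr rfl fun j _ => ?_
            rw [Finset.sum_congr rfl (fun i hi => by rw [hρκ j i (hτ j hi)])]
            simp
          · intro j _ j' _ hjj
            refine Finset.disjoint_left.2 fun i hi hi' => hjj ?_
            rw [← hρκ j i (hτ j hi), hρκ j' i (hτ j' hi')]
        set P := Finset.univ.biUnion ρ with hP
        have hPs : P ⊆ s := by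
          intro i hi
          obtain ⟨j, _, hj⟩ := Finset.mem_biUnion.1 hi
          exact hρs' j i hj
        have hPsum : ∑ i ∈ P, w (κ i) = (q+1) * X * W := by
          rw [hP, hsumsub ρ (fun _ => le_rfl), hW, Finset.mul_sum]
          exact Finset.sum_congr rfl fun j _ => by rw [hρc]
        have hsd := Finset.sum_sdiff (f := fun i => w (κ i)) hPs
        have hMF : F ≤ M := by omega
        have hle : (q+1) * X * W ≤ Q * X * W := by gcongr
        have hqM : M + M ≤ (q+1) * M := by nlinarith
        obtain ⟨t1, ht1, h1, h2⟩ := greedy_subset (fun i => w (κ i)) W (M - F) (s \ P)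
          (fun i _ => hwW _) (by omega)
        obtain ⟨x, hx⟩ := hF (M - ∑ i ∈ t1, w (κ i)) (by omega)
        have hxX : ∀ j, x j ≤ X := by
          intro j
          have := Finset.single_le_sum (f := fun j => x j * w j) (fun _ _ => Nat.zero_le _) (Finset.mem_univ j)
          have h3 : x j ≤ x j * w j := Nat.le_mul_of_pos_right _ (hw j)
          omega
        choose τ hτ hτc using fun j => Finset.exists_subset_card_eq
          (show x j ≤ (ρ j).card by rw [hρc]; have := hxX j; nlinarith)
        have hτP : Finset.univ.biUnion τ ⊆ P := by
          intro i hi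
          obtain ⟨j, _, hj⟩ := Finset.mem_biUnion.1 hi
          exact Finset.mem_biUnion.2 ⟨j, Finset.mem_univ _, hτ j hj⟩
        refine ⟨t1 ∪ Finset.univ.biUnion τ, ?_, ?_, ?_⟩
        · exact Finset.union_subset (ht1.trans Finset.sdiff_subset) (hτP.trans hPs)
        · rw [Finset.sum_union, hsumsub τ hτ]
          · simp_rw [hτc]; rw [hx]; omega
          · refine Finset.disjoint_left.2 fun i hi hi' => ?_
            exact (Finset.mem_sdiff.1 (ht1 hi)).2 (hτP hi')
        · intro j
          have : ρ j \ τ j ⊆ ((s \ (t1 ∪ Finset.univ.biUnion τ)).filter fun i => κ i = j) := by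
            intro i hi
            obtain ⟨hi1, hi2⟩ := Finset.mem_sdiff.1 hi
            simp only [Finset.mem_filter, Finset.mem_sdiff, Finset.mem_union, not_or]
            refine ⟨⟨hρs' j i hi1, fun h => ?_, fun h => ?_⟩, hρκ j i hi1⟩
            · exact (Finset.mem_sdiff.1 (ht1 h)).2 (Finset.mem_biUnion.2 ⟨j, Finset.mem_univ _, hi1⟩)
            · obtain ⟨j', _, hj'⟩ := Finset.mem_biUnion.1 h
              have e1 := hρκ j' i (hτ j' hj')
              have e2 := hρκ j i hi1
              obtain rfl : j' = j := by rw [← e1, e2]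
              exact hi2 hj'
          refine le_trans ?_ (Finset.card_le_card this)
          rw [Finset.card_sdiff_of_subset (hτ j), hρc, hτc]
          have := hxX j
          rw [add_mul]; omega
      have hsd := Finset.sum_sdiff (f := fun i => w (κ i)) hts
      obtain ⟨a, ha1, ha2⟩ := ih (by omega) (s \ t) htc (by
        rw [add_mul] at hsum; omega)
      refine ⟨fun i => if i ∈ t then q else a i, ?_, ?_⟩
      · intro i hi
        by_cases h : i ∈ t
        · simp [h]
        · have := ha1 i (Finset.mem_sdiff.2 ⟨hi, h⟩)
          simp [h]; omega
      · intro k hk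
        rcases Nat.lt_succ_iff_lt_or_eq.1 hk with hk' | rfl
        · rw [← ha2 k hk']
          refine Finset.sum_congr ?_ fun _ _ => rfl
          ext i
          simp only [Finset.mem_filter, Finset.mem_sdiff]
          constructor
          · rintro ⟨h1, h2⟩
            by_cases h : i ∈ t
            · simp [h] at h2; omega
            · simp [h] at h2; exact ⟨⟨h1, h⟩, h2⟩
          · rintro ⟨⟨h1, h⟩, h2⟩
            simp [h, h1, h2]
        · rw [← htM]
          refine Finset.sum_congr ?_ fun _ _ => rfl
          ext i
          simp only [Finset.mem_filter]
          constructor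
          · rintro ⟨h1, h2⟩
            by_contra h
            have := ha1 i (Finset.mem_sdiff.2 ⟨h1, h⟩)
            simp [h] at h2; omega
          · intro h; simp [h, hts h]
  obtain ⟨a, ha1, ha2⟩ := key q hq Finset.univ (fun j => by
    have := hκ j
    have h2 : q * X ≤ Q * X := by gcongr
    omega) hsum
  refine ⟨fun i => ⟨a i, ha1 i (Finset.mem_univ _)⟩, fun k => ?_⟩
  rw [← ha2 k k.2]
  refine Finset.sum_congr ?_ fun _ _ => rfl
  ext i; simp [Fin.ext_iff]

theorem greedy_bins {I : Type*} (w : I → ℕ) {q : ℕ} (hq : 0 < q) (V : ℕ) (s : Finset I) :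
    ∀ (_ : ∀ i ∈ s, 0 < w i ∧ w i ≤ V + 1) (cap : Fin q → ℕ)
      (_ : ∑ i ∈ s, w i + q * V ≤ ∑ k, cap k),
    ∃ a : I → Fin q, ∀ k, ∑ i ∈ s with a i = k, w i ≤ cap k := by
  induction s using Finset.induction_on with
  | empty => intro _ _ _; exact ⟨fun _ => ⟨0, hq⟩, by simp⟩
  | insert x s hx ih =>
    intro hw cap hcap
    have hwx := hw x (by simp)
    rw [Finset.sum_insert hx] at hcap
    obtain ⟨k0, hk0⟩ : ∃ k0, w x ≤ cap k0 := by
      by_contra hcon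
      push Not at hcon
      have : ∑ k, cap k ≤ ∑ k : Fin q, V := Finset.sum_le_sum fun k _ => by have := hcon k; omega
      simp at this
      omega
    have h1 : ∑ k, cap k = ∑ k, (cap k - if k = k0 then w x else 0) + w x := by
      have : ∀ k, cap k = (cap k - if k = k0 then w x else 0) + if k = k0 then w x else 0 := by
        intro k; split_ifs with h
        · subst h; omega
        · simp
      conv_lhs => rw [Finset.sum_congr rfl (fun k _ => this k)]
      rw [Finset.sum_add_distrib]; simp
    obtain ⟨a, ha⟩ := ih (fun i hi => hw i (by simp [hi]))
      (fun k => cap k - if k = k0 then w x else 0) (by omega)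
    refine ⟨fun i => if i = x then k0 else a i, fun k => ?_⟩
    have h2 : ∑ i ∈ s, (if (if i = x then k0 else a i) = k then w i else 0) =
        ∑ i ∈ s, (if a i = k then w i else 0) := by
      refine Finset.sum_congr rfl fun i hi => ?_
      have : i ≠ x := by rintro rfl; exact hx hi
      simp [this]
    have h3 := ha k
    rw [Finset.sum_filter] at h3 ⊢
    rw [Finset.sum_insert hx, h2]
    by_cases h : k = k0
    · subst h
      simp at h3 ⊢
      omega
    · simp [h, Ne.symm h] at h3 ⊢
      exact h3

theorem pack_flex {I : Type*} [Fintype I] (v : I → ℕ) (V q M : ℕ) (hq : 0 < q)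
    (hv : ∀ i, 0 < v i ∧ v i ≤ V) (flex : I → Prop) (hsum : ∑ i, v i = q * M)
    (hf : q * (V + 1) ≤ (Finset.univ.filter flex).card) :
    ∃ s' : I → ℕ, (∀ i, ¬ flex i → s' i = v i) ∧ (∀ i, 0 < s' i) ∧
      ∃ a : I → Fin q, ∀ k, ∑ i with a i = k, s' i = M := by
  obtain ⟨t, htf, htc⟩ := Finset.exists_subset_card_eq (show q ≤ (Finset.univ.filter flex).card by nlinarith)
  have ht : ∀ i ∈ t, flex i := fun i hi => (Finset.mem_filter.1 (htf hi)).2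
  let φ : t ≃ Fin q := Fintype.equivFinOfCardEq (by simpa using htc)
  set A := Finset.univ.filter (fun i => ¬ flex i) with hA
  set B := Finset.univ.filter flex with hB
  have hAB : ∑ i ∈ B, v i + ∑ i ∈ A, v i = q * M := by
    rw [← hsum]; exact Finset.sum_filter_add_sum_filter_not _ _ _
  have hBv : B.card ≤ ∑ i ∈ B, v i := by
    rw [Finset.card_eq_sum_ones]; exact Finset.sum_le_sum fun i _ => (hv i).1
  have hM : 0 < M := by
    rcases Nat.eq_zero_or_pos M with h | h
    · subst h; have : q ≤ q * (V+1) := Nat.le_mul_of_pos_right _ (by omega)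
      omega
    · exact h
  obtain ⟨i0, hi0⟩ : B.Nonempty := Finset.card_pos.1 (by nlinarith)
  have hV : 0 < V := (hv i0).1.trans_le (hv i0).2
  have hqV : q * (V - 1) + 2 * q = q * (V + 1) := by
    obtain ⟨V, rfl⟩ := Nat.exists_eq_succ_of_ne_zero hV.ne'
    simp; ring
  have hqM : q * (M - 1) + q = q * M := by
    obtain ⟨M, rfl⟩ := Nat.exists_eq_succ_of_ne_zero hM.ne'
    simp; ring
  obtain ⟨a1, ha1⟩ := greedy_bins v hq (V - 1) A (fun i _ => ⟨(hv i).1, by have := (hv i).2; omega⟩)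
    (fun _ => M - 1) (by simp; omega)
  have hfib : ∑ k, ∑ i ∈ A with a1 i = k, v i = ∑ i ∈ A, v i :=
    Finset.sum_fiberwise _ _ _
  have hcap2 : ∑ k, (M - 1 - ∑ i ∈ A with a1 i = k, v i) + ∑ i ∈ A, v i = q * (M - 1) := by
    rw [← hfib, ← Finset.sum_add_distrib, Finset.sum_congr rfl (fun k _ => Nat.sub_add_cancel (ha1 k))]
    simp
  obtain ⟨a2, ha2⟩ := greedy_bins (fun _ : I => 1) hq 0 (B \ t) (fun i _ => ⟨by simp, by simp⟩)
    (fun k => M - 1 - ∑ i ∈ A with a1 i = k, v i) (by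
      have := Finset.card_sdiff_of_subset htf
      simp only [Finset.sum_const, smul_eq_mul, mul_one, mul_zero, add_zero]
      omega)
  let ld : Fin q → ℕ := fun k => ∑ i ∈ A with a1 i = k, v i + ∑ i ∈ B \ t with a2 i = k, 1
  have hld : ∀ k, ld k < M := by
    intro k; have h1 := ha1 k; have h2 := ha2 k; simp only [ld]; omega
  refine ⟨fun i => if h : i ∈ t then M - ld (φ ⟨i, h⟩) else if flex i then 1 else v i, ?_, ?_,
    fun i => if h : i ∈ t then φ ⟨i, h⟩ else if flex i then a2 i else a1 i, ?_⟩
  · intro i hi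
    have : i ∉ t := fun h => hi (ht i h)
    simp [this, hi]
  · intro i
    dsimp only
    split_ifs with h h
    · have := hld (φ ⟨i, h⟩); omega
    · simp
    · exact (hv i).1
  · intro k
    rw [Finset.sum_filter]
    have hu : (Finset.univ : Finset I) = A ∪ ((B \ t) ∪ t) := by
      ext i; simp [hA, hB]; by_cases h : flex i <;> simp [h]
    have hd1 : Disjoint A ((B \ t) ∪ t) := by
      rw [Finset.disjoint_left]; intro i hi hi'
      have hi := (Finset.mem_filter.1 hi).2
      rcases Finset.mem_union.1 hi' with h | h
      · exact hi (Finset.mem_filter.1 (Finset.mem_sdiff.1 h).1).2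
      · exact hi (ht i h)
    rw [hu, Finset.sum_union hd1, Finset.sum_union Finset.sdiff_disjoint]
    have e1 : ∀ i ∈ A, i ∉ t ∧ ¬ flex i := fun i hi => by
      simp [hA] at hi; exact ⟨fun h => hi (ht i h), hi⟩
    have e2 : ∀ i ∈ B \ t, i ∉ t ∧ flex i := fun i hi => by
      simp [hB] at hi; exact ⟨hi.2, hi.1⟩
    have s1 := Finset.sum_congr (rfl : A = A) (fun i hi => show
      (if (if h : i ∈ t then φ ⟨i, h⟩ else if flex i then a2 i else a1 i) = k then
        (if h : i ∈ t then M - ld (φ ⟨i, h⟩) else if flex i then 1 else v i) else 0) =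
        if a1 i = k then v i else 0 by simp [e1 i hi])
    have s2 := Finset.sum_congr (rfl : B \ t = B \ t) (fun i hi => show
      (if (if h : i ∈ t then φ ⟨i, h⟩ else if flex i then a2 i else a1 i) = k then
        (if h : i ∈ t then M - ld (φ ⟨i, h⟩) else if flex i then 1 else v i) else 0) =
        if a2 i = k then 1 else 0 by simp [e2 i hi])
    have s3 : ∑ i ∈ t, 
      (if (if h : i ∈ t then φ ⟨i, h⟩ else if flex i then a2 i else a1 i) = k then
        (if h : i ∈ t then M - ld (φ ⟨i, h⟩) else if flex i then 1 else v i) else 0) =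
        M - ld k := by
      rw [Finset.sum_eq_single (φ.symm k : I)]
      · simp
      · intro i hi hne
        rw [if_neg]
        simp only [hi, dif_pos]
        intro h
        apply hne
        rw [← h]; simp
      · intro h; simp at h
    rw [s1, s2, s3, ← Finset.sum_filter, ← Finset.sum_filter]
    have := hld k
    simp only [ld] at this ⊢
    omega

theorem mkΦ {I : Type*} [Fintype I] {q M : ℕ} (s : I → ℕ) (a : I → Fin q)
    (h : ∀ k, ∑ i with a i = k, s i = M) :
    ∃ Φ : (Σ i, Fin (s i)) ≃ Fin q × Fin M, ∀ p, (Φ p).1 = a p.1 := by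
  let f : (Σ i, Fin (s i)) → Fin q := fun p => a p.1
  have hc : ∀ k, Fintype.card {p // f p = k} = Fintype.card (Fin M) := by
    intro k
    rw [Fintype.card_fin, ← h k, Fintype.card_subtype]
    have : (Finset.univ.filter fun p => f p = k) = (Finset.univ.filter fun i => a i = k).sigma (fun i => (Finset.univ : Finset (Fin (s i)))) := by
      ext ⟨i, t⟩; simp [f]
    rw [this, Finset.card_sigma]; simp
  let e := fun k => Fintype.equivOfCardEq (hc k)
  refine ⟨(Equiv.sigmaFiberEquiv f).symm.trans ((Equiv.sigmaCongrRight e).trans (Equiv.sigmaEquivProd _ _)), ?_⟩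
  intro p; rfl
end GDB

namespace GDB
universe u
open Filter Topology

theorem fin_lb {ι : Type*} [Finite ι] (f : ι → ℝ) (hf : ∀ i, 0 < f i) : ∃ δ > 0, ∀ i, δ ≤ f i := by
  rcases isEmpty_or_nonempty ι with h | h
  · exact ⟨1, one_pos, fun i => h.elim i⟩
  · obtain ⟨i, hi⟩ := Finite.exists_min f
    exact ⟨f i, hf i, hi⟩

section
variable {X : Type u} [MetricSpace X] {p : ℕ} {r : ℝ} (G : GraphDirected X p r) (hr : 0 < r)

def gdg (i : Fin p) (q : Σ e : (Σ j, Fin (G.a i j)), G.K e.1) : G.K i :=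
  ⟨G.S i q.1.1 q.1.2 q.2, by
    rw [G.union i]
    exact Set.mem_iUnion.2 ⟨_, Set.mem_iUnion.2 ⟨_, ⟨_, q.2.2, rfl⟩⟩⟩⟩

include hr in
theorem gdg_bij (i : Fin p) : Function.Bijective (gdg G i) := by
  constructor
  · rintro ⟨⟨j, e⟩, x⟩ ⟨⟨j', e'⟩, y⟩ h
    have h : G.S i j e x = G.S i j' e' y := congrArg Subtype.val h
    by_cases hh : (⟨j, e⟩ : Σ j, Fin (G.a i j)) = ⟨j', e'⟩
    · obtain ⟨rfl, hh⟩ := Sigma.mk.inj hh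
      obtain rfl := eq_of_heq hh
      have h2 := G.sim i j e x y
      rw [h, dist_self] at h2
      have : dist (x : X) y = 0 := by
        rcases mul_eq_zero.1 h2.symm with h | h
        · exact absurd h hr.ne'
        · exact h
      have : x = y := Subtype.ext (dist_eq_zero.1 this)
      rw [this]
    · exact absurd h (Set.disjoint_left.1 (G.disj i j j' e e' hh) ⟨x, x.2, rfl⟩ |> fun hn h =>
        hn (h ▸ ⟨y, y.2, rfl⟩))
  · rintro ⟨x, hx⟩
    have := hx
    rw [G.union i] at this
    obtain ⟨j, hj⟩ := Set.mem_iUnion.1 this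
    obtain ⟨e, y, hy, rfl⟩ := Set.mem_iUnion.1 hj
    exact ⟨⟨⟨j, e⟩, ⟨y, hy⟩⟩, rfl⟩

noncomputable def gdF : Fam.{u} where
  V := Fin p
  E i := Σ j, Fin (G.a i j)
  tgt _ e := e.1
  X i := G.K i
  dec i := (Equiv.ofBijective _ (gdg_bij G hr i)).symm

theorem gdF_dec {i : Fin p} {x : G.K i} {e : Σ j, Fin (G.a i j)} {x' : G.K e.1}
    (h : (gdF G hr).dec i x = ⟨e, x'⟩) : (x : X) = G.S i e.1 e.2 x' := by
  have : x = ((gdF G hr).dec i).symm ⟨e, x'⟩ := by rw [← h]; exact (Equiv.symm_apply_apply _ _).symm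
  rw [this]; rfl

variable [CompactSpace X] (hr1 : r < 1)

theorem gdF_upper : ∃ Δ > 0, ∀ n i (x y : G.K i), (gdF G hr).R n i x y → dist x y ≤ Δ * r ^ n := by
  obtain ⟨C, hC⟩ := Metric.isBounded_iff.1 (isCompact_univ (X := X)).isBounded
  refine ⟨max C 1, by positivity, fun n => ?_⟩
  induction n with
  | zero => intro i x y _; simp; left; exact hC (Set.mem_univ _) (Set.mem_univ _)
  | succ n ih =>
    rintro i x y ⟨e, x', y', h1, h2, h3⟩
    have h1 := gdF_dec G hr h1
    have h2 := gdF_dec G hr h2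
    have h4 := ih e.1 x' y' h3
    rw [Subtype.dist_eq, h1, h2, G.sim, pow_succ, ← mul_assoc, mul_comm]
    exact mul_le_mul_of_nonneg_right h4 hr.le

include hr1 in
theorem gdF_lower : ∃ δ > 0, ∀ n i (x y : G.K i), ¬ (gdF G hr).R n i x y → δ * r ^ n ≤ dist x y := by
  have h0 : ∀ q : (Σ i, (Σ j, Fin (G.a i j)) × (Σ j, Fin (G.a i j))), ∃ δ > 0, q.2.1 ≠ q.2.2 →
      ∀ x ∈ G.K q.2.1.1, ∀ y ∈ G.K q.2.2.1, δ ≤ dist (G.S q.1 _ q.2.1.2 x) (G.S q.1 _ q.2.2.2 y) := by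
    rintro ⟨i, e, e'⟩
    by_cases h : e = e'
    · exact ⟨1, one_pos, fun h' => absurd h h'⟩
    have hc : ∀ e : Σ j, Fin (G.a i j), IsCompact (G.S i e.1 e.2 '' G.K e.1) := fun e =>
      (G.compact _).image (LipschitzWith.of_dist_le_mul (K := ⟨r, hr.le⟩)
        (fun x y => (G.sim _ _ _ x y).le)).continuous
    obtain ⟨δ, hδ, hh⟩ := Metric.exists_pos_forall_lt_edist (hc e) (hc e').isClosed
      (G.disj i _ _ e.2 e'.2 h)
    refine ⟨δ, hδ, fun _ x hx y hy => ?_⟩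
    have := hh _ ⟨x, hx, rfl⟩ _ ⟨y, hy, rfl⟩
    rw [edist_nndist] at this
    have := ENNReal.coe_lt_coe.1 this
    rw [dist_nndist]
    exact_mod_cast this.le
  choose f hf hf' using h0
  obtain ⟨δ, hδ, hδf⟩ := fin_lb f hf
  refine ⟨δ, hδ, fun n => ?_⟩
  induction n with
  | zero => intro i x y h; exact absurd trivial h
  | succ n ih =>
    intro i x y h
    rcases hx : (gdF G hr).dec i x with ⟨e, x'⟩
    rcases hy : (gdF G hr).dec i y with ⟨e', y'⟩
    have h1 := gdF_dec G hr hx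
    have h2 := gdF_dec G hr hy
    by_cases hee : e = e'
    · subst hee
      have h3 : ¬ (gdF G hr).R n e.1 x' y' := fun h3 => h ⟨e, x', y', hx, hy, h3⟩
      have h4 := ih _ _ _ h3
      rw [Subtype.dist_eq, h1, h2, G.sim, pow_succ, ← mul_assoc, mul_comm]
      exact mul_le_mul_of_nonneg_left h4 hr.le
    · have h3 := hf' ⟨i, e, e'⟩ hee (x' : G.K e.1).1 (x' : G.K e.1).2 (y' : G.K e'.1).1 (y' : G.K e'.1).2
      rw [Subtype.dist_eq, h1, h2]
      refine le_trans ?_ ((hδf _).trans h3)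
      exact mul_le_of_le_one_right hδ.le (pow_le_one₀ hr.le hr1.le)

include hr1 in
theorem gdF_sep (i : Fin p) : (gdF G hr).Sep i := by
  obtain ⟨Δ, hΔ, h⟩ := gdF_upper G hr
  intro x y hxy
  have h1 : Tendsto (fun n => Δ * r ^ n) atTop (𝓝 (Δ * 0)) :=
    (tendsto_pow_atTop_nhds_zero_of_lt_one hr.le hr1).const_mul _
  rw [mul_zero] at h1
  have h2 : dist (α := G.K i) x y ≤ 0 := ge_of_tendsto' h1 (fun n => h n i x y (hxy n))
  exact dist_le_zero (γ := G.K i) |>.1 h2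

include hr1 in
theorem gdF_comp (i : Fin p) : (gdF G hr).Comp i := by
  obtain ⟨Δ, hΔ, h⟩ := gdF_upper G hr
  obtain ⟨δ, hδ, h'⟩ := gdF_lower G hr hr1
  intro (s : ℕ → G.K i) hs
  have : CompactSpace (G.K i) := isCompact_iff_compactSpace.1 (G.compact i)
  have hcs : CauchySeq (α := G.K i) s := cauchySeq_of_le_geometric r Δ hr1 (fun n => h n i _ _ (hs n))
  obtain ⟨x, hx⟩ := cauchySeq_tendsto_of_complete hcs
  refine ⟨x, fun n => ?_⟩
  have hnm : ∀ m ≥ n, (gdF G hr).R n i (s n) (s m) := by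
    intro m hm
    induction hm with
    | refl => exact Fam.R_refl _ _ _ _
    | step hm ih => exact Fam.R_trans _ _ _ _ _ _ ih (Fam.R_anti _ hm _ _ _ (hs _))
  by_contra hcon
  have h2 : ∀ m ≥ n, δ * r ^ n ≤ dist (α := G.K i) (s m) x := fun m hm => by
    rw [dist_comm (α := G.K i)]
    refine h' n i x (s m) (fun h3 => hcon ?_)
    exact Fam.R_trans _ _ _ _ _ _ h3 (Fam.R_symm _ _ _ _ _ (hnm m hm))
  obtain ⟨N, hN⟩ := (Metric.tendsto_atTop.1 hx) (δ * r ^ n) (by positivity)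
  exact absurd (hN (max N n) (le_max_left _ _)) (not_lt.2 (h2 _ (le_max_right _ _)))
end
end GDB

namespace GDB
universe u
section
variable {X : Type u} [MetricSpace X] {p : ℕ}

theorem gd_S_inj {r : ℝ} (hr : 0 < r) (G : GraphDirected X p r) (i j e) :
    Function.Injective (G.S i j e) := by
  intro x y h
  have h2 := G.sim i j e x y
  rw [h, dist_self] at h2
  rcases mul_eq_zero.1 h2.symm with h | h
  · exact absurd h hr.ne'
  · exact dist_eq_zero.1 h

theorem gd_sub {r : ℝ} (G : GraphDirected X p r) (i j e) : G.S i j e '' G.K j ⊆ G.K i := by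
  intro x hx
  rw [G.union i]
  exact Set.mem_iUnion.2 ⟨_, Set.mem_iUnion.2 ⟨_, hx⟩⟩

theorem gd_comp {r1 r2 : ℝ} (hr : 0 < r1) (G1 : GraphDirected X p r1) (G2 : GraphDirected X p r2)
    (hK : G1.K = G2.K) : ∃ G' : GraphDirected X p (r1 * r2), G'.K = G1.K ∧
      ∀ i k, G'.a i k = ∑ j, G1.a i j * G2.a j k := by
  let eqv : ∀ i k, Fin (∑ j, G1.a i j * G2.a j k) ≃ Σ j, Fin (G1.a i j) × Fin (G2.a j k) := fun i k =>
    finSigmaFinEquiv.symm.trans (Equiv.sigmaCongrRight fun j => finProdFinEquiv.symm)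
  let SS : ∀ i k, (Σ j, Fin (G1.a i j) × Fin (G2.a j k)) → X → X := fun i k q x =>
    G1.S i q.1 q.2.1 (G2.S q.1 k q.2.2 x)
  have himg : ∀ i k q, SS i k q '' G1.K k = G1.S i q.1 q.2.1 '' (G2.S q.1 k q.2.2 '' G2.K k) := by
    intro i k q; rw [Set.image_image, hK]
  refine ⟨⟨fun i k => ∑ j, G1.a i j * G2.a j k, fun i k e => SS i k (eqv i k e), ?_, G1.K,
    G1.nonempty, G1.compact, ?_, ?_⟩, rfl, fun _ _ => rfl⟩
  · intro i j e x y
    simp only [SS]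
    rw [G1.sim, G2.sim, mul_assoc]
  · intro i
    ext x
    simp only [Set.mem_iUnion, himg]
    constructor
    · intro hx
      rw [G1.union i] at hx
      obtain ⟨j, hj⟩ := Set.mem_iUnion.1 hx
      obtain ⟨e, y, hy, rfl⟩ := Set.mem_iUnion.1 hj
      rw [hK, G2.union j] at hy
      obtain ⟨k, hk⟩ := Set.mem_iUnion.1 hy
      obtain ⟨e', hy⟩ := Set.mem_iUnion.1 hk
      refine ⟨k, (eqv i k).symm ⟨j, e, e'⟩, ?_⟩
      rw [Equiv.apply_symm_apply]
      exact ⟨y, hy, rfl⟩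
    · rintro ⟨k, e, h⟩
      apply gd_sub G1 i _ (eqv i k e).2.1
      rw [hK]
      exact Set.image_mono (gd_sub G2 _ _ _) h
  · intro i k k' e e' hne
    rw [himg, himg]
    rcases hq : eqv i k e with ⟨j, e1, e2⟩
    rcases hq' : eqv i k' e' with ⟨j', e1', e2'⟩
    by_cases h1 : (⟨j, e1⟩ : Σ j, Fin (G1.a i j)) = ⟨j', e1'⟩
    · obtain ⟨rfl, hh⟩ := Sigma.mk.inj h1
      obtain rfl := eq_of_heq hh
      dsimp only
      apply Set.disjoint_image_of_injective (gd_S_inj hr G1 _ _ _)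
      apply G2.disj
      intro h2
      obtain ⟨rfl, hh⟩ := Sigma.mk.inj h2
      obtain rfl := eq_of_heq hh
      rw [← hq'] at hq
      exact hne (by rw [(eqv i k).injective hq])
    · refine Set.disjoint_of_subset ?_ ?_ (G1.disj i j j' e1 e1' h1)
      · dsimp only; rw [hK]; exact Set.image_mono (gd_sub G2 _ _ _)
      · dsimp only; rw [hK]; exact Set.image_mono (gd_sub G2 _ _ _)

theorem gd_pow {r : ℝ} (hr : 0 < r) (G : GraphDirected X p r) (c : ℕ) :
    ∃ G' : GraphDirected X p (r ^ (c+1)), G'.K = G.K ∧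
      ∀ i k, G'.a i k = (Matrix.of G.a ^ (c+1)) i k := by
  induction c with
  | zero => rw [zero_add, pow_one, pow_one]; exact ⟨G, rfl, fun _ _ => rfl⟩
  | succ c ih =>
    obtain ⟨G1, h1, h2⟩ := ih
    rw [pow_succ r, pow_succ (Matrix.of G.a)]
    obtain ⟨G2, h3, h4⟩ := gd_comp (pow_pos hr _) G1 G h1
    refine ⟨G2, h3.trans h1, fun i k => ?_⟩
    rw [h4, Matrix.mul_apply]
    exact Finset.sum_congr rfl fun j _ => by rw [h2]; rfl
end
end GDB

namespace GDB
open Filter Topology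

theorem simul_dirichlet {p : ℕ} (v : Fin p → ℝ) (ε : ℝ) (hε : 0 < ε) :
    ∃ N : ℕ, 0 < N ∧ ∃ w : Fin p → ℤ, ∀ j, |(w j : ℝ) - N * v j| < ε := by
  have hc : IsCompact (Set.univ.pi fun _ : Fin p => Set.Icc (0:ℝ) 1) :=
    isCompact_univ_pi fun _ => isCompact_Icc
  obtain ⟨x, _, φ, hφ, hx⟩ := hc.tendsto_subseq (x := fun n : ℕ => fun j => Int.fract (n * v j))
    (fun n j _ => ⟨Int.fract_nonneg _, (Int.fract_lt_one _).le⟩)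
  obtain ⟨N, hN⟩ := Metric.cauchySeq_iff.1 hx.cauchySeq ε hε
  have h := hN (N+1) (by omega) N le_rfl
  have hlt : φ N < φ (N+1) := hφ (by omega)
  refine ⟨φ (N+1) - φ N, by omega, fun j => ⌊(φ (N+1) : ℝ) * v j⌋ - ⌊(φ N : ℝ) * v j⌋, fun j => ?_⟩
  have h2 := (dist_le_pi_dist _ _ j).trans_lt h
  rw [Real.dist_eq] at h2
  simp only [Function.comp, Int.fract] at h2
  rw [Nat.cast_sub hlt.le]
  push_cast
  rw [← abs_neg]
  refine lt_of_le_of_lt (le_of_eq ?_) h2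
  congr 1
  ring

theorem int_eigen {p : ℕ} (a : Fin p → Fin p → ℕ) (m : ℕ) (v : Fin p → ℝ) (hv : ∀ i, 0 < v i)
    (h : ∀ i, ∑ j, (a i j : ℝ) * v j = m * v i) :
    ∃ w : Fin p → ℕ, (∀ i, 0 < w i) ∧ ∀ i, ∑ j, a i j * w j = m * w i := by
  obtain ⟨δ, hδ, hδv⟩ := fin_lb v hv
  set S : ℝ := ∑ i, ∑ j, (a i j : ℝ) + m with hS
  have hS0 : 0 ≤ S := by positivity
  obtain ⟨N, hN, w, hw⟩ := simul_dirichlet v (min δ (1/(S+1))) (by positivity)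
  have hw0 : ∀ j, 0 < w j := by
    intro j
    have h1 := (hw j).trans_le (min_le_left _ _)
    have h2 := abs_lt.1 h1
    have h3 : (1:ℝ) ≤ N := by exact_mod_cast hN
    have h4 : v j ≤ N * v j := le_mul_of_one_le_left (hv j).le h3
    have : (0:ℝ) < w j := by linarith [hδv j]
    exact_mod_cast this
  refine ⟨fun j => (w j).toNat, fun j => by have := hw0 j; dsimp only; omega, fun i => ?_⟩
  zify
  simp_rw [Int.toNat_of_nonneg (hw0 _).le]
  have key : |((∑ j, (a i j : ℤ) * w j - m * w i : ℤ) : ℝ)| < 1 := by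
    have e : ((∑ j, (a i j : ℤ) * w j - m * w i : ℤ) : ℝ) =
        ∑ j, (a i j : ℝ) * (w j - N * v j) - m * (w i - N * v i) := by
      push_cast
      simp_rw [mul_sub, Finset.sum_sub_distrib]
      have : ∑ j, (a i j : ℝ) * (N * v j) = N * (m * v i) := by
        rw [← h i, Finset.mul_sum]; exact Finset.sum_congr rfl fun j _ => by ring
      rw [this]; ring
    rw [e]
    set ε := 1/(S+1) with hε
    have hε0 : 0 < ε := by positivity
    have hle : ∀ j, |(w j : ℝ) - N * v j| ≤ ε := fun j => ((hw j).trans_le (min_le_right _ _)).le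
    calc _ ≤ |∑ j, (a i j : ℝ) * (w j - N * v j)| + |m * (w i - N * v i)| := abs_sub _ _
      _ ≤ ∑ j, (a i j : ℝ) * ε + m * ε := by
        gcongr
        · refine (Finset.abs_sum_le_sum_abs _ _).trans (Finset.sum_le_sum fun j _ => ?_)
          rw [abs_mul, Nat.abs_cast]
          exact mul_le_mul_of_nonneg_left (hle j) (by positivity)
        · rw [abs_mul, Nat.abs_cast]
          exact mul_le_mul_of_nonneg_left (hle i) (by positivity)
      _ = (∑ j, (a i j : ℝ) + m) * ε := by rw [← Finset.sum_mul]; ring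
      _ ≤ S * ε := by
        refine mul_le_mul_of_nonneg_right (add_le_add_left ?_ _) hε0.le
        exact Finset.single_le_sum (f := fun i => ∑ j, (a i j : ℝ)) (fun _ _ => by positivity) (Finset.mem_univ i)
      _ < 1 := by rw [hε, mul_one_div, div_lt_one (by positivity)]; linarith
  have : |∑ j, (a i j : ℤ) * w j - m * w i| < 1 := by exact_mod_cast key
  have := Int.abs_lt_one_iff.1 this
  linarith
end GDB

namespace GDB
open Filter Topology
section
variable {p : ℕ} (A : Matrix (Fin p) (Fin p) ℕ)

theorem mat_eigen_pow (v : Fin p → ℕ) (m : ℕ) (h : ∀ i, ∑ j, A i j * v j = m * v i) (n : ℕ) :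
    ∀ i, ∑ j, (A ^ n) i j * v j = m ^ n * v i := by
  have h' : A.mulVec v = m • v := by ext i; simpa [Matrix.mulVec, dotProduct] using h i
  have : (A ^ n).mulVec v = m ^ n • v := by
    induction n with
    | zero => simp
    | succ n ih => rw [pow_succ, ← Matrix.mulVec_mulVec, h', Matrix.mulVec_smul, ih, smul_smul, pow_succ, mul_comm]
  intro i
  have := congrFun this i
  simpa [Matrix.mulVec, dotProduct] using this

theorem mat_supp (a b : ℕ) (i k : Fin p) :
    0 < (A ^ (a + b)) i k ↔ ∃ j, 0 < (A ^ a) i j ∧ 0 < (A ^ b) j k := by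
  rw [pow_add, Matrix.mul_apply, Finset.sum_pos_iff]
  simp

theorem mat_idem : ∃ c0 ≥ 1, ∀ N ≥ 1, ∀ i j, 0 < (A ^ (c0 * N)) i j ↔ 0 < (A ^ c0) i j := by
  let s : ℕ → Set (Fin p × Fin p) := fun n => {q | 0 < (A ^ n) q.1 q.2}
  obtain ⟨a, b, hne, hab⟩ := Finite.exists_ne_map_eq_of_infinite s
  wlog hlt : a < b generalizing a b
  · exact this b a hne.symm hab.symm (by omega)
  have hadd : ∀ x y z, s x = s y → s (x + z) = s (y + z) := by
    intro x y z h
    ext ⟨i, k⟩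
    simp only [s, Set.mem_ofPred_eq, mat_supp]
    have : ∀ i j, 0 < (A ^ x) i j ↔ 0 < (A ^ y) i j := fun i j => by
      have := Set.ext_iff.1 h (i, j); simpa [s] using this
    simp [this]
  obtain ⟨d, rfl⟩ := Nat.exists_eq_add_of_lt hlt
  have h1 : ∀ n ≥ a, ∀ k, s (n + k * (d+1)) = s n := by
    intro n hn k
    induction k with
    | zero => simp
    | succ k ih =>
      obtain ⟨e, rfl⟩ := Nat.exists_eq_add_of_le hn
      have := hadd a (a+d+1) (e + k * (d+1)) hab
      rw [← ih, add_assoc a e (k * (d+1)), this]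
      congr 1; ring
  refine ⟨(d+1)*(a+1), by nlinarith, fun N hN i j => ?_⟩
  obtain ⟨N, rfl⟩ := Nat.exists_eq_add_of_le hN
  have := h1 ((d+1)*(a+1)) (by nlinarith) ((a+1)*N)
  have h2 : (d+1)*(a+1)*(1+N) = (d+1)*(a+1) + (a+1)*N*(d+1) := by ring
  rw [h2]
  have := Set.ext_iff.1 this (i, j)
  simpa [s] using this

theorem mat_struct (v : Fin p → ℕ) (hv : ∀ i, 0 < v i) (m : ℕ) (hm : 2 ≤ m)
    (h : ∀ i, ∑ j, A i j * v j = m * v i) :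
    ∃ c0 ≥ 1, ∃ (P : Fin p → Fin p → Prop) (good : Fin p → Prop),
      (∀ i k, good i → P i k → good k ∧ ∀ l, P k l ↔ P i l) ∧
      (∀ i, good i → P i i) ∧
      (∀ N ≥ 1, ∀ i j, 0 < (A ^ (c0 * N)) i j ↔ P i j) ∧
      ∀ H : ℕ, ∃ N0 ≥ 1, ∀ N ≥ N0, (∀ i, H ≤ ∑ j with good j, (A ^ (c0 * N)) i j) ∧
        ∀ i j, good i → P i j → H ≤ (A ^ (c0 * N)) i j := by
  obtain ⟨c0, hc0, hP⟩ := mat_idem A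
  set P : Fin p → Fin p → Prop := fun i j => 0 < (A ^ c0) i j with hPdef
  have hP' : ∀ N ≥ 1, ∀ i j, 0 < (A ^ (c0 * N)) i j ↔ P i j := hP
  have htr : ∀ i j k, P i j → P j k → P i k := by
    intro i j k h1 h2
    rw [← hP' 2 (by omega), mul_two, mat_supp]
    exact ⟨j, h1, h2⟩
  have hex : ∀ i, ∃ j, P i j := by
    intro i
    by_contra hcon
    push Not at hcon
    have h1 := mat_eigen_pow A v m h c0 i
    rw [Finset.sum_eq_zero] at h1
    · have := hv i
      have : 0 < m ^ c0 * v i := by positivity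
      omega
    · intro j _
      have := hcon j
      simp only [hPdef] at this
      have : (A ^ c0) i j = 0 := by omega
      simp [this]
  let good : Fin p → Prop := fun i => P i i ∧ ∀ k, P i k → P k i
  have hgood : ∀ i, ∃ k, P i k ∧ good k := by
    intro i
    let Rf : Fin p → Finset (Fin p) := fun i => Finset.univ.filter (P i)
    have hne : (Rf i).Nonempty := by obtain ⟨j, hj⟩ := hex i; exact ⟨j, by simp [Rf, hj]⟩
    obtain ⟨j, hj, hmin⟩ := Finset.exists_min_image (Rf i) (fun j => (Rf j).card) hne
    have hj : P i j := by simpa [Rf] using hj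
    have heq : ∀ k, P j k → Rf k = Rf j := by
      intro k hk
      refine Finset.eq_of_subset_of_card_le ?_ (hmin k (by simp [Rf]; exact htr _ _ _ hj hk))
      intro l hl
      simp [Rf] at hl ⊢
      exact htr _ _ _ hk hl
    have heq' : ∀ k, P j k → ∀ l, P k l ↔ P j l := fun k hk l => by
      have := Finset.ext_iff.1 (heq k hk) l; simpa [Rf] using this
    obtain ⟨k, hk⟩ := hex j
    refine ⟨k, htr _ _ _ hj hk, (heq' k hk k).2 hk, fun l hl => ?_⟩
    exact (heq' l ((heq' k hk l).1 hl) k).2 hk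
  set W := ∑ i, v i with hW
  have hvW : ∀ i, v i ≤ W := fun i => Finset.single_le_sum (f := v) (fun _ _ => Nat.zero_le _) (Finset.mem_univ i)
  have cnt : ∀ (T : Finset (Fin p)) (i : Fin p), (∀ k, P i k → ∃ j ∈ T, P k j) → ∀ N ≥ 1,
      2 ^ N ≤ (∑ j ∈ T, (A ^ (c0 * (N+1))) i j) * W := by
    intro T i hT N hN
    have h1 := mat_eigen_pow A v m h (c0 * N) i
    calc 2 ^ N ≤ m ^ N := Nat.pow_le_pow_left hm N
      _ ≤ m ^ (c0 * N) := Nat.pow_le_pow_right (by omega) (Nat.le_mul_of_pos_left _ hc0)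
      _ ≤ m ^ (c0 * N) * v i := Nat.le_mul_of_pos_right _ (hv i)
      _ = ∑ k, (A ^ (c0 * N)) i k * v k := h1.symm
      _ ≤ ∑ k, (A ^ (c0 * N)) i k * W := by gcongr; exact hvW _
      _ = (∑ k, (A ^ (c0 * N)) i k) * W := by rw [Finset.sum_mul]
      _ ≤ (∑ j ∈ T, (A ^ (c0 * (N+1))) i j) * W := by
        refine Nat.mul_le_mul_right _ ?_
        simp_rw [mul_add, mul_one, pow_add, Matrix.mul_apply]
        rw [Finset.sum_comm]
        refine Finset.sum_le_sum fun k _ => ?_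
        rw [← Finset.mul_sum]
        rcases Nat.eq_zero_or_pos ((A ^ (c0 * N)) i k) with h0 | h0
        · simp [h0]
        · obtain ⟨j, hj, hkj⟩ := hT k ((hP' N hN _ _).1 h0)
          refine Nat.le_mul_of_pos_right _ (lt_of_lt_of_le hkj ?_)
          exact Finset.single_le_sum (f := fun j => (A ^ c0) k j) (fun _ _ => Nat.zero_le _) hj
  refine ⟨c0, hc0, P, good, ?_, fun i hi => hi.1, hP', ?_⟩
  · intro i k hi hk
    have hki := hi.2 k hk
    refine ⟨⟨htr _ _ _ hki hk, fun l hl => htr _ _ _ (hi.2 l (htr _ _ _ hk hl)) hk⟩, fun l => ⟨htr _ _ _ hk, htr _ _ _ hki⟩⟩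
  · intro H
    refine ⟨H * W + 2, by omega, fun N hN => ?_⟩
    obtain ⟨N, rfl⟩ := Nat.exists_eq_add_of_le' (show 1 ≤ N by omega)
    have hNN : H * W < 2 ^ N := lt_of_le_of_lt (by omega) (Nat.lt_two_pow_self)
    refine ⟨fun i => ?_, fun i j hi hij => ?_⟩
    · have := cnt (Finset.univ.filter good) i (fun k _ => by
        obtain ⟨j, h1, h2⟩ := hgood k; exact ⟨j, by simp [h2], h1⟩) N (by omega)
      exact (lt_of_mul_lt_mul_right (hNN.trans_le this) (Nat.zero_le _)).le.trans_eq (Finset.sum_congr (by ext; simp) fun _ _ => rfl)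
    · have := cnt {j} i (fun k hk => ⟨j, by simp, htr _ _ _ (hi.2 k hk) hij⟩) N (by omega)
      rw [Finset.sum_singleton] at this
      exact (lt_of_mul_lt_mul_right (hNN.trans_le this) (Nat.zero_le _)).le
end
end GDB

namespace GDB
universe u

section
variable (F : Fam.{u})

def resF (good : F.V → Prop) (hcl : ∀ i, good i → ∀ e, good (F.tgt i e)) : Fam.{u} where
  V := {i // good i}
  E i := F.E i.1
  tgt i e := ⟨F.tgt i.1 e, hcl _ i.2 e⟩
  X i := F.X i.1
  dec i := F.dec i.1

theorem resF_R (good : F.V → Prop) (hcl : ∀ i, good i → ∀ e, good (F.tgt i e)) (n : ℕ) :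
    ∀ i x y, (resF F good hcl).R n i x y ↔ F.R n i.1 x y := by
  induction n with
  | zero => intros; exact Iff.rfl
  | succ n ih =>
    intro i x y
    constructor
    · rintro ⟨e, x', y', h1, h2, h3⟩
      exact ⟨e, x', y', h1, h2, (ih _ _ _).1 h3⟩
    · rintro ⟨e, x', y', h1, h2, h3⟩
      exact ⟨e, x', y', h1, h2, (ih ⟨_, hcl _ i.2 e⟩ _ _).2 h3⟩

theorem res_BL [∀ i, Fintype (F.E i)] (good : F.V → Prop)
    (hcl : ∀ i, good i → ∀ e, good (F.tgt i e)) (w : F.V → ℕ) (M : ℕ) (hM : 2 ≤ M)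
    (hw : ∀ i, good i → 0 < w i)
    (hpack : ∀ i, good i → ∃ a : F.E i → Fin (w i), ∀ k, ∑ e with a e = k, w (F.tgt i e) = M)
    (hne : ∀ i, Nonempty (F.X i)) (hs : ∀ i, F.Sep i) (hc : ∀ i, F.Comp i) :
    ∀ i, good i → BL (fun n => F.R n i) (RS M) := by
  intro i hi
  choose a ha using fun i : {i // good i} => hpack i.1 i.2
  choose Φ hΦ using fun i : {i // good i} => mkΦ _ (a i) (ha i)
  have hR := resF_R F good hcl
  have := tr_BL (F := resF F good hcl) (v := fun i => w i.1) (M := M) a Φ hΦ (by omega)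
    (fun i _ => hne i.1) ⟨i, hi⟩ (by
      intro x y h
      exact hs i x y fun n => (hR n ⟨i, hi⟩ x y).1 (h n)) (by
      intro s h
      obtain ⟨x, hx⟩ := hc i s (fun n => (hR n ⟨i, hi⟩ _ _).1 (h n))
      exact ⟨x, fun n => (hR n ⟨i, hi⟩ _ _).2 (hx n)⟩)
  have h2 := this.trans (hilbert_BL M (w i) hM (hw i hi))
  obtain ⟨f, c, hf⟩ := h2
  exact ⟨f, c, fun n x y => ⟨fun h => (hf n x y).1 ((hR _ ⟨i, hi⟩ _ _).2 h), fun h =>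
    (hR _ ⟨i, hi⟩ _ _).1 ((hf n x y).2 h)⟩⟩

def sub_X (good : F.V → Prop) (M : ℕ) : ({i // ¬ good i} ⊕ ℕ) → Type u
  | .inl j => F.X j.1
  | .inr b => ULift.{u} (Fin b × (ℕ → Fin M))

def sub_E (good : F.V → Prop) (M : ℕ) : ({i // ¬ good i} ⊕ ℕ) → Type
  | .inl j => F.E j.1
  | .inr b => Fin b × Fin M

def sub_tgt (good : F.V → Prop) (M : ℕ) (t' : ∀ i : {i // ¬ good i}, F.E i.1 → {i // ¬ good i} ⊕ ℕ) :
    ∀ t, sub_E F good M t → ({i // ¬ good i} ⊕ ℕ)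
  | .inl j => fun e => t' j e
  | .inr _ => fun _ => .inr 1

def symb_dec (b M : ℕ) : ULift.{u} (Fin b × (ℕ → Fin M)) ≃
    Σ _ : Fin b × Fin M, ULift.{u} (Fin 1 × (ℕ → Fin M)) where
  toFun x := ⟨(x.down.1, x.down.2 0), ⟨(0, fun n => x.down.2 (n+1))⟩⟩
  invFun q := ⟨(q.1.1, fun n => Nat.casesOn n q.1.2 q.2.down.2)⟩
  left_inv := by
    rintro ⟨x, z⟩
    simp only [ULift.up.injEq, Prod.mk.injEq, true_and]
    funext n; cases n <;> rfl
  right_inv := by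
    rintro ⟨⟨x, z⟩, ⟨t, y⟩⟩
    have : t = 0 := Subsingleton.elim _ _
    subst this
    rfl

def sub_dec (good : F.V → Prop) (M : ℕ) (t' : ∀ i : {i // ¬ good i}, F.E i.1 → {i // ¬ good i} ⊕ ℕ)
    (θ : ∀ i e, F.X (F.tgt i.1 e) ≃ sub_X F good M (t' i e)) :
    ∀ t, sub_X F good M t ≃ Σ e : sub_E F good M t, sub_X F good M (sub_tgt F good M t' t e)
  | .inl j => (F.dec j.1).trans (Equiv.sigmaCongrRight (θ j))
  | .inr b => symb_dec b M

def subF (good : F.V → Prop) (M : ℕ) (t' : ∀ i : {i // ¬ good i}, F.E i.1 → {i // ¬ good i} ⊕ ℕ)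
    (θ : ∀ i e, F.X (F.tgt i.1 e) ≃ sub_X F good M (t' i e)) : Fam.{u} where
  V := {i // ¬ good i} ⊕ ℕ
  E := sub_E F good M
  tgt := sub_tgt F good M t'
  X := sub_X F good M
  dec := sub_dec F good M t' θ

section
variable {F} {good : F.V → Prop} {M : ℕ} {t' : ∀ i : {i // ¬ good i}, F.E i.1 → {i // ¬ good i} ⊕ ℕ}
    {θ : ∀ i e, F.X (F.tgt i.1 e) ≃ sub_X F good M (t' i e)}

theorem subF_inr1 (n : ℕ) : ∀ (b : ℕ) (x y : ULift.{u} (Fin b × (ℕ → Fin M))), RD b M n x.down y.down →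
    (subF F good M t' θ).R n (.inr b) x y := by
  induction n with
  | zero => intros; trivial
  | succ n ih =>
    intro b x y h
    refine ⟨(x.down.1, x.down.2 0), ⟨(0, fun n => x.down.2 (n+1))⟩, ⟨(0, fun n => y.down.2 (n+1))⟩, rfl, ?_, ?_⟩
    · rw [h.1, h.2 0 (by omega)]; rfl
    · exact ih 1 _ _ ⟨rfl, fun k hk => h.2 (k+1) (by omega)⟩

theorem subF_inr2 (n : ℕ) : ∀ (b : ℕ) (x y : ULift.{u} (Fin b × (ℕ → Fin M))),
    (subF F good M t' θ).R (n+1) (.inr b) x y → RD b M (n+1) x.down y.down := by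
  induction n with
  | zero =>
    rintro b x y ⟨e, x', y', h1, h2, h3⟩
    have e1 : (x.down.1, x.down.2 0) = e := congrArg Sigma.fst h1
    have e2 : (y.down.1, y.down.2 0) = e := congrArg Sigma.fst h2
    have e3 := Prod.mk.inj (e1.trans e2.symm)
    refine ⟨e3.1, fun k hk => ?_⟩
    obtain rfl : k = 0 := by omega
    exact e3.2
  | succ n ih =>
    rintro b x y ⟨e, x', y', h1, h2, h3⟩
    have h1' : (symb_dec b M x) = ⟨e, x'⟩ := h1
    have h2' : (symb_dec b M y) = ⟨e, y'⟩ := h2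
    obtain ⟨e1, f1⟩ := Sigma.mk.inj h1'
    obtain ⟨e2, f2⟩ := Sigma.mk.inj h2'
    have e3 := Prod.mk.inj (e1.trans e2.symm)
    have h4 := ih 1 x' y' h3
    rw [← eq_of_heq f1, ← eq_of_heq f2] at h4
    refine ⟨e3.1, ?_⟩
    rintro (_ | k) hk
    · exact e3.2
    · exact h4.2 k (by omega)

end
end
end GDB

namespace GDB
universe u

def sub_v {F : Fam.{u}} {good : F.V → Prop} (v : F.V → ℕ) : ({i // ¬ good i} ⊕ ℕ) → ℕ
  | .inl j => v j.1
  | .inr b => b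

def SubProp {F : Fam.{u}} (good : F.V → Prop) (M : ℕ) (j : F.V) (t : {i // ¬ good i} ⊕ ℕ)
    (θ : F.X j ≃ sub_X F good M t) (c : ℕ) : Prop :=
  ∀ C ≥ c, ∀ n, ∀ Q : ∀ t : {i // ¬ good i} ⊕ ℕ, sub_X F good M t → sub_X F good M t → Prop,
    ((∀ b (x y : ULift.{u} (Fin b × (ℕ → Fin M))), RD b M n x.down y.down → Q (.inr b) x y) →
      (∀ (i : {i // ¬ good i}) (x y : F.X i.1), F.R (n+C) i.1 x y → Q (.inl i) x y) →
      ∀ x y, F.R (n+C) j x y → Q t (θ x) (θ y)) ∧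
    ((∀ b (x y : ULift.{u} (Fin b × (ℕ → Fin M))), Q (.inr b) x y → RD b M n x.down y.down) →
      (∀ (i : {i // ¬ good i}) (x y : F.X i.1), Q (.inl i) x y → F.R (n-C) i.1 x y) →
      ∀ x y, Q t (θ x) (θ y) → F.R (n-C) j x y)

theorem subProp_ex {F : Fam.{u}} (good : F.V → Prop) (M : ℕ) (hM : 2 ≤ M) (v : F.V → ℕ)
    (hg : ∀ i, good i → BL (fun n => F.R n i) (RS M)) (j : F.V) (s : ℕ) (hs0 : 0 < s)
    (hs : ¬ good j → s = v j) :
    ∃ (t : {i // ¬ good i} ⊕ ℕ) (θ : F.X j ≃ sub_X F good M t) (c : ℕ),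
      sub_v v t = s ∧ SubProp good M j t θ c := by
  by_cases hj : good j
  · obtain ⟨f, c, hf⟩ := (hg j hj).trans (hilbert_BL M s hM hs0).symm
    refine ⟨.inr s, f.trans Equiv.ulift.symm, c, rfl, fun C hC n Q => ⟨fun h1 h2 x y h => ?_, fun h1 h2 x y h => ?_⟩⟩
    · apply h1
      exact (hf n x y).1 (F.R_anti (by omega) _ _ _ h)
    · by_cases hn : n ≤ C
      · rw [Nat.sub_eq_zero_of_le hn]; trivial
      · have h3 := h1 _ _ _ h
        have h4 : RD s M (n - C + c) (f x) (f y) := ⟨h3.1, fun k hk => h3.2 k (by omega)⟩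
        exact (hf _ x y).2 h4
  · refine ⟨.inl ⟨j, hj⟩, Equiv.refl _, 0, (hs hj).symm, fun C hC n Q => ⟨fun h1 h2 x y h => ?_, fun h1 h2 x y h => ?_⟩⟩
    · exact h2 ⟨j, hj⟩ x y h
    · exact h2 ⟨j, hj⟩ x y h

theorem subst_BL (F : Fam.{u}) [Finite F.V] [∀ i, Fintype (F.E i)] (good : F.V → Prop)
    (v : F.V → ℕ) (M : ℕ) (hM : 2 ≤ M) (hv : ∀ i, 0 < v i)
    (hg : ∀ i, good i → BL (fun n => F.R n i) (RS M))
    (hpack : ∀ i, ¬ good i → ∃ s' : F.E i → ℕ, (∀ e, ¬ good (F.tgt i e) → s' e = v (F.tgt i e)) ∧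
      (∀ e, 0 < s' e) ∧ ∃ a : F.E i → Fin (v i), ∀ k, ∑ e with a e = k, s' e = M)
    (hne : ∀ i, Nonempty (F.X i)) (hs : ∀ i, F.Sep i) (hc : ∀ i, F.Comp i) :
    ∀ i, BL (fun n => F.R n i) (RS M) := by
  intro i0
  by_cases hi0 : good i0
  · exact hg i0 hi0
  choose s' hs1 hs2 a ha using fun i : {i // ¬ good i} => hpack i.1 i.2
  choose t' θ c ht hp using fun (i : {i // ¬ good i}) (e : F.E i.1) =>
    subProp_ex good M hM v hg (F.tgt i.1 e) (s' i e) (hs2 i e) (fun h => hs1 i e h)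
  obtain ⟨C0, hC0⟩ : ∃ C0, ∀ q : (Σ i : {i // ¬ good i}, F.E i.1), c q.1 q.2 ≤ C0 := by
    obtain ⟨C0, h⟩ := Set.finite_range (fun q : (Σ i : {i // ¬ good i}, F.E i.1) => c q.1 q.2) |>.bddAbove
    exact ⟨C0, fun q => h ⟨q, rfl⟩⟩
  set C := C0 + 1 with hC
  have hcC : ∀ i e, c i e ≤ C := fun i e => (hC0 ⟨i, e⟩).trans (by omega)
  let F' := subF F good M t' θ
  have cl1 : ∀ n (i : {i // ¬ good i}) (x y : F.X i.1), F.R (n+C) i.1 x y → F'.R n (.inl i) x y := by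
    intro n
    induction n with
    | zero => intros; trivial
    | succ n ih =>
      intro i x y h
      rw [show n + 1 + C = (n + C) + 1 by ring] at h
      obtain ⟨e, x', y', h1, h2, h3⟩ := h
      refine ⟨e, θ i e x', θ i e y', ?_, ?_, ?_⟩
      · change (Equiv.sigmaCongrRight (θ i)) (F.dec i.1 x) = _
        rw [h1]; rfl
      · change (Equiv.sigmaCongrRight (θ i)) (F.dec i.1 y) = _
        rw [h2]; rfl
      · exact ((hp i e) C (hcC i e) n (fun t => F'.R n t)).1 (subF_inr1 n) ih x' y' h3
  have cl2 : ∀ n (i : {i // ¬ good i}) (x y : F.X i.1), F'.R n (.inl i) x y → F.R (n-C) i.1 x y := by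
    intro n
    induction n with
    | zero => intro i x y _; rw [Nat.zero_sub]; trivial
    | succ n ih =>
      intro i x y h
      rcases n with _ | n
      · rw [Nat.sub_eq_zero_of_le (by omega)]; trivial
      obtain ⟨e, x2, y2, h1, h2, h3⟩ := h
      rcases hx : F.dec i.1 x with ⟨e1, x'⟩
      rcases hy : F.dec i.1 y with ⟨e2, y'⟩
      change (Equiv.sigmaCongrRight (θ i)) (F.dec i.1 x) = _ at h1
      change (Equiv.sigmaCongrRight (θ i)) (F.dec i.1 y) = _ at h2
      rw [hx] at h1
      rw [hy] at h2
      obtain ⟨rfl, f1⟩ := Sigma.mk.inj h1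
      obtain ⟨e3, f2⟩ := Sigma.mk.inj h2
      dsimp only at e3
      subst e3
      obtain rfl := eq_of_heq f1
      obtain rfl := eq_of_heq f2
      have h4 := ((hp i e2) C (hcC i e2) (n+1) (fun t => F'.R (n+1) t)).2 (subF_inr2 n) ih x' y' h3
      refine F.R_anti (k := (n + 1 - C) + 1) (by omega) _ _ _ ⟨e2, x', y', hx, hy, h4⟩
  have cl3 : ∀ n (i : {i // ¬ good i}) (x y : F.X i.1), F'.R (n+C) (.inl i) x y → F.R n i.1 x y := by
    intro n i x y h
    have := cl2 _ _ _ _ h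
    rwa [Nat.add_sub_cancel] at this
  have hΦ0 : ∀ i : F'.V, ∃ (a : F'.E i → Fin (sub_v v i))
      (Φ : (Σ e : F'.E i, Fin (sub_v v (F'.tgt i e))) ≃ Fin (sub_v v i) × Fin M), ∀ p, (Φ p).1 = a p.1 := by
    rintro (i | b)
    · have h : ∀ k, ∑ e with a i e = k, sub_v v (t' i e) = M := by
        intro k; rw [← ha i k]; exact Finset.sum_congr rfl fun e _ => ht i e
      obtain ⟨Φ, hΦ⟩ := mkΦ _ (a i) h
      exact ⟨a i, Φ, hΦ⟩
    · exact ⟨fun e => e.1, Equiv.sigmaUnique (Fin b × Fin M) (fun _ => Fin 1), fun p => rfl⟩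
  choose a' Φ' hΦ' using hΦ0
  have hne' : ∀ i : F'.V, Fin (sub_v v i) → Nonempty (F'.X i) := by
    rintro (i | b) t
    · exact hne i.1
    · exact ⟨⟨(t, fun _ => ⟨0, by omega⟩)⟩⟩
  have hsep : F'.Sep (.inl ⟨i0, hi0⟩) := fun x y h => hs i0 x y fun n => cl3 n ⟨i0, hi0⟩ x y (h _)
  have hcomp : F'.Comp (.inl ⟨i0, hi0⟩) := by
    intro s h
    obtain ⟨x, hx⟩ := hc i0 (fun n => s (n + C)) (fun n => cl3 n ⟨i0, hi0⟩ _ _ (by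
      have := h (n + C)
      rwa [show n + C + 1 = n + 1 + C by ring] at this))
    refine ⟨x, fun n => ?_⟩
    have hnm : ∀ m ≥ n, F'.R n (.inl ⟨i0, hi0⟩) (s n) (s m) := by
      intro m hm
      induction hm with
      | refl => exact Fam.R_refl _ _ _ _
      | step hm ih => exact Fam.R_trans _ _ _ _ _ _ ih (Fam.R_anti _ hm _ _ _ (h _))
    exact F'.R_trans _ _ _ _ _ (cl1 n ⟨i0, hi0⟩ _ _ (hx (n+C))) (F'.R_symm _ _ _ _ (hnm _ (by omega)))
  have h1 := tr_BL (F := F') (v := sub_v v) a' Φ' hΦ' (by omega) hne' (.inl ⟨i0, hi0⟩) hsep hcomp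
  have h2 : BL (fun n => F.R n i0) (fun n => F'.R n (.inl ⟨i0, hi0⟩)) :=
    ⟨Equiv.refl _, C, fun n x y => ⟨cl1 n ⟨i0, hi0⟩ x y, cl3 n ⟨i0, hi0⟩ x y⟩⟩
  exact (h2.trans h1).trans (hilbert_BL M (v i0) hM (hv i0))
end GDB

namespace GDB
universe u

theorem symb_first {M : ℕ} {x y : ℕ → Fin M} (h : x ≠ y) :
    ∃ k, (∀ r, symbDist r x y = r ^ k) ∧ RS M k x y ∧ ¬ RS M (k+1) x y := by
  have hne : {k : ℕ | x k ≠ y k}.Nonempty := by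
    by_contra hcon
    apply h
    funext k
    by_contra hk
    exact hcon ⟨k, hk⟩
  refine ⟨sInf {k : ℕ | x k ≠ y k}, fun r => by simp [symbDist, h], ?_, ?_⟩
  · intro k hk
    by_contra hc
    exact Nat.notMem_of_lt_sInf hk hc
  · intro hh
    exact Nat.sInf_mem hne (hh _ (by omega))

theorem BL_bilip {X : Type u} [MetricSpace X] [CompactSpace X] {p : ℕ} {r : ℝ}
    (G : GraphDirected X p r) (hr : 0 < r) (hr1 : r < 1) (i : Fin p) (M : ℕ)
    (h : BL (fun n => (gdF G hr).R n i) (RS M)) : BilipWithSymb (G.K i) M r := by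
  obtain ⟨f, c, hf⟩ := h
  obtain ⟨Δ, hΔ, hup⟩ := gdF_upper G hr
  obtain ⟨δ, hδ, hlo⟩ := gdF_lower G hr hr1
  set C := max 1 (max (Δ * (r ^ c)⁻¹) (δ * r ^ (c+1))⁻¹) with hC
  have hC1 : 1 ≤ C := le_max_left _ _
  have hC2 : Δ * (r ^ c)⁻¹ ≤ C := (le_max_left _ _).trans (le_max_right _ _)
  have hC3 : (δ * r ^ (c+1))⁻¹ ≤ C := (le_max_right _ _).trans (le_max_right _ _)
  have hC0 : 0 < C := by linarith
  refine ⟨f, f.bijective, C, hC1, fun (x : G.K i) (y : G.K i) => ?_⟩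
  by_cases hxy : x = y
  · subst hxy; simp [symbDist]
  obtain ⟨k, hk, h1, h2⟩ := symb_first (fun h => hxy (f.injective h) : f x ≠ f y)
  rw [hk]
  have hrc : 0 < r ^ c := pow_pos hr c
  constructor
  · have h3 := (hf (k - c) x y).2 
    have h3 : (gdF G hr).R (k - c) i x y := by
      by_cases hkc : k ≤ c
      · rw [Nat.sub_eq_zero_of_le hkc]; trivial
      · exact (hf (k - c) x y).2 (h1.anti (by omega))
    have h4 := hup _ _ _ _ h3
    rw [inv_mul_le_iff₀ hC0]
    refine h4.trans ?_
    have h5 : r ^ (k - c) ≤ (r ^ c)⁻¹ * r ^ k := by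
      rw [le_inv_mul_iff₀ hrc, ← pow_add]
      exact pow_le_pow_of_le_one hr.le hr1.le (by omega)
    calc Δ * r ^ (k - c) ≤ Δ * ((r ^ c)⁻¹ * r ^ k) := by gcongr
      _ = (Δ * (r ^ c)⁻¹) * r ^ k := by ring
      _ ≤ C * r ^ k := by gcongr
  · have h3 : ¬ (gdF G hr).R (k + 1 + c) i x y := fun h => h2 ((hf (k+1) x y).1 h)
    have h4 := hlo _ _ _ _ h3
    have h5 : r ^ k ≤ (δ * r ^ (c+1))⁻¹ * dist x y := by
      rw [le_inv_mul_iff₀ (by positivity)]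
      refine le_trans (le_of_eq ?_) h4
      ring
    exact h5.trans (mul_le_mul_of_nonneg_right hC3 dist_nonneg)
end GDB

namespace GDB
universe u

theorem sum_edges {p : ℕ} (a : Fin p → ℕ) (f : Fin p → ℕ) :
    ∑ e : (Σ j, Fin (a j)), f e.1 = ∑ j, a j * f j := by
  rw [Fintype.sum_sigma]; simp

theorem card_edges {p : ℕ} (a : Fin p → ℕ) (Q : Fin p → Prop) :
    (Finset.univ.filter fun e : (Σ j, Fin (a j)) => Q e.1).card = ∑ j with Q j, a j := by
  rw [Finset.card_filter, sum_edges a (fun j => if Q j then 1 else 0), Finset.sum_filter]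
  simp

theorem class_symb {X : Type u} [MetricSpace X] [CompactSpace X] {r : ℝ} (hr : 0 < r) (hr1 : r < 1)
    {m : ℕ} (hm : 2 ≤ m) {K : Set X} (hK : MemGDClass K r m) :
    ∃ c ≥ 1, ∀ N ≥ 1, BilipWithSymb K (m ^ (c * N)) (r ^ (c * N)) := by
  obtain ⟨p, hp, G, ⟨v, hv0, hv⟩, rfl⟩ := hK
  obtain ⟨w, hw0, hw⟩ := int_eigen G.a m v hv0 hv
  set A : Matrix (Fin p) (Fin p) ℕ := Matrix.of G.a with hA
  obtain ⟨c0, hc0, P, good, hg1, hg2, hP, hbig⟩ := mat_struct A w hw0 m hm hw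
  set W := ∑ i, w i with hW
  have hwW : ∀ i, w i ≤ W := fun i => Finset.single_le_sum (f := w) (fun _ _ => Nat.zero_le _) (Finset.mem_univ i)
  let g : Fin p → ℕ := fun i => (Finset.univ.filter (P i)).gcd w
  have hgd : ∀ i k, P i k → g i ∣ w k := fun i k h => Finset.gcd_dvd (by simp [h])
  have hgpos : ∀ i, good i → 0 < g i := fun i hi => Nat.pos_of_dvd_of_pos (hgd i i (hg2 i hi)) (hw0 i)
  have hgeq : ∀ i k, good i → P i k → g k = g i := by
    intro i k hi hk
    have := (hg1 i k hi hk).2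
    simp only [g]
    congr 1
    ext l; simp [this l]
  have hH : ∀ i, ∃ H, good i → ∀ q ≤ W, ∀ M ≥ H, ∀ (I : Type) [Fintype I] (κ : I → {k // P i k}),
      (∀ j, H ≤ (Finset.univ.filter fun i => κ i = j).card) →
      ∑ e, w (κ e) / g i = q * M →
      ∃ a : I → Fin q, ∀ k, ∑ e with a e = k, w (κ e) / g i = M := by
    intro i
    by_cases hi : good i
    · obtain ⟨H, hH⟩ := pack_rigid (fun k : {k // P i k} => w k / g i)
        (fun k => Nat.div_pos (Nat.le_of_dvd (hw0 _) (hgd i k k.2)) (hgpos i hi)) (by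
          intro d hd
          have h1 : d * g i ∣ g i := by
            refine Finset.dvd_gcd fun k hk => ?_
            have hk : P i k := by simpa using hk
            rw [mul_comm]
            exact Nat.mul_dvd_of_dvd_div (hgd i k hk) (hd ⟨k, hk⟩)
          have h2 := Nat.le_of_dvd (hgpos i hi) h1
          have h3 := hgpos i hi
          have h4 : d ≠ 0 := by
            rintro rfl
            simp at h1; omega
          nlinarith [Nat.pos_of_ne_zero h4]) W
      exact ⟨H, fun _ q hq M hM I _ κ h1 h2 => hH q hq M hM I κ (fun j => (h1 j).trans_eq (by congr)) h2⟩
    · exact ⟨0, fun h => absurd h hi⟩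
  choose H hH using hH
  set HH := ∑ i, H i + W * (W + 1) with hHH
  have hHle : ∀ i, H i ≤ HH := fun i =>
    (Finset.single_le_sum (f := H) (fun _ _ => Nat.zero_le _) (Finset.mem_univ i)).trans (by omega)
  obtain ⟨N0, hN0, hN⟩ := hbig HH
  refine ⟨c0 * (N0 + HH), Nat.mul_pos hc0 (by omega), fun N hN1 => ?_⟩
  rw [mul_assoc]
  set L := (N0 + HH) * N with hL
  have hLN : N0 + HH ≤ L := Nat.le_mul_of_pos_right _ hN1
  obtain ⟨hN2, hN3⟩ := hN L (by omega)
  have hc0L : 0 < c0 * L := Nat.mul_pos hc0 (by omega)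
  have hMHH : HH ≤ m ^ (c0 * L) := by
    calc HH ≤ c0 * L := (by omega : HH ≤ L).trans (Nat.le_mul_of_pos_left _ hc0)
      _ ≤ 2 ^ (c0 * L) := Nat.lt_two_pow_self.le
      _ ≤ m ^ (c0 * L) := Nat.pow_le_pow_left hm _
  have hM2 : 2 ≤ m ^ (c0 * L) := hm.trans (Nat.le_self_pow (by omega) m)
  set M := m ^ (c0 * L) with hM
  have heig := mat_eigen_pow A w m hw (c0 * L)
  rw [← hM] at heig
  obtain ⟨G', hK', ha'⟩ : ∃ G' : GraphDirected X p (r ^ (c0 * L)), G'.K = G.K ∧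
      ∀ i k, G'.a i k = (A ^ (c0 * L)) i k := by
    obtain ⟨e, he⟩ := Nat.exists_eq_add_of_le' hc0L
    rw [he]
    exact gd_pow hr G e
  have hr' : 0 < r ^ (c0 * L) := pow_pos hr _
  have hr1' : r ^ (c0 * L) < 1 := pow_lt_one₀ hr.le hr1 (by omega)
  rw [← hK']
  apply BL_bilip G' hr' hr1'
  let _ : ∀ i, Fintype ((gdF G' hr').E i) := fun i => inferInstanceAs (Fintype (Σ j, Fin (G'.a i j)))
  have _ : Finite (gdF G' hr').V := inferInstanceAs (Finite (Fin p))
  have hne : ∀ i, Nonempty ((gdF G' hr').X i) := fun i => (G'.nonempty i).to_subtype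
  have hsum : ∀ i, ∑ j, G'.a i j * w j = M * w i := by
    intro i; rw [← heig i]; exact Finset.sum_congr rfl fun j _ => by rw [ha']
  have hPe : ∀ i (e : Σ j, Fin (G'.a i j)), P i e.1 := by
    intro i e
    rw [← hP L (by omega), ← ha']
    exact e.2.pos
  have hgoodBL : ∀ i, good i → BL (fun n => (gdF G' hr').R n i) (RS M) := by
    refine res_BL (gdF G' hr') good (fun i hi e => (hg1 i _ hi (hPe i e)).1) (fun i => w i / g i) M hM2
      (fun i hi => Nat.div_pos (Nat.le_of_dvd (hw0 _) (hgd i i (hg2 i hi))) (hgpos i hi)) ?_ hne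
      (gdF_sep G' hr' hr1') (gdF_comp G' hr' hr1')
    intro (i : Fin p) hi
    obtain ⟨a, ha⟩ := hH i hi (w i / g i) ((Nat.div_le_self _ _).trans (hwW i)) M ((hHle i).trans hMHH)
      (Σ j, Fin (G'.a i j)) (fun e => ⟨e.1, hPe i e⟩) (by
        intro j
        refine ((hHle i).trans (hN3 i j hi j.2)).trans ?_
        have h5 : (Finset.univ.filter fun e : (Σ j, Fin (G'.a i j)) => e.1 = (j : Fin p)).card = G'.a i j := by
          rw [Finset.card_filter, sum_edges (G'.a i) (fun k => if k = (j : Fin p) then 1 else 0)]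
          simp
        rw [← ha', ← h5]
        refine Finset.card_le_card fun e he => ?_
        simp only [Finset.mem_filter, Finset.mem_univ, true_and] at he ⊢
        exact Subtype.ext he) (by
        rw [sum_edges (G'.a i) (fun j => w j / g i)]
        apply Nat.eq_of_mul_eq_mul_right (hgpos i hi)
        rw [Finset.sum_mul, mul_right_comm, Nat.div_mul_cancel (hgd i i (hg2 i hi)), mul_comm (w i), ← hsum i]
        refine Finset.sum_congr rfl fun j _ => ?_
        rcases Nat.eq_zero_or_pos (G'.a i j) with h0 | h0
        · simp [h0]
        · rw [mul_assoc, Nat.div_mul_cancel (hgd i j (hPe i ⟨j, ⟨0, h0⟩⟩))])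
    refine ⟨a, fun k => ?_⟩
    rw [← ha k]
    refine Finset.sum_congr rfl fun e _ => ?_
    change w e.1 / g e.1 = w e.1 / g i
    rw [hgeq i e.1 hi (hPe i e)]
  refine subst_BL (gdF G' hr') good w M hM2 hw0 hgoodBL ?_ hne (gdF_sep G' hr' hr1') (gdF_comp G' hr' hr1') _
  intro (i : Fin p) hi
  exact pack_flex (I := Σ j, Fin (G'.a i j)) (fun e => w e.1) W (w i) M (hw0 i) (fun e => ⟨hw0 _, hwW _⟩)
    (fun e => good e.1) (by rw [sum_edges (G'.a i) w, hsum, mul_comm]) (by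
      have h1 := hN2 i
      have h2 := hwW i
      have h3 : w i * (W + 1) ≤ W * (W+1) := by gcongr
      refine (show w i * (W+1) ≤ HH by omega).trans (h1.trans (le_of_eq ?_))
      rw [card_edges (G'.a i) good]
      exact Finset.sum_congr (by ext; simp) fun j _ => by rw [ha'])
end GDB

open MeasureTheory
namespace GDB

theorem words_le {M1 M2 k l : ℕ} (h1 : 1 ≤ M1) (f : (ℕ → Fin M1) → (ℕ → Fin M2))
    (h : ∀ x y, RS M2 l (f x) (f y) → RS M1 k x y) : M1 ^ k ≤ M2 ^ l := by
  let ext : (Fin k → Fin M1) → (ℕ → Fin M1) := fun w i => if hi : i < k then w ⟨i, hi⟩ else ⟨0, h1⟩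
  have := Fintype.card_le_of_injective
    (fun (w : Fin k → Fin M1) => fun i : Fin l => f (ext w) i) (by
      intro w w' hw
      have h2 := h (ext w) (ext w') (fun i hi => congrFun hw ⟨i, hi⟩)
      funext i
      have h3 := h2 i i.2
      simpa [ext] using h3)
  simpa using this

noncomputable def uni (M : ℕ) [NeZero M] : Measure (ℕ → Fin M) :=
  Measure.infinitePi (fun _ => (PMF.uniformOfFintype (Fin M)).toMeasure)

instance (M : ℕ) [NeZero M] : IsProbabilityMeasure (uni M) := by unfold uni; infer_instance

theorem cyl_eq {M : ℕ} (x : ℕ → Fin M) (n : ℕ) :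
    {y | RS M n x y} = Set.pi (Finset.range n) (fun i => {x i}) := by
  ext y; simp [RS, Set.mem_pi, eq_comm]

theorem cyl_meas {M : ℕ} (x : ℕ → Fin M) (n : ℕ) : MeasurableSet {y | RS M n x y} := by
  rw [cyl_eq]
  exact MeasurableSet.pi (Finset.countable_toSet _) (fun _ _ => MeasurableSet.singleton _)

theorem uni_cyl {M : ℕ} [NeZero M] (x : ℕ → Fin M) (n : ℕ) :
    (uni M).real {y | RS M n x y} = ((M:ℝ)⁻¹) ^ n := by
  rw [cyl_eq, Measure.real, uni, Measure.infinitePi_pi _ (fun _ _ => MeasurableSet.singleton _)]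
  simp

/-- a set saturated at level `n` -/
theorem sat_meas {M : ℕ} [NeZero M] (S : Set (ℕ → Fin M)) (n : ℕ) (hS : ∀ x ∈ S, ∀ y, RS M n x y → y ∈ S)
    (hne : S.Nonempty) : MeasurableSet S ∧ ∃ u : ℕ, 1 ≤ u ∧ (uni M).real S = u * ((M:ℝ)⁻¹) ^ n := by
  let T : (ℕ → Fin M) → (Fin n → Fin M) := fun x i => x i
  let E : (Fin n → Fin M) → (ℕ → Fin M) := fun w i => if hi : i < n then w ⟨i, hi⟩ else 0
  have hTE : ∀ w, T (E w) = w := by intro w; funext i; simp [T, E]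
  have hRS : ∀ x y, RS M n x y ↔ T x = T y := fun x y =>
    ⟨fun h => funext fun i => h i i.2, fun h i hi => congrFun h ⟨i, hi⟩⟩
  let U : Finset (Fin n → Fin M) := Finset.univ.filter fun w => E w ∈ S
  have hU : S = ⋃ w ∈ U, {y | RS M n (E w) y} := by
    ext y
    simp only [Set.mem_iUnion, Set.mem_setOf_eq, exists_prop, U, Finset.mem_filter, Finset.mem_univ, true_and]
    constructor
    · intro hy
      refine ⟨T y, hS y hy _ ?_, ?_⟩ <;> rw [hRS, hTE]
    · rintro ⟨w, hw, h⟩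
      exact hS _ hw _ h
  refine ⟨?_, U.card, ?_, ?_⟩
  · rw [hU]; exact Finset.measurableSet_biUnion _ fun w _ => cyl_meas _ _
  · obtain ⟨y, hy⟩ := hne
    refine Finset.card_pos.2 ⟨T y, ?_⟩
    simp only [U, Finset.mem_filter, Finset.mem_univ, true_and]
    refine hS y hy _ ?_
    rw [hRS, hTE]
  · conv_lhs => rw [hU]
    rw [measureReal_biUnion_finset]
    · simp [uni_cyl]
    · intro w _ w' _ hww
      rw [Function.onFun, Set.disjoint_left]
      intro y h1 h2
      rw [Set.mem_setOf_eq, hRS, hTE] at h1 h2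
      exact hww (h1.trans h2.symm)
    · intro w _; exact cyl_meas _ _

theorem rigid_pow {M1 M2 : ℕ} (h1 : 2 ≤ M1) (h2 : 2 ≤ M2) (f : (ℕ → Fin M1) ≃ (ℕ → Fin M2))
    (n : ℕ → ℕ) (c1 : ℕ) (hmono : Monotone n) (hD : ∀ B, ∃ D, ∀ k, n (k + B) ≤ n k + D)
    (ha : ∀ k x y, RS M2 (n k) (f x) (f y) → RS M1 k x y)
    (hb : ∀ k x y, RS M1 k x y → RS M2 (n k - c1) (f x) (f y)) :
    ∃ a b, 1 ≤ a ∧ M1 ^ a = M2 ^ b := by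
  haveI : NeZero M1 := ⟨by omega⟩
  haveI : NeZero M2 := ⟨by omega⟩
  let Z : (ℕ → Fin M1) → ℕ → Set (ℕ → Fin M2) := fun x k => f '' {y | RS M1 k x y}
  have hM2 : (0:ℝ) < M2 := by exact_mod_cast (by omega : 0 < M2)
  have hM1 : (0:ℝ) < M1 := by exact_mod_cast (by omega : 0 < M1)
  have hZ : ∀ x k, MeasurableSet (Z x k) ∧ ∃ u : ℕ, 1 ≤ u ∧ (uni M2).real (Z x k) = u * ((M2:ℝ)⁻¹) ^ (n k) := by
    intro x k
    apply sat_meas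
    · rintro _ ⟨y, hy, rfl⟩ z hz
      refine ⟨f.symm z, ?_, by simp⟩
      have := ha k y (f.symm z) (by simpa using hz)
      intro i hi
      exact (hy i hi).trans (this i hi)
    · exact ⟨f x, x, fun _ _ => rfl, rfl⟩
  choose hZm u hu1 hu using hZ
  set B := M2 ^ c1 with hB
  have huB : ∀ x k, u x k ≤ B := by
    intro x k
    have h3 : (uni M2).real (Z x k) ≤ ((M2:ℝ)⁻¹) ^ (n k - c1) := by
      rw [← uni_cyl (f x)]
      refine measureReal_mono ?_
      rintro _ ⟨y, hy, rfl⟩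
      exact hb k x y hy
    rw [hu, inv_pow, inv_pow, ← div_eq_mul_inv, div_le_iff₀ (by positivity), ← div_eq_inv_mul, le_div_iff₀ (by positivity)] at h3
    have h4 : u x k * M2 ^ (n k - c1) ≤ M2 ^ n k := by exact_mod_cast h3
    have h5 : M2 ^ n k ≤ B * M2 ^ (n k - c1) := by
      rw [hB, ← pow_add]; exact Nat.pow_le_pow_right (by omega) (by omega)
    exact Nat.le_of_mul_le_mul_right (h4.trans h5) (by positivity)
  let g : (ℕ → Fin M1) → ℕ → ℝ := fun x k => (uni M2).real (Z x k) * M1 ^ k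
  have hgu : ∀ x k, g x k = u x k * M1 ^ k / M2 ^ n k := by
    intro x k; simp only [g, hu, inv_pow]; field_simp
  have hg0 : ∀ x k, 0 < g x k := by
    intro x k; rw [hgu]
    have : (0:ℝ) < u x k := by exact_mod_cast hu1 x k
    positivity
  have hgB : ∀ x k, g x k ≤ B := by
    intro x k
    rw [hgu, div_le_iff₀ (by positivity)]
    have := words_le (by omega) f (ha k)
    exact_mod_cast Nat.mul_le_mul (huB x k) this
  let S := sSup (Set.range fun q : (ℕ → Fin M1) × ℕ => g q.1 q.2)
  have hbdd : BddAbove (Set.range fun q : (ℕ → Fin M1) × ℕ => g q.1 q.2) :=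
    ⟨B, by rintro _ ⟨q, rfl⟩; exact hgB _ _⟩
  have hgS : ∀ x k, g x k ≤ S := fun x k => le_csSup hbdd ⟨(x, k), rfl⟩
  have hS0 : 0 < S := (hg0 (fun _ => 0) 0).trans_le (hgS _ _)
  have hstep : ∀ x k, S - g x (k+1) ≤ M1 * (S - g x k) := by
    intro x k
    have hun : Z x k = ⋃ a ∈ (Finset.univ : Finset (Fin M1)), Z (Function.update x k a) (k+1) := by
      ext z
      simp only [Finset.mem_univ, Set.iUnion_true, Set.mem_iUnion, Z, Set.mem_image, Set.mem_setOf_eq]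
      constructor
      · rintro ⟨y, hy, rfl⟩
        refine ⟨y k, y, fun i hi => ?_, rfl⟩
        by_cases hik : i = k
        · subst hik; simp
        · rw [Function.update_of_ne hik]; exact hy i (by omega)
      · rintro ⟨a, y, hy, rfl⟩
        refine ⟨y, fun i hi => ?_, rfl⟩
        rw [← hy i (by omega), Function.update_of_ne (by omega)]
    have hsum : (uni M2).real (Z x k) = ∑ a, (uni M2).real (Z (Function.update x k a) (k+1)) := by
      conv_lhs => rw [hun]
      rw [measureReal_biUnion_finset]
      · intro a _ b _ hab
        rw [Function.onFun, Set.disjoint_left]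
        rintro _ ⟨y, hy, rfl⟩ ⟨y', hy', hyy⟩
        have := f.injective hyy
        subst this
        have h3 := hy k (by omega)
        have h4 := hy' k (by omega)
        simp only [Function.update_self] at h3 h4
        exact hab (h3.trans h4.symm)
      · intro a _; exact hZm _ _
    have hsum2 : M1 * g x k = ∑ a, g (Function.update x k a) (k+1) := by
      simp only [g]
      rw [← Finset.sum_mul, ← hsum, pow_succ]; ring
    rw [← Finset.add_sum_erase _ _ (Finset.mem_univ (x k)), Function.update_eq_self] at hsum2
    have h5 : ∑ a ∈ Finset.univ.erase (x k), g (Function.update x k a) (k+1) ≤ (M1 - 1) * S := by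
      refine (Finset.sum_le_card_nsmul _ _ S fun a _ => hgS _ _).trans (le_of_eq ?_)
      rw [Finset.card_erase_of_mem (Finset.mem_univ _), nsmul_eq_mul, Finset.card_univ, Fintype.card_fin,
        Nat.cast_sub (by omega)]; simp
    linarith
  have hchain : ∀ x k j, S - g x (k+j) ≤ M1 ^ j * (S - g x k) := by
    intro x k j
    induction j with
    | zero => simp
    | succ j ih =>
      calc S - g x (k + j + 1) ≤ M1 * (S - g x (k+j)) := hstep _ _
        _ ≤ M1 * (M1 ^ j * (S - g x k)) := by gcongr
        _ = _ := by ring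
  obtain ⟨D, hD⟩ := hD B
  set ε : ℝ := S / 2 / M2 ^ D with hε
  have hε0 : 0 < ε := by positivity
  have hM1pow : ∀ j, (1:ℝ) ≤ M1 ^ j := fun j => one_le_pow₀ (by exact_mod_cast (by omega : 1 ≤ M1))
  have hεS : ε ≤ S / 2 := div_le_self (by positivity) (one_le_pow₀ (by exact_mod_cast (by omega : 1 ≤ M2)))
  obtain ⟨_, ⟨⟨x, k⟩, rfl⟩, hxk⟩ := exists_lt_of_lt_csSup (Set.range_nonempty _)
    (show S - ε / M1 ^ B < sSup (Set.range fun q : (ℕ → Fin M1) × ℕ => g q.1 q.2) from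
      sub_lt_self S (by positivity))
  simp only at hxk
  have hclose : ∀ j ≤ B, S - g x (k+j) < ε := by
    intro j hj
    have h3 : S - g x k < ε / M1 ^ B := by linarith
    rw [lt_div_iff₀ (by positivity)] at h3
    refine (hchain x k j).trans_lt (lt_of_le_of_lt ?_ h3)
    rw [mul_comm]
    have := hgS x k
    refine mul_le_mul_of_nonneg_left ?_ (by linarith)
    exact pow_le_pow_right₀ (by exact_mod_cast (by omega : 1 ≤ M1)) hj
  obtain ⟨i, hi, j, hj, hij, huij⟩ := Finset.exists_ne_map_eq_of_card_lt_of_maps_to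
    (s := Finset.range (B+1)) (t := Finset.Icc 1 B) (f := fun j => u x (k+j)) (by simp)
    (fun j _ => by simp only [Finset.coe_Icc, Set.mem_Icc]; exact ⟨hu1 _ _, huB _ _⟩)
  wlog hlt : i < j generalizing i j
  · exact this j hj i hi hij.symm huij.symm (by omega)
  simp only [Finset.mem_range] at hi hj
  have hnle : n (k+i) ≤ n (k+j) := hmono (by omega)
  have hbD : n (k+j) - n (k+i) ≤ D := by
    have h3 := hD k
    have h4 : n (k+j) ≤ n (k+B) := hmono (by omega)
    have h5 : n k ≤ n (k+i) := hmono (by omega)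
    omega
  obtain ⟨b, hbeq⟩ := Nat.exists_eq_add_of_le hnle
  obtain ⟨a, haeq⟩ := Nat.exists_eq_add_of_lt hlt
  refine ⟨a + 1, b, by omega, ?_⟩
  by_contra hne
  have hrat : g x (k+j) * M2 ^ b = g x (k+i) * M1 ^ (a+1) := by
    rw [hgu, hgu, hbeq, ← huij, haeq]
    field_simp
    ring
  have hi' := hclose i (by omega)
  have hj' := hclose j (by omega)
  have hiS := hgS x (k+i)
  have hjS := hgS x (k+j)
  have hbD' : b ≤ D := by omega
  have hpw : (M2:ℝ) ^ b ≤ M2 ^ D := pow_le_pow_right₀ (by exact_mod_cast (by omega : 1 ≤ M2)) hbD'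
  have hεb : ε * M2 ^ b ≤ S / 2 := by
    calc ε * M2 ^ b ≤ ε * M2 ^ D := by gcongr
      _ = S / 2 := by rw [hε]; field_simp
  have hb0 : (0:ℝ) < M2 ^ b := by positivity
  rcases lt_or_gt_of_ne hne with h | h
  · have h' : (M1:ℝ) ^ (a+1) + 1 ≤ M2 ^ b := by exact_mod_cast h
    nlinarith [mul_lt_mul_of_pos_right (show g x (k+i) - g x (k+j) < ε by linarith) hb0, hg0 x (k+i)]
  · have h' : (M2:ℝ) ^ b + 1 ≤ M1 ^ (a+1) := by exact_mod_cast h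
    nlinarith [mul_lt_mul_of_pos_right (show g x (k+j) - g x (k+i) < ε by linarith) hb0, hg0 x (k+i)]

end GDB

namespace GDB

theorem rigid {M1 M2 : ℕ} (h1 : 2 ≤ M1) (h2 : 2 ≤ M2) {ρ1 ρ2 : ℝ} (hρ1 : 0 < ρ1) (hρ1' : ρ1 < 1)
    (hρ2 : 0 < ρ2) (hρ2' : ρ2 < 1) (f : (ℕ → Fin M1) → (ℕ → Fin M2)) (hf : Function.Bijective f)
    (C : ℝ) (hC : 1 ≤ C) (hfC : ∀ x y, C⁻¹ * symbDist ρ1 x y ≤ symbDist ρ2 (f x) (f y) ∧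
      symbDist ρ2 (f x) (f y) ≤ C * symbDist ρ1 x y) :
    ∃ a b : ℕ, 1 ≤ a ∧ 1 ≤ b ∧ ρ1 ^ a = ρ2 ^ b ∧ M1 ^ a = M2 ^ b := by
  set L1 := - Real.log ρ1 with hL1
  set L2 := - Real.log ρ2 with hL2
  have hL1p : 0 < L1 := by have := Real.log_neg hρ1 hρ1'; linarith
  have hL2p : 0 < L2 := by have := Real.log_neg hρ2 hρ2'; linarith
  have hCp : 0 < C := by linarith
  set θ := L1 / L2 with hθ
  have hθp : 0 < θ := div_pos hL1p hL2p
  set c' := Real.log C / L2 with hc'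
  obtain ⟨c0, hc0⟩ := exists_nat_ge c'
  have key : ∀ k l : ℕ, C⁻¹ * ρ1 ^ k ≤ ρ2 ^ l → ρ2 ^ l ≤ C * ρ1 ^ k →
      (l:ℝ) ≤ k * θ + c' ∧ k * θ - c' ≤ l := by
    intro k l h3 h4
    have h5 := Real.log_le_log (by positivity) h3
    have h6 := Real.log_le_log (by positivity) h4
    rw [Real.log_mul (by positivity) (by positivity), Real.log_pow, Real.log_pow, Real.log_inv] at h5
    rw [Real.log_mul (by positivity) (by positivity), Real.log_pow, Real.log_pow] at h6
    constructor
    · rw [hθ, hc', mul_div_assoc', ← add_div, le_div_iff₀ hL2p]; rw [hL1, hL2]; linarith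
    · rw [hθ, hc', mul_div_assoc', ← sub_div, div_le_iff₀ hL2p]; rw [hL1, hL2]; linarith
  have key2 : ∀ x y, x ≠ y → ∃ k l : ℕ, RS M1 k x y ∧ ¬ RS M1 (k+1) x y ∧ RS M2 l (f x) (f y) ∧
      ¬ RS M2 (l+1) (f x) (f y) ∧ (l:ℝ) ≤ k * θ + c' ∧ k * θ - c' ≤ l := by
    intro x y hxy
    obtain ⟨k, hk, hk1, hk2⟩ := symb_first hxy
    obtain ⟨l, hl, hl1, hl2⟩ := symb_first (fun h => hxy (hf.1 h) : f x ≠ f y)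
    have := hfC x y
    rw [hk, hl] at this
    exact ⟨k, l, hk1, hk2, hl1, hl2, key k l this.1 this.2⟩
  let n : ℕ → ℕ := fun k => ⌈(k:ℝ) * θ⌉₊ + c0
  have hn1 : ∀ k : ℕ, (k:ℝ) * θ + c0 ≤ n k := by
    intro k; simp only [n]; push_cast; linarith [Nat.le_ceil ((k:ℝ) * θ)]
  have hn2 : ∀ k : ℕ, (n k : ℝ) ≤ k * θ + c0 + 1 := by
    intro k; simp only [n]; push_cast
    linarith [Nat.ceil_lt_add_one (show 0 ≤ (k:ℝ) * θ by positivity)]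
  have hmono : Monotone n := by
    intro a b hab
    simp only [n]
    gcongr
  have hD : ∀ B, ∃ D, ∀ k, n (k + B) ≤ n k + D := by
    intro B
    obtain ⟨D, hD⟩ := exists_nat_ge (B * θ + 1)
    refine ⟨D, fun k => ?_⟩
    have h3 := hn1 k
    have h4 := hn2 (k + B)
    push_cast at h4
    have : (n (k+B) : ℝ) ≤ n k + D := by linarith
    exact_mod_cast this
  have ha : ∀ k x y, RS M2 (n k) (f x) (f y) → RS M1 k x y := by
    intro k x y h
    by_cases hxy : x = y
    · subst hxy; exact fun _ _ => rfl
    obtain ⟨k', l, e1, e2, e3, e4, e5, e6⟩ := key2 x y hxy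
    by_cases hk : k ≤ k'
    · exact e1.anti hk
    exfalso
    have hl : n k ≤ l := by
      by_contra hcon
      exact e4 (h.anti (by omega))
    have hl' : (n k : ℝ) ≤ l := by exact_mod_cast hl
    have hk' : (k':ℝ) + 1 ≤ k := by exact_mod_cast (by omega : k' + 1 ≤ k)
    have := hn1 k
    nlinarith
  have hb : ∀ k x y, RS M1 k x y → RS M2 (n k - (2 * c0 + 1)) (f x) (f y) := by
    intro k x y h
    by_cases hxy : x = y
    · subst hxy; exact fun _ _ => rfl
    obtain ⟨k', l, e1, e2, e3, e4, e5, e6⟩ := key2 x y hxy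
    have hk : k ≤ k' := by
      by_contra hcon
      exact e2 (h.anti (by omega))
    have hk' : (k:ℝ) * θ ≤ k' * θ := by gcongr
    have h3 := hn2 k
    have : (n k : ℝ) ≤ l + (2 * c0 + 1) := by linarith
    have : n k ≤ l + (2 * c0 + 1) := by exact_mod_cast this
    exact e3.anti (by omega)
  obtain ⟨a, b, ha1, hab⟩ := rigid_pow h1 h2 (Equiv.ofBijective f hf) n _ hmono hD ha hb
  have hle1 : ∀ k, M1 ^ k ≤ M2 ^ n k := fun k => words_le (by omega) f (ha k)
  have hle2 : ∀ k, M2 ^ (n k - (2 * c0 + 1)) ≤ M1 ^ k := fun k =>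
    words_le (by omega) (Equiv.ofBijective f hf).symm (fun x y h => by
      have := hb k _ _ h
      have e : ∀ z, f ((Equiv.ofBijective f hf).symm z) = z := fun z => (Equiv.ofBijective f hf).apply_symm_apply z
      rwa [e, e] at this)
  have hj1 : ∀ j, b * j ≤ n (a * j) := by
    intro j
    have := hle1 (a * j)
    rw [pow_mul, hab, ← pow_mul] at this
    exact (Nat.pow_le_pow_iff_right (by omega)).1 this
  have hj2 : ∀ j, n (a * j) ≤ b * j + (2 * c0 + 1) := by
    intro j
    have := hle2 (a * j)
    rw [pow_mul, hab, ← pow_mul] at this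
    have := (Nat.pow_le_pow_iff_right (by omega)).1 this
    omega
  have hunb : ∀ t : ℝ, ∀ c : ℝ, (∀ j : ℕ, j * t ≤ c) → t ≤ 0 := by
    intro t c h
    by_contra hcon
    push Not at hcon
    obtain ⟨j, hj⟩ := exists_nat_gt (c / t)
    rw [div_lt_iff₀ hcon] at hj
    exact absurd (h j) (by linarith)
  have hθ1 : (b:ℝ) - a * θ ≤ 0 := hunb _ (c0 + 1) fun j => by
    have h3 : ((b * j : ℕ):ℝ) ≤ n (a * j) := by exact_mod_cast hj1 j
    have h4 := hn2 (a * j)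
    push_cast at h3 h4
    linarith
  have hθ2 : a * θ - b ≤ 0 := hunb _ (2 * c0 + 1) fun j => by
    have h3 : (n (a * j) : ℝ) ≤ ((b * j + (2 * c0 + 1) : ℕ):ℝ) := by exact_mod_cast hj2 j
    have h4 := hn1 (a * j)
    push_cast at h3 h4
    have : (0:ℝ) ≤ c0 := by positivity
    linarith
  have hθe : a * θ = b := by linarith
  refine ⟨a, b, ha1, ?_, ?_, hab⟩
  · rcases Nat.eq_zero_or_pos b with h | h
    · subst h
      have := Nat.one_lt_pow (by omega : a ≠ 0) (by omega : 1 < M1)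
      simp at hab; omega
    · exact h
  · apply Real.log_injOn_pos (by simp; positivity) (by simp; positivity)
    rw [Real.log_pow, Real.log_pow]
    rw [hθ, mul_div_assoc', div_eq_iff hL2p.ne'] at hθe
    rw [hL1, hL2] at hθe
    linarith

theorem main {X : Type*} {X' : Type*} [MetricSpace X] [CompactSpace X] [MetricSpace X'] [CompactSpace X']
    {r₁ r₂ : ℝ} (hr₁ : r₁ ∈ Set.Ioo (0 : ℝ) 1) (hr₂ : r₂ ∈ Set.Ioo (0 : ℝ) 1)
    {m₁ m₂ : ℕ} (hm₁ : 2 ≤ m₁) (hm₂ : 2 ≤ m₂)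
    {K : Set X} {K' : Set X'}
    (hK : MemGDClass K r₁ m₁) (hK' : MemGDClass K' r₂ m₂) :
    BilipEquivSets K K' ↔
      ∃ k₁ k₂ : ℕ, 1 ≤ k₁ ∧ 1 ≤ k₂ ∧ r₁ ^ k₁ = r₂ ^ k₂ ∧ m₁ ^ k₁ = m₂ ^ k₂ := by
  obtain ⟨c1, hc1, H1⟩ := class_symb hr₁.1 hr₁.2 hm₁ hK
  obtain ⟨c2, hc2, H2⟩ := class_symb hr₂.1 hr₂.2 hm₂ hK'
  constructor
  · rintro ⟨h, hh, C, hC, hCh⟩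
    have H1' := H1 1 le_rfl
    have H2' := H2 1 le_rfl
    rw [mul_one] at H1' H2'
    obtain ⟨f1, hf1, C1, hC1, hC1f⟩ := H1'
    obtain ⟨f2, hf2, C2, hC2, hC2f⟩ := H2'
    let e1 := Equiv.ofBijective f1 hf1
    have hC0 : 0 < C := by linarith
    have hC10 : 0 < C1 := by linarith
    have hC20 : 0 < C2 := by linarith
    obtain ⟨a, b, ha, hb, h1, h2⟩ := rigid (M1 := m₁ ^ c1) (M2 := m₂ ^ c2) (ρ1 := r₁ ^ c1) (ρ2 := r₂ ^ c2)
      (hm₁.trans (Nat.le_self_pow (by omega) _)) (hm₂.trans (Nat.le_self_pow (by omega) _))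
      (pow_pos hr₁.1 _) (pow_lt_one₀ hr₁.1.le hr₁.2 (by omega))
      (pow_pos hr₂.1 _) (pow_lt_one₀ hr₂.1.le hr₂.2 (by omega))
      (f2 ∘ h ∘ e1.symm) (hf2.comp (hh.comp e1.symm.bijective)) (C2 * C * C1)
      (one_le_mul_of_one_le_of_one_le (one_le_mul_of_one_le_of_one_le hC2 hC) hC1) (by
        intro x y
        obtain ⟨x, rfl⟩ := e1.surjective x
        obtain ⟨y, rfl⟩ := e1.surjective y
        simp only [Function.comp_apply, Equiv.symm_apply_apply]
        have p1 : C1⁻¹ * dist x y ≤ symbDist (r₁ ^ c1) (e1 x) (e1 y) ∧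
          symbDist (r₁ ^ c1) (e1 x) (e1 y) ≤ C1 * dist x y := hC1f x y
        have p2 := hCh x y
        have p3 := hC2f (h x) (h y)
        rw [inv_mul_le_iff₀ hC10] at p1
        rw [inv_mul_le_iff₀ hC0] at p2
        rw [inv_mul_le_iff₀ hC20] at p3
        constructor
        · rw [inv_mul_le_iff₀ (by positivity)]
          calc _ ≤ C1 * dist x y := p1.2
            _ ≤ C1 * (C * dist (h x) (h y)) := by gcongr; exact p2.1
            _ ≤ C1 * (C * (C2 * symbDist (r₂ ^ c2) (f2 (h x)) (f2 (h y)))) := by gcongr; exact p3.1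
            _ = _ := by ring
        · calc _ ≤ C2 * dist (h x) (h y) := p3.2
            _ ≤ C2 * (C * dist x y) := by gcongr; exact p2.2
            _ ≤ C2 * (C * (C1 * symbDist (r₁ ^ c1) (e1 x) (e1 y))) := by gcongr; exact p1.1
            _ = _ := by ring)
    refine ⟨c1 * a, c2 * b, Nat.mul_pos hc1 ha, Nat.mul_pos hc2 hb, ?_, ?_⟩
    · rw [pow_mul, pow_mul]; exact h1
    · rw [pow_mul, pow_mul]; exact h2
  · rintro ⟨k1, k2, hk1, hk2, h1, h2⟩
    obtain ⟨f1, hf1, C1, hC1, hC1f⟩ := H1 (k1 * c2) (Nat.mul_pos hk1 hc2)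
    have H2' := H2 (k2 * c1) (Nat.mul_pos hk2 hc1)
    have e1 : m₂ ^ (c2 * (k2 * c1)) = m₁ ^ (c1 * (k1 * c2)) := by
      rw [show c2 * (k2 * c1) = k2 * (c1 * c2) by ring, show c1 * (k1 * c2) = k1 * (c1 * c2) by ring,
        pow_mul m₂, pow_mul m₁, h2]
    have e2 : r₂ ^ (c2 * (k2 * c1)) = r₁ ^ (c1 * (k1 * c2)) := by
      rw [show c2 * (k2 * c1) = k2 * (c1 * c2) by ring, show c1 * (k1 * c2) = k1 * (c1 * c2) by ring,
        pow_mul r₂, pow_mul r₁, h1]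
    rw [e1, e2] at H2'
    obtain ⟨f2, hf2, C2, hC2, hC2f⟩ := H2'
    let g2 := Equiv.ofBijective f2 hf2
    have hC10 : 0 < C1 := by linarith
    have hC20 : 0 < C2 := by linarith
    refine ⟨g2.symm ∘ f1, g2.symm.bijective.comp hf1, C2 * C1, one_le_mul_of_one_le_of_one_le hC2 hC1, ?_⟩
    intro x y
    have p1 := hC1f x y
    have p2 := hC2f (g2.symm (f1 x)) (g2.symm (f1 y))
    have e : ∀ z, f2 (g2.symm z) = z := fun z => g2.apply_symm_apply z
    rw [e, e] at p2
    simp only [Function.comp_apply]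
    rw [inv_mul_le_iff₀ hC10] at p1
    rw [inv_mul_le_iff₀ hC20] at p2
    constructor
    · rw [inv_mul_le_iff₀ (by positivity)]
      calc _ ≤ C1 * _ := p1.1
        _ ≤ C1 * (C2 * dist (g2.symm (f1 x)) (g2.symm (f1 y))) := by gcongr; exact p2.2
        _ = _ := by ring
    · calc _ ≤ C2 * _ := p2.1
        _ ≤ C2 * (C1 * dist x y) := by gcongr; exact p1.2
        _ = _ := by ring
end GDB

/-- **Theorem 2 (rigidity).** For `K ∈ 𝔄_{m₁}^{r₁}` and `K' ∈ 𝔄_{m₂}^{r₂}`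
(with `r₁, r₂ ∈ (0,1)` and integers `m₁, m₂ ≥ 2`), `K` and `K'` are bilipschitz
equivalent iff `r₁^{k₁} = r₂^{k₂}` and `m₁^{k₁} = m₂^{k₂}` for some integers
`k₁, k₂ ≥ 1`. -/
theorem gdClass_bilip_iff
    {X X' : Type*} [MetricSpace X] [CompactSpace X] [MetricSpace X'] [CompactSpace X']
    {r₁ r₂ : ℝ} (hr₁ : r₁ ∈ Set.Ioo (0 : ℝ) 1) (hr₂ : r₂ ∈ Set.Ioo (0 : ℝ) 1)
    {m₁ m₂ : ℕ} (hm₁ : 2 ≤ m₁) (hm₂ : 2 ≤ m₂)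
    {K : Set X} {K' : Set X'}
    (hK : MemGDClass K r₁ m₁) (hK' : MemGDClass K' r₂ m₂) :
    BilipEquivSets K K' ↔
      ∃ k₁ k₂ : ℕ, 1 ≤ k₁ ∧ 1 ≤ k₂ ∧ r₁ ^ k₁ = r₂ ^ k₂ ∧ m₁ ^ k₁ = m₂ ^ k₂ := by
  exact GDB.main hr₁ hr₂ hm₁ hm₂ hK hK'
end
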